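/- Let C > 0 be arbitrary. Then there is a constant K (depending only on C) such that for all x ≥ 2, |Σ_{p ≤ x} G_{g ANY, h ANY}(p)/(p-1) − S · Li(x)| ≤ K · x / (log x)^C, where the sum is over primes p ≤ x and S = ∏_q (1 − q/(q³ − 1)) is the Stephens constant, the product being over all primes q. -/

import Mathlib

namespace SW
section P1
open Complex MeasureTheory Filter Topology

/-- error term of the partial sums -/
noncomputable def Er (f : ℕ → ℂ) (κ : ℂ) (u : ℝ) : ℂ := (∑ k ∈ Finset.Icc 1 ⌊u⌋₊, f k) - κ * u

/-- truncated error term -/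
noncomputable def Gt (f : ℕ → ℂ) (κ : ℂ) (N : ℕ) (u : ℝ) : ℂ :=
  if (N : ℝ) < u then Er f κ u - Er f κ N else 0

lemma summable_of_bdd {f : ℕ → ℂ} (hf : ∀ n, ‖f n‖ ≤ 1) {s : ℂ} (hs : 1 < s.re) :
    LSeriesSummable f s :=
  LSeriesSummable_of_bounded_of_one_lt_re (m := 1) (fun n _ => hf n) hs

lemma tail_partial (f : ℕ → ℂ) (N M : ℕ) :
    ∑ k ∈ Finset.Icc 1 M, (if k ≤ N then 0 else f k) =
      if N < M then (∑ k ∈ Finset.Icc 1 M, f k) - ∑ k ∈ Finset.Icc 1 N, f k else 0 := by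
  split_ifs with h
  · rw [eq_sub_iff_add_eq]
    have : ∑ k ∈ Finset.Icc 1 N, f k = ∑ k ∈ Finset.Icc 1 M, (if k ≤ N then f k else 0) := by
      rw [← Finset.sum_filter]
      congr 1
      ext k
      simp
      omega
    rw [this, ← Finset.sum_add_distrib]
    apply Finset.sum_congr rfl
    intro k _
    split_ifs <;> simp
  · apply Finset.sum_eq_zero
    intro k hk
    simp at hk
    rw [if_pos (by omega)]

lemma locInt_partial (f : ℕ → ℂ) :
    LocallyIntegrableOn (fun t : ℝ => ∑ k ∈ Finset.Icc 1 ⌊t⌋₊, f k) (Set.Ici 0) := by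
  have := locallyIntegrableOn_mul_sum_Icc (𝕜 := ℂ) f (m := 1) (a := 0) le_rfl
    (g := fun _ => 1) ((locallyIntegrable_const 1).locallyIntegrableOn _)
  simpa using this

lemma locInt_Gt (f : ℕ → ℂ) (κ : ℂ) (N : ℕ) :
    LocallyIntegrableOn (Gt f κ N) (Set.Ioi 0) := by
  have h1 : LocallyIntegrableOn (fun u : ℝ => Er f κ u - Er f κ N) (Set.Ioi 0) := by
    apply LocallyIntegrableOn.mono_set (s := Set.Ici 0) _ Set.Ioi_subset_Ici_self
    apply LocallyIntegrableOn.sub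
    · apply LocallyIntegrableOn.sub (locInt_partial f)
      apply Continuous.locallyIntegrable (by fun_prop) |>.locallyIntegrableOn
    · exact (locallyIntegrable_const _).locallyIntegrableOn _
  have : Gt f κ N = Set.indicator (Set.Ioi (N : ℝ)) (fun u : ℝ => Er f κ u - Er f κ N) := by
    ext u
    simp [Gt, Set.indicator]
  rw [this]
  intro x hx
  obtain ⟨U, hU, hi⟩ := h1 x hx
  exact ⟨U, hU, hi.indicator measurableSet_Ioi⟩

lemma norm_Gt_le {f : ℕ → ℂ} {κ : ℂ} {Q : ℝ} (hE : ∀ u : ℝ, 1 ≤ u → ‖Er f κ u‖ ≤ Q)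
    {N : ℕ} (hN : 1 ≤ N) (u : ℝ) : ‖Gt f κ N u‖ ≤ 2 * Q := by
  have hN' : (1:ℝ) ≤ N := by exact_mod_cast hN
  have hQ : 0 ≤ Q := (norm_nonneg _).trans (hE N hN')
  unfold Gt
  split_ifs with h
  · have := norm_sub_le (Er f κ u) (Er f κ N)
    have := hE u (by linarith)
    have := hE N hN'
    linarith
  · simp; linarith

lemma mellin_Gt_diff {f : ℕ → ℂ} {κ : ℂ} {Q : ℝ} (hE : ∀ u : ℝ, 1 ≤ u → ‖Er f κ u‖ ≤ Q)
    {N : ℕ} (hN : 1 ≤ N) {s : ℂ} (hs : s.re < 0) : DifferentiableAt ℂ (mellin (Gt f κ N)) s := by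
  refine mellin_differentiableAt_of_isBigO_rpow (a := 0) (b := s.re - 1) (locInt_Gt f κ N) ?_ hs ?_
    (by linarith)
  · apply Asymptotics.IsBigO.of_bound (2 * Q)
    filter_upwards with u
    simpa using norm_Gt_le hE hN u
  · apply Asymptotics.IsBigO.of_bound 0
    have : ∀ᶠ u : ℝ in 𝓝[>] 0, u < N :=
      nhdsWithin_le_nhds (Iio_mem_nhds (by exact_mod_cast hN))
    filter_upwards [this] with u hu
    simp [Gt, hu.le]

lemma mellin_Gt_eq (f : ℕ → ℂ) (κ : ℂ) {N : ℕ} (hN : 1 ≤ N) (s : ℂ) :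
    mellin (Gt f κ N) (-s) =
      ∫ t in Set.Ioi (N : ℝ), (Er f κ t - Er f κ N) * (t : ℂ) ^ (-(s + 1)) := by
  unfold mellin
  have h : ∀ t : ℝ, (t : ℂ) ^ (-s - 1) • Gt f κ N t =
      Set.indicator (Set.Ioi (N : ℝ)) (fun t : ℝ => (Er f κ t - Er f κ N) * (t : ℂ) ^ (-(s + 1))) t := by
    intro t
    simp only [Gt, Set.indicator, Set.mem_Ioi]
    split_ifs with h
    · rw [smul_eq_mul, mul_comm]; congr 2; ring
    · exact smul_zero _
  simp_rw [h]
  rw [setIntegral_indicator measurableSet_Ioi]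
  congr 2
  ext t
  simp

lemma norm_mellin_Gt_le {f : ℕ → ℂ} {κ : ℂ} {Q : ℝ} (hE : ∀ u : ℝ, 1 ≤ u → ‖Er f κ u‖ ≤ Q)
    {N : ℕ} (hN : 1 ≤ N) {s : ℂ} (hs : 0 < s.re) :
    ‖mellin (Gt f κ N) (-s)‖ ≤ 2 * Q * ((N : ℝ) ^ (-s.re) / s.re) := by
  have hN0 : (0:ℝ) < N := by exact_mod_cast hN
  rw [mellin_Gt_eq f κ hN]
  have hintg := integrableOn_Ioi_rpow_of_lt (a := -s.re - 1) (by linarith) hN0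
  have := integral_Ioi_rpow_of_lt (a := -s.re - 1) (by linarith) hN0
  calc _ ≤ ∫ t in Set.Ioi (N : ℝ), 2 * Q * t ^ (-s.re - 1) := by
        apply norm_integral_le_of_norm_le (hintg.const_mul _)
        filter_upwards [ae_restrict_mem measurableSet_Ioi] with t ht
        have ht' : (N:ℝ) < t := ht
        have h0 : 0 < t := hN0.trans ht'
        rw [norm_mul, norm_cpow_eq_rpow_re_of_pos h0]
        have h1 := norm_Gt_le hE hN t
        rw [Gt, if_pos ht'] at h1
        have h2 : (-(s + 1)).re = -s.re - 1 := by simp; ring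
        rw [h2]
        gcongr
    _ = _ := by
        rw [integral_const_mul, this]
        congr 1
        rw [show -s.re - 1 + 1 = -s.re by ring, neg_div_neg_eq]

lemma lseries_rep {f : ℕ → ℂ} (hf : ∀ n, ‖f n‖ ≤ 1) {κ : ℂ} {Q : ℝ}
    (hE : ∀ u : ℝ, 1 ≤ u → ‖Er f κ u‖ ≤ Q) {N : ℕ} (hN : 1 ≤ N) {s : ℂ} (hs : 1 < s.re) :
    (s - 1) * LSeries f s = κ * (N : ℂ) ^ (1 - s) +
      (s - 1) * (∑ n ∈ Finset.Icc 1 N, f n * (n : ℂ) ^ (-s) + s * mellin (Gt f κ N) (-s)) := by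
  have hN0 : (0:ℝ) < N := by exact_mod_cast hN
  have hN1 : (1:ℝ) ≤ N := by exact_mod_cast hN
  set fN : ℕ → ℂ := fun n => if n ≤ N then 0 else f n with hfN
  set gN : ℕ → ℂ := fun n => if n ≤ N then f n else 0 with hgN
  have hfNb : ∀ n, ‖fN n‖ ≤ 1 := by
    intro n; simp only [hfN]; split_ifs <;> simp [hf]
  have hgNb : ∀ n, ‖gN n‖ ≤ 1 := by
    intro n; simp only [hgN]; split_ifs <;> simp [hf]
  have hsplit : LSeries f s = LSeries gN s + LSeries fN s := by
    rw [← LSeries_add (summable_of_bdd hgNb hs) (summable_of_bdd hfNb hs)]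
    congr 1
    ext n
    simp only [hfN, hgN, Pi.add_apply]
    split_ifs <;> simp
  have hg : LSeries gN s = ∑ n ∈ Finset.Icc 1 N, f n * (n : ℂ) ^ (-s) := by
    rw [LSeries, tsum_eq_sum (s := Finset.Icc 1 N)]
    · apply Finset.sum_congr rfl
      intro n hn
      simp at hn
      rw [LSeries.term_of_ne_zero (by omega), cpow_neg, div_eq_mul_inv]
      simp [hgN, hn.2]
    · intro n hn
      rcases eq_or_ne n 0 with rfl | h0
      · simp
      · have : ¬ n ≤ N := by
          intro h; apply hn; simp; omega
        rw [LSeries.term_of_ne_zero h0]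
        simp [hgN, this]
  have hI : LSeries fN s = s * ∫ t in Set.Ioi (1 : ℝ), (∑ k ∈ Finset.Icc 1 ⌊t⌋₊, fN k) * t ^ (-(s + 1)) := by
    refine LSeries_eq_mul_integral fN zero_le_one hs (summable_of_bdd hfNb hs) ?_
    apply Asymptotics.IsBigO.of_bound 1
    filter_upwards with n
    refine (norm_sum_le _ _).trans ?_
    refine (Finset.sum_le_sum (fun k _ => hfNb k)).trans ?_
    simp
  have hS0 : s ≠ 0 := by intro h; rw [h] at hs; simp at hs; linarith
  have hS1 : s - 1 ≠ 0 := by intro h; rw [sub_eq_zero] at h; rw [h] at hs; simp at hs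
  have hI2 : ∫ t in Set.Ioi (1 : ℝ), (∑ k ∈ Finset.Icc 1 ⌊t⌋₊, fN k) * (t:ℂ) ^ (-(s + 1)) =
      ∫ t in Set.Ioi (N : ℝ), ((Er f κ t - Er f κ N) * (t:ℂ) ^ (-(s + 1)) +
        (κ * (t:ℂ) ^ (-s) - κ * N * (t:ℂ) ^ (-(s+1)))) := by
    have h : ∀ t ∈ Set.Ioi (1:ℝ), (∑ k ∈ Finset.Icc 1 ⌊t⌋₊, fN k) * (t:ℂ) ^ (-(s + 1)) =
      Set.indicator (Set.Ici ((N+1 : ℕ) : ℝ)) (fun t : ℝ => ((∑ k ∈ Finset.Icc 1 ⌊t⌋₊, f k) - ∑ k ∈ Finset.Icc 1 N, f k) * (t:ℂ) ^ (-(s + 1))) t := by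
      intro t ht
      have ht0 : (0:ℝ) ≤ t := zero_le_one.trans (le_of_lt ht)
      rw [hfN, tail_partial]
      simp only [Set.indicator, Set.mem_Ici]
      have : (N < ⌊t⌋₊) ↔ (((N+1:ℕ):ℝ) ≤ t) := by rw [← Nat.le_floor_iff ht0]; rfl
      simp only [this]
      split_ifs <;> simp
    rw [setIntegral_congr_fun measurableSet_Ioi h, setIntegral_indicator measurableSet_Ici]
    have hset : Set.Ioi (1:ℝ) ∩ Set.Ici ((N+1:ℕ):ℝ) = Set.Ici ((N+1:ℕ):ℝ) := by
      ext t; simp; intro h; linarith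
    rw [hset]
    have h3 : ∀ t ∈ Set.Ioi (N:ℝ), ((Er f κ t - Er f κ N) * (t:ℂ) ^ (-(s + 1)) +
        (κ * (t:ℂ) ^ (-s) - κ * N * (t:ℂ) ^ (-(s+1)))) = 
        Set.indicator (Set.Ici ((N+1 : ℕ) : ℝ)) (fun t : ℝ => ((∑ k ∈ Finset.Icc 1 ⌊t⌋₊, f k) - ∑ k ∈ Finset.Icc 1 N, f k) * (t:ℂ) ^ (-(s + 1))) t := by
      intro t ht
      have ht' : (N:ℝ) < t := ht
      have ht0 : (0:ℝ) < t := hN0.trans ht'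
      have htc : (t:ℂ) ≠ 0 := by exact_mod_cast ht0.ne'
      have e1 : (t:ℂ) ^ (-s) = t * (t:ℂ)^(-(s+1)) := by
        conv_rhs => enter [1]; rw [← cpow_one (t:ℂ)]
        rw [← cpow_add _ _ htc]; congr 1; ring
      have e2 : ((Er f κ t - Er f κ N) * (t:ℂ) ^ (-(s + 1)) +
        (κ * (t:ℂ) ^ (-s) - κ * N * (t:ℂ) ^ (-(s+1)))) = ((∑ k ∈ Finset.Icc 1 ⌊t⌋₊, f k) - ∑ k ∈ Finset.Icc 1 N, f k) * (t:ℂ) ^ (-(s + 1)) := by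
        rw [e1, Er, Er]; simp; ring
      rw [e2, Set.indicator]
      split_ifs with h
      · rfl
      · have : ⌊t⌋₊ = N := by
          rw [Nat.floor_eq_iff ht0.le]
          simp at h
          exact ⟨ht'.le, h⟩
        simp [this]
    rw [setIntegral_congr_fun measurableSet_Ioi h3, setIntegral_indicator measurableSet_Ici]
    congr 2
    ext t; simp; intro h; linarith
  have i1 : IntegrableOn (fun t : ℝ => (t:ℂ) ^ (-s)) (Set.Ioi (N:ℝ)) :=
    integrableOn_Ioi_cpow_of_lt (by simp; linarith) hN0
  have i2 : IntegrableOn (fun t : ℝ => (t:ℂ) ^ (-(s+1))) (Set.Ioi (N:ℝ)) :=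
    integrableOn_Ioi_cpow_of_lt (by simp; linarith) hN0
  have i3 : IntegrableOn (fun t : ℝ => (Er f κ t - Er f κ N) * (t:ℂ) ^ (-(s + 1))) (Set.Ioi (N:ℝ)) := by
    apply Integrable.bdd_mul (c := 2 * Q) i2
    · have := (locInt_Gt f κ N).aestronglyMeasurable
      have h2 := this.mono_measure (Measure.restrict_mono_set volume
        (show Set.Ioi (N:ℝ) ⊆ Set.Ioi 0 from Set.Ioi_subset_Ioi hN0.le))
      apply h2.congr
      filter_upwards [ae_restrict_mem measurableSet_Ioi] with t ht
      rw [Gt, if_pos (Set.mem_Ioi.mp ht)]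
    · filter_upwards [ae_restrict_mem measurableSet_Ioi] with t ht
      have h1 := norm_Gt_le hE hN t
      rwa [Gt, if_pos (Set.mem_Ioi.mp ht)] at h1
  have i4 : IntegrableOn (fun t : ℝ => κ * (t:ℂ) ^ (-s) - κ * N * (t:ℂ) ^ (-(s+1))) (Set.Ioi (N:ℝ)) :=
    (i1.const_mul κ).sub (i2.const_mul _)
  rw [hsplit, hg, hI, hI2, integral_add i3 i4,
    integral_sub (i1.const_mul κ) (i2.const_mul _), integral_const_mul, integral_const_mul,
    integral_Ioi_cpow_of_lt (by simp; linarith) hN0, integral_Ioi_cpow_of_lt (by simp; linarith) hN0,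
    mellin_Gt_eq f κ hN]
  have e3 : ((N:ℝ):ℂ) ^ (-s + 1) = (N:ℂ) ^ (1 - s) := by
    rw [ofReal_natCast]; congr 1; ring
  have e4 : (N:ℂ) * ((N:ℝ):ℂ) ^ (-(s+1) + 1) = (N:ℂ) ^ (1 - s) := by
    have hNc : (N:ℂ) ≠ 0 := by exact_mod_cast hN0.ne'
    rw [ofReal_natCast]
    conv_lhs => enter [1]; rw [← cpow_one (N:ℂ)]
    rw [← cpow_add _ _ hNc]; congr 1; ring
  have e5 : κ * (N:ℂ) * (-((N:ℝ):ℂ) ^ (-(s+1) + 1) / (-(s+1) + 1)) = κ * ((N:ℂ) ^ (1 - s) / s) := by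
    rw [← e4, show -(s+1) + 1 = -s by ring]; field_simp
  rw [e5, e3]
  have : -s + 1 = -(s-1) := by ring
  rw [this]
  field_simp
  ring

end P1
end SW

namespace SW
section P2
open Complex MeasureTheory Filter Topology

lemma exp_sub_one_bound {a : ℝ} (ha : 0 ≤ a) {w : ℂ} (hw : w.re ≤ a) :
    ‖cexp w - 1‖ ≤ Real.exp a * ‖w‖ := by
  have := Convex.norm_image_sub_le_of_norm_hasDerivWithin_le (𝕜 := ℂ) (f := cexp) (f' := cexp)
    (s := {z : ℂ | z.re ≤ a}) (x := 0) (y := w) (C := Real.exp a)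
    (fun x _ => (Complex.hasDerivAt_exp x).hasDerivWithinAt)
    (fun x hx => by rw [Complex.norm_exp]; exact Real.exp_le_exp.mpr hx)
    (convex_halfSpace_re_le a) (by simpa using ha) hw
  simpa using this

lemma sum_rpow_le {δ : ℝ} (hδ : 0 < δ) {σ : ℝ} (hσ : 1 - δ ≤ σ) {N : ℕ} (hN : 1 ≤ N) :
    ∑ n ∈ Finset.Icc 1 N, (n : ℝ) ^ (-σ) ≤ (1 + 1 / δ) * (N : ℝ) ^ (2 * δ) := by
  have hN0 : (0:ℝ) < N := by exact_mod_cast hN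
  have hN1 : (1:ℝ) ≤ N := by exact_mod_cast hN
  calc ∑ n ∈ Finset.Icc 1 N, (n : ℝ) ^ (-σ) ≤ ∑ n ∈ Finset.Icc 1 N, (N : ℝ) ^ δ * (n : ℝ)⁻¹ := by
        apply Finset.sum_le_sum
        intro n hn
        simp at hn
        have hn1 : (1:ℝ) ≤ n := by exact_mod_cast hn.1
        have hn0 : (0:ℝ) < n := by linarith
        calc (n : ℝ) ^ (-σ) ≤ (n : ℝ) ^ (δ - 1) := Real.rpow_le_rpow_of_exponent_le hn1 (by linarith)
          _ = (n:ℝ) ^ δ * (n:ℝ)⁻¹ := by rw [Real.rpow_sub hn0, Real.rpow_one, div_eq_mul_inv]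
          _ ≤ _ := by
            gcongr
            exact hn.2
    _ = (N : ℝ) ^ δ * (harmonic N : ℝ) := by
        rw [← Finset.mul_sum, harmonic_eq_sum_Icc]; simp
    _ ≤ (N : ℝ) ^ δ * ((N : ℝ) ^ δ + (N : ℝ) ^ δ / δ) := by
        gcongr
        refine (harmonic_le_one_add_log N).trans ?_
        gcongr
        · exact Real.one_le_rpow hN1 hδ.le
        · exact Real.log_le_rpow_div hN0.le hδ
    _ = _ := by
        rw [two_mul, Real.rpow_add hN0]; field_simp

theorem bound_general {δ : ℝ} (hδ : 0 < δ) (hδ2 : δ ≤ 1 / 2) :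
    ∃ C : ℝ, 0 < C ∧ ∀ (f : ℕ → ℂ) (κ : ℂ) (Q : ℝ) (Z : ℂ → ℂ), (∀ n, ‖f n‖ ≤ 1) → ‖κ‖ ≤ 1 → 1 ≤ Q →
      (∀ u : ℝ, 1 ≤ u → ‖Er f κ u‖ ≤ Q) → DifferentiableOn ℂ Z {s | 0 < s.re} →
      (∀ s : ℂ, 1 < s.re → Z s = (s - 1) * LSeries f s) →
      ∀ s : ℂ, 1 - δ ≤ s.re → s.re ≤ 4 →
        ‖Z s - κ‖ ≤ ‖s - 1‖ * (C * (Q * (|s.im| + 2)) ^ (2 * δ)) := by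
  refine ⟨2 * (1 / δ + (1 + 1 / δ) + 8), by positivity, ?_⟩
  intro f κ Q Z hf hκ hQ hE hZ hZL s hs hs3
  set T : ℝ := Q * (|s.im| + 2) with hT
  have hT2 : 2 ≤ T := by
    have : 0 ≤ |s.im| := abs_nonneg _
    nlinarith
  set N : ℕ := ⌈T⌉₊ with hNdef
  have hTN : T ≤ N := Nat.le_ceil T
  have hNT : (N:ℝ) ≤ 2 * T := by
    have := (Nat.ceil_lt_add_one (show 0 ≤ T by linarith)).le
    linarith
  have hN1 : (1:ℝ) ≤ N := by linarith
  have hN : 1 ≤ N := by exact_mod_cast hN1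
  have hN0 : (0:ℝ) < N := by linarith
  have hσ : 1 / 2 ≤ s.re := by linarith
  -- identity theorem
  have hopen : IsOpen {s : ℂ | 0 < s.re} := isOpen_lt continuous_const continuous_re
  have hcpow : ∀ n : ℕ, n ≠ 0 → Differentiable ℂ (fun z : ℂ => (n:ℂ) ^ (-z)) := by
    intro n hn z
    exact (differentiableAt_id.neg).const_cpow (Or.inl (by exact_mod_cast hn))
  have hid : Z s = κ * (N : ℂ) ^ (1 - s) +
      (s - 1) * (∑ n ∈ Finset.Icc 1 N, f n * (n : ℂ) ^ (-s) + s * mellin (Gt f κ N) (-s)) := by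
    have h1 : DifferentiableOn ℂ (fun s : ℂ => κ * (N : ℂ) ^ (1 - s) +
      (s - 1) * (∑ n ∈ Finset.Icc 1 N, f n * (n : ℂ) ^ (-s) + s * mellin (Gt f κ N) (-s))) {s | 0 < s.re} := by
      intro z hz
      apply DifferentiableAt.differentiableWithinAt
      apply DifferentiableAt.add
      · apply DifferentiableAt.const_mul
        exact ((differentiableAt_const _).sub differentiableAt_id).const_cpow (Or.inl (by exact_mod_cast hN0.ne'))
      · apply DifferentiableAt.mul (by fun_prop)
        apply DifferentiableAt.add
        · apply DifferentiableAt.fun_sum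
          intro n hn
          simp at hn
          exact (hcpow n (by omega) z).const_mul _
        · apply DifferentiableAt.mul differentiableAt_id
          have : DifferentiableAt ℂ (mellin (Gt f κ N)) (-z) :=
            mellin_Gt_diff hE hN (by simpa using hz)
          exact this.comp z differentiableAt_id.neg
    refine AnalyticOnNhd.eqOn_of_preconnected_of_eventuallyEq (hZ.analyticOnNhd hopen)
      (h1.analyticOnNhd hopen) (convex_halfSpace_re_gt 0).isPreconnected (z₀ := 2) (by simp) ?_
      (show s ∈ {s : ℂ | 0 < s.re} by simp; linarith)
    have : {z : ℂ | 1 < z.re} ∈ 𝓝 (2:ℂ) :=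
      (isOpen_lt continuous_const continuous_re).mem_nhds (by simp)
    filter_upwards [this] with z hz
    rw [hZL z hz, lseries_rep hf hE hN hz]
  have hb1 : ‖(N:ℂ) ^ (1 - s) - 1‖ ≤ ‖s - 1‖ * (1 / δ * (N:ℝ) ^ (2 * δ)) := by
    have hlog : 0 ≤ Real.log N := Real.log_nonneg hN1
    have e : (N:ℂ) ^ (1 - s) = cexp ((Real.log N : ℂ) * (1 - s)) := by
      rw [cpow_def_of_ne_zero (by exact_mod_cast hN0.ne'), natCast_log]
    rw [e]
    refine (exp_sub_one_bound (a := Real.log N * δ) (by positivity) ?_).trans ?_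
    · rw [re_ofReal_mul]; simp; gcongr; linarith
    · rw [norm_mul, ← Real.rpow_def_of_pos hN0, norm_real, Real.norm_of_nonneg hlog, norm_sub_rev,
        two_mul, Real.rpow_add hN0]
      have := Real.log_le_rpow_div hN0.le hδ
      calc (N:ℝ) ^ δ * (Real.log N * ‖s - 1‖) ≤ (N:ℝ) ^ δ * ((N:ℝ) ^ δ / δ * ‖s - 1‖) := by gcongr
        _ = _ := by ring
  have hb2 : ‖∑ n ∈ Finset.Icc 1 N, f n * (n : ℂ) ^ (-s)‖ ≤ (1 + 1 / δ) * (N : ℝ) ^ (2 * δ) := by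
    refine (norm_sum_le _ _).trans (le_trans ?_ (sum_rpow_le hδ hs hN))
    apply Finset.sum_le_sum
    intro n hn
    simp at hn
    rw [norm_mul, norm_natCast_cpow_of_pos (by omega), neg_re]
    exact mul_le_of_le_one_left (by positivity) (hf n)
  have hb3 : ‖s * mellin (Gt f κ N) (-s)‖ ≤ 8 * (N : ℝ) ^ (2 * δ) := by
    rw [norm_mul]
    have h1 := norm_mellin_Gt_le hE hN (s := s) (by linarith)
    have h2 : ‖s‖ ≤ 2 * (|s.im| + 2) := by
      have := Complex.norm_le_abs_re_add_abs_im s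
      rw [abs_of_nonneg (by linarith : 0 ≤ s.re)] at this
      have : 0 ≤ |s.im| := abs_nonneg _
      linarith
    have h3 : (N:ℝ) ^ (-s.re) / s.re ≤ 2 * ((N:ℝ) ^ (2 * δ) / N) := by
      have : (N:ℝ) ^ (-s.re) ≤ (N:ℝ) ^ (2 * δ - 1) := Real.rpow_le_rpow_of_exponent_le hN1 (by linarith)
      rw [Real.rpow_sub hN0, Real.rpow_one] at this
      rw [div_le_iff₀ (by linarith)]
      have : 0 ≤ (N:ℝ) ^ (2 * δ) / N := by positivity
      nlinarith
    calc ‖s‖ * ‖mellin (Gt f κ N) (-s)‖ ≤ (2 * (|s.im| + 2)) * (2 * Q * (2 * ((N:ℝ) ^ (2 * δ) / N))) := by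
          have : 2 * Q * ((N:ℝ) ^ (-s.re) / s.re) ≤ 2 * Q * (2 * ((N:ℝ) ^ (2 * δ) / N)) := by gcongr
          gcongr
          exact h1.trans this
      _ = 8 * (T / N) * (N:ℝ) ^ (2 * δ) := by rw [hT]; ring
      _ ≤ 8 * 1 * (N:ℝ) ^ (2 * δ) := by
          gcongr
          rw [div_le_one hN0]; exact hTN
      _ = _ := by ring
  have hfin : (N:ℝ) ^ (2 * δ) ≤ 2 * T ^ (2 * δ) := by
    calc (N:ℝ) ^ (2 * δ) ≤ (2 * T) ^ (2 * δ) := by gcongr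
      _ = 2 ^ (2 * δ) * T ^ (2 * δ) := Real.mul_rpow (by norm_num) (by linarith)
      _ ≤ 2 ^ (1:ℝ) * T ^ (2 * δ) := by
          gcongr
          · norm_num
          · linarith
      _ = _ := by simp
  have e : Z s - κ = κ * ((N:ℂ) ^ (1 - s) - 1) + (s - 1) * (∑ n ∈ Finset.Icc 1 N, f n * (n : ℂ) ^ (-s) + s * mellin (Gt f κ N) (-s)) := by
    rw [hid]; ring
  rw [e]
  calc _ ≤ ‖κ * ((N:ℂ) ^ (1 - s) - 1)‖ + ‖(s - 1) * (∑ n ∈ Finset.Icc 1 N, f n * (n : ℂ) ^ (-s) + s * mellin (Gt f κ N) (-s))‖ := norm_add_le _ _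
    _ ≤ ‖s - 1‖ * (1 / δ * (N:ℝ) ^ (2 * δ)) + ‖s - 1‖ * ((1 + 1 / δ) * (N : ℝ) ^ (2 * δ) + 8 * (N : ℝ) ^ (2 * δ)) := by
        rw [norm_mul, norm_mul]
        exact add_le_add ((mul_le_of_le_one_left (norm_nonneg _) hκ).trans hb1)
          (mul_le_mul_of_nonneg_left ((norm_add_le _ _).trans (add_le_add hb2 hb3)) (norm_nonneg _))
    _ = ‖s - 1‖ * ((1 / δ + (1 + 1 / δ) + 8) * (N:ℝ) ^ (2 * δ)) := by ring
    _ ≤ ‖s - 1‖ * ((1 / δ + (1 + 1 / δ) + 8) * (2 * T ^ (2 * δ))) := by gcongr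
    _ = _ := by ring

end P2
end SW

namespace SW
section P3
open Complex MeasureTheory Filter Topology DirichletCharacter

lemma sum_range_zmod {q : ℕ} [NeZero q] (g : ZMod q → ℂ) :
    ∑ k ∈ Finset.range q, g (k : ZMod q) = ∑ a, g a := by
  refine Finset.sum_nbij' (fun k => (k : ZMod q)) ZMod.val ?_ ?_ ?_ ?_ ?_
  · intros; simp
  · intro a _; simpa using ZMod.val_lt a
  · intro k hk; simp at hk; exact ZMod.val_cast_of_lt hk
  · intro a _; simp
  · intros; rfl

lemma periodic_bound {q : ℕ} [NeZero q] (g : ZMod q → ℂ) {B : ℝ} (hB : ∀ a, ‖g a‖ ≤ B)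
    (h0 : ∑ a, g a = 0) (n : ℕ) : ‖∑ k ∈ Finset.range n, g (k : ZMod q)‖ ≤ q * B := by
  have hB0 : 0 ≤ B := (norm_nonneg _).trans (hB 0)
  induction n using Nat.strong_induction_on with
  | _ n ih =>
    by_cases h : n < q
    · refine (norm_sum_le _ _).trans ?_
      refine (Finset.sum_le_card_nsmul _ _ B (fun k _ => hB _)).trans ?_
      simp
      gcongr
    · push Not at h
      obtain ⟨m, rfl⟩ := Nat.exists_eq_add_of_le h
      rw [Finset.sum_range_add, sum_range_zmod, h0, zero_add]
      have := ih m (by have := NeZero.pos q; omega)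
      simpa using this

lemma Er_periodic {q : ℕ} [NeZero q] (g : ZMod q → ℂ) (hB : ∀ a, ‖g a‖ ≤ 1) {κ : ℂ}
    (hκ : ∑ a, g a = q * κ) (hκ1 : ‖κ‖ ≤ 1) (u : ℝ) (hu : 1 ≤ u) :
    ‖Er (fun n => g n) κ u‖ ≤ 3 * q := by
  have e : Er (fun n => g n) κ u = ∑ k ∈ Finset.range ⌊u⌋₊, (g ((k : ZMod q) + 1) - κ) + κ * ((⌊u⌋₊ : ℂ) - u) := by
    rw [Er, Finset.sum_sub_distrib]
    have : ∑ k ∈ Finset.Icc 1 ⌊u⌋₊, g (k : ZMod q) = ∑ k ∈ Finset.range ⌊u⌋₊, g ((k : ZMod q) + 1) := by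
      rw [Finset.range_eq_Ico, ← Finset.Ico_add_one_right_eq_Icc]
      have := Finset.sum_Ico_add' (fun k : ℕ => g (k : ZMod q)) 0 ⌊u⌋₊ 1
      rw [zero_add] at this
      rw [← this]
      simp
    rw [this]
    simp
    ring
  rw [e]
  have h1 := periodic_bound (q := q) (fun a => g (a + 1) - κ) (B := 2) (fun a => by
      refine (norm_sub_le _ _).trans ?_
      linarith [hB (a + 1)]) (by
      rw [Finset.sum_sub_distrib]
      have : ∑ a, g (a + 1) = ∑ a, g a := Equiv.sum_comp (Equiv.addRight (1 : ZMod q)) g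
      rw [this, hκ]; simp [ZMod.card]) ⌊u⌋₊
  have h2 : ‖κ * ((⌊u⌋₊ : ℂ) - u)‖ ≤ 1 := by
    rw [norm_mul]
    have : ‖((⌊u⌋₊ : ℂ) - u)‖ ≤ 1 := by
      have : ((⌊u⌋₊ : ℂ) - u) = (((⌊u⌋₊ : ℝ) - u : ℝ) : ℂ) := by push_cast; rfl
      rw [this, norm_real, Real.norm_eq_abs, abs_le]
      have := Nat.floor_le (show 0 ≤ u by linarith)
      have := Nat.lt_floor_add_one u
      constructor <;> linarith
    exact mul_le_one₀ hκ1 (norm_nonneg _) this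
  have hq : (1:ℝ) ≤ q := by exact_mod_cast NeZero.pos q
  refine (norm_add_le _ _).trans ?_
  linarith

theorem bound_char {δ : ℝ} (hδ : 0 < δ) (hδ2 : δ ≤ 1 / 2) :
    ∃ C : ℝ, 0 < C ∧ ∀ (q : ℕ) [NeZero q] (χ : DirichletCharacter ℂ q), ∃ κ : ℂ, ‖κ‖ ≤ 1 ∧ (χ ≠ 1 → κ = 0) ∧
      (q = 1 → κ = 1) ∧
      ∀ s : ℂ, s ≠ 1 → 1 - δ ≤ s.re → s.re ≤ 4 →
        ‖(s - 1) * LFunction χ s - κ‖ ≤ ‖s - 1‖ * (C * (q * (|s.im| + 2)) ^ (2 * δ)) := by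
  obtain ⟨C, hC, h⟩ := bound_general hδ hδ2
  refine ⟨C * 3, by positivity, ?_⟩
  intro q _ χ
  have hq : (1:ℝ) ≤ q := by exact_mod_cast NeZero.pos q
  have hq0 : (q:ℂ) ≠ 0 := by exact_mod_cast NeZero.ne q
  have hκ1 : ‖(∑ a, χ a) / (q:ℂ)‖ ≤ 1 := by
    rw [norm_div, norm_natCast, div_le_one (by linarith)]
    refine (norm_sum_le _ _).trans ((Finset.sum_le_card_nsmul _ _ 1 (fun a _ => χ.norm_le_one a)).trans ?_)
    simp [ZMod.card]
  refine ⟨(∑ a, χ a) / q, hκ1, ?_, ?_, ?_⟩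
  · intro hχ
    rw [MulChar.sum_eq_zero_of_ne_one hχ]; simp
  · intro h1
    subst h1
    simp
    exact map_one χ
  · intro s hs1 hs hs3
    have hsum : ∑ a, χ a = q * ((∑ a, χ a) / q) := by field_simp
    have key : ∀ Z : ℂ → ℂ, Differentiable ℂ Z → (∀ s, s ≠ 1 → Z s = (s - 1) * LFunction χ s) →
      ‖(s - 1) * LFunction χ s - (∑ a, χ a) / q‖ ≤ ‖s - 1‖ * (C * 3 * (q * (|s.im| + 2)) ^ (2 * δ)) := by
      intro Z hZ hZs
      rw [← hZs s hs1]
      refine (h (fun n => χ n) _ (3 * q) Z (fun n => χ.norm_le_one _) hκ1 (by linarith)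
        (Er_periodic χ (fun a => χ.norm_le_one a) hsum hκ1) hZ.differentiableOn ?_ s hs hs3).trans ?_
      · intro z hz
        rw [hZs z (by rintro rfl; simp at hz), LFunction_eq_LSeries χ hz]
      · have hT : 0 ≤ q * (|s.im| + 2) := by positivity
        rw [mul_assoc 3, Real.mul_rpow (by norm_num) hT, mul_assoc C]
        gcongr
        calc (3:ℝ) ^ (2 * δ) ≤ 3 ^ (1:ℝ) := Real.rpow_le_rpow_of_exponent_le (by norm_num) (by linarith)
          _ = 3 := by simp
    by_cases hχ : χ = 1
    · apply key (LFunctionTrivChar₁ q) (differentiable_LFunctionTrivChar₁ q)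
      intro z hz
      rw [LFunctionTrivChar₁, Function.update_of_ne hz, hχ]
    · apply key (fun z => (z - 1) * LFunction χ z)
      · exact (differentiable_id.sub_const 1).mul (differentiable_LFunction hχ)
      · intros; rfl

/-- bound for nonprincipal characters -/
theorem bound_nonprincipal {δ : ℝ} (hδ : 0 < δ) (hδ2 : δ ≤ 1 / 2) :
    ∃ C : ℝ, 0 < C ∧ ∀ (q : ℕ) [NeZero q] (χ : DirichletCharacter ℂ q), χ ≠ 1 →
      ∀ s : ℂ, 1 - δ ≤ s.re → s.re ≤ 4 →
        ‖LFunction χ s‖ ≤ C * (q * (|s.im| + 2)) ^ (2 * δ) := by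
  obtain ⟨C, hC, h⟩ := bound_char hδ hδ2
  refine ⟨C, hC, ?_⟩
  intro q _ χ hχ
  obtain ⟨κ, -, hκ, -, h⟩ := h q χ
  rw [hκ hχ] at h
  have h' : ∀ s : ℂ, s ≠ 1 → 1 - δ ≤ s.re → s.re ≤ 4 →
        ‖LFunction χ s‖ ≤ C * (q * (|s.im| + 2)) ^ (2 * δ) := by
    intro s h1 h2 h3
    have := h s h1 h2 h3
    rw [sub_zero, norm_mul] at this
    exact le_of_mul_le_mul_left this (norm_pos_iff.mpr (sub_ne_zero.mpr h1))
  intro s h2 h3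
  by_cases h1 : s = 1
  · subst h1
    have hc : Continuous (LFunction χ) := (differentiable_LFunction hχ).continuous
    have ht : Tendsto (fun x : ℝ => ‖LFunction χ (1 + x)‖) (𝓝[>] 0) (𝓝 ‖LFunction χ 1‖) := by
      have : Tendsto (fun x : ℝ => ‖LFunction χ (1 + x)‖) (𝓝 0) (𝓝 ‖LFunction χ (1 + (0:ℝ))‖) := by
        apply Continuous.tendsto
        fun_prop
      simp at this
      exact this.mono_left nhdsWithin_le_nhds
    refine le_of_tendsto ht ?_
    have : Set.Ioo (0:ℝ) 1 ∈ 𝓝[>] (0:ℝ) := Ioo_mem_nhdsGT (by norm_num)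
    filter_upwards [this] with x hx
    have := h' (1 + x) (by simpa using hx.1.ne') (by simp; linarith [hx.1]) (by simp; linarith [hx.2])
    simpa using this
  · exact h' s h1 h2 h3

end P3
end SW

namespace SW
section P4
open Complex MeasureTheory Filter Topology DirichletCharacter
open scoped ComplexOrder

/-- `(s-1) ζ(s)` -/
noncomputable def Z1 : ℂ → ℂ := LFunctionTrivChar₁ 1

lemma Z1_one : Z1 1 = 1 := by simp [Z1]

lemma Z1_of_ne {s : ℂ} (hs : s ≠ 1) : Z1 s = (s - 1) * riemannZeta s := by
  simp [Z1, Function.update_of_ne hs]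

lemma Z1_diff : Differentiable ℂ Z1 := differentiable_LFunctionTrivChar₁ 1

theorem siegel_ineq : ∃ C1 : ℝ, 1 ≤ C1 ∧ ∀ (f : ℕ → ℂ) (P : ℂ → ℂ) (M : ℝ), 0 ≤ f → f 1 = 1 →
    LSeries.abscissaOfAbsConv f ≤ 1 → Differentiable ℂ P →
    (∀ s : ℂ, 1 < s.re → LSeries f s = riemannZeta s * P s) →
    (∀ s ∈ Metric.closedBall (2:ℂ) (4/3), ‖P s‖ ≤ M) →
    ∀ β : ℝ, 7/8 ≤ β → β < 1 → (riemannZeta β * P β).re ≤ 0 → ∀ K : ℕ, 1 ≤ K →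
      1 ≤ ‖P 1‖ * (2 - β) ^ K / (1 - β) + C1 * M * (27/32) ^ K := by
  obtain ⟨B, hB⟩ : ∃ B, ∀ s ∈ Metric.closedBall (2:ℂ) (4/3), ‖Z1 s‖ ≤ B :=
    (isCompact_closedBall _ _).exists_bound_of_continuousOn Z1_diff.continuous.continuousOn
  have hB0 : 1 ≤ B := by
    have := hB 1 (by rw [Metric.mem_closedBall, dist_eq]; norm_num)
    rwa [Z1_one, norm_one] at this
  refine ⟨3 * (B + 1) * (32 / 5), by nlinarith, ?_⟩
  intro f P M hf0 hf1 hfa hP hfP hM β hβ hβ1 hneg K hK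
  have hM0 : ‖P 1‖ ≤ M := hM 1 (by rw [Metric.mem_closedBall, dist_eq]; norm_num)
  have hM00 : 0 ≤ M := (norm_nonneg _).trans hM0
  set H : ℂ → ℂ := dslope (fun s => Z1 s * P s) 1 with hH
  have hHd : Differentiable ℂ H := by
    rw [← differentiableOn_univ]
    exact (Complex.differentiableOn_dslope Filter.univ_mem).2 (Z1_diff.mul hP).differentiableOn
  have hHs : ∀ s, s ≠ 1 → H s = (s - 1)⁻¹ * (Z1 s * P s - P 1) := by
    intro s hs
    rw [hH, dslope_of_ne _ hs, slope_def_field, Z1_one, one_mul, div_eq_inv_mul]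
  have hHs' : ∀ s, s ≠ 1 → H s = riemannZeta s * P s - P 1 * (s - 1)⁻¹ := by
    intro s hs
    rw [hHs s hs, Z1_of_ne hs]
    have := sub_ne_zero.2 hs
    field_simp
  -- coefficients
  set b : ℕ → ℂ := fun m => (m.factorial : ℂ)⁻¹ * ((-1) ^ m * iteratedDeriv m (LSeries f) 2) with hb
  have hab : LSeries.abscissaOfAbsConv f < ((2:ℝ) : EReal) := lt_of_le_of_lt hfa (by exact_mod_cast (by norm_num : (1:ℝ) < 2))
  have hb0 : ∀ m, 0 ≤ b m := by
    intro m
    have := LSeries.iteratedDeriv_alternating hf0 (x := 2) hab m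
    refine mul_nonneg ?_ (by simpa using this)
    positivity
  have hb00 : 1 ≤ (b 0).re := by
    have : b 0 = LSeries f 2 := by simp [hb]
    rw [this, LSeries, re_tsum]
    · have hs : Summable (fun n => (LSeries.term f 2 n).re) := by
        have : LSeriesSummable f 2 := LSeriesSummable_of_abscissaOfAbsConv_lt_re (by simpa using hab)
        exact Complex.hasSum_re this.hasSum |>.summable
      have h1 : (LSeries.term f 2 1).re = 1 := by simp [LSeries.term_def, hf1]
      rw [← h1]
      apply hs.le_tsum 1
      intro n _
      have := LSeries.term_nonneg (hf0 n) 2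
      have := (Complex.le_def.1 this).1
      simpa using this
    · exact LSeriesSummable_of_abscissaOfAbsConv_lt_re (by simpa using hab)
  have hcoef : ∀ m, (m.factorial : ℂ)⁻¹ * iteratedDeriv m H 2 = (-1) ^ m * (b m - P 1) := by
    intro m
    have h1 : H =ᶠ[𝓝 2] fun s => LSeries f s - P 1 * (1 * s - 1)⁻¹ := by
      have : {s : ℂ | 1 < s.re} ∈ 𝓝 (2:ℂ) := (isOpen_lt continuous_const continuous_re).mem_nhds (by simp)
      filter_upwards [this] with s hs
      rw [hHs' s (by rintro rfl; simp at hs), hfP s hs, one_mul]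
    have hana : AnalyticAt ℂ (LSeries f) 2 := by
      apply LSeries_analyticOnNhd f
      simpa using hab
    have hinv : ContDiffAt ℂ m (fun s : ℂ => (1 * s - 1)⁻¹) 2 := by
      apply ContDiffAt.inv
      · fun_prop
      · norm_num
    rw [h1.iteratedDeriv_eq, iteratedDeriv_fun_sub hana.contDiffAt (contDiffAt_const.mul hinv),
      iteratedDeriv_const_mul_field, iteratedDeriv_eq_iterate (f := fun s : ℂ => (1 * s - 1)⁻¹), iter_deriv_inv_linear_sub]
    have hm : (m.factorial : ℂ) ≠ 0 := by exact_mod_cast m.factorial_ne_zero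
    have h2 : ((-1:ℂ)) ^ m * (-1) ^ m = 1 := by rw [← mul_pow]; simp
    simp only [hb]
    have e2 : (1 * 2 - 1 : ℂ) = 1 := by norm_num
    simp only [e2, one_zpow, one_pow, mul_one]
    rw [mul_sub, mul_sub]
    congr 1
    · linear_combination (-(m.factorial : ℂ)⁻¹ * iteratedDeriv m (LSeries f) 2) * h2
    · field_simp
  have hbd : ∀ m, ‖b m - P 1‖ ≤ 3 * (B + 1) * M * (3 / 4) ^ m := by
    intro m
    have h1 := Complex.norm_iteratedDeriv_le_of_forall_mem_sphere_norm_le (f := H) (c := 2) (R := 4/3) (C := 3 * (B + 1) * M) m (by norm_num) hHd.diffContOnCl (by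
      intro z hz
      have hz' : z ∈ Metric.closedBall (2:ℂ) (4/3) := Metric.sphere_subset_closedBall hz
      rw [Metric.mem_sphere, dist_eq] at hz
      have h3 : 1 / 3 ≤ ‖z - 1‖ := by
        have : ‖z - 2‖ ≤ ‖z - 1‖ + ‖(-1:ℂ)‖ := by
          have e : z - 2 = (z - 1) + (-1) := by ring
          rw [e]; exact norm_add_le _ _
        rw [hz] at this
        simp at this
        linarith
      have hz1 : z ≠ 1 := by
        rintro rfl
        simp at h3
        linarith
      rw [hHs z hz1, norm_mul, norm_inv]
      have h4 : ‖z - 1‖⁻¹ ≤ 3 := by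
        rw [inv_le_comm₀ (by linarith) (by norm_num)]
        linarith
      have h5 : ‖Z1 z * P z - P 1‖ ≤ B * M + M := by
        refine (norm_sub_le _ _).trans (add_le_add ?_ hM0)
        rw [norm_mul]
        exact mul_le_mul (hB z hz') (hM z hz') (norm_nonneg _) (by linarith)
      calc _ ≤ 3 * (B * M + M) := by gcongr
        _ = _ := by ring)
    have h2 : ‖b m - P 1‖ = ‖(m.factorial : ℂ)⁻¹ * iteratedDeriv m H 2‖ := by
      rw [hcoef, norm_mul]; simp
    rw [h2, norm_mul, norm_inv, Complex.norm_natCast]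
    have hm : (0:ℝ) < (m.factorial : ℝ) := by exact_mod_cast m.factorial_pos
    rw [inv_mul_le_iff₀ hm]
    refine h1.trans (le_of_eq ?_)
    rw [div_eq_mul_inv, ← inv_pow]
    norm_num
    ring
  -- series
  have hser : HasSum (fun m => (b m - P 1) * ((2 - β : ℝ) : ℂ) ^ m) (H β) := by
    have := Complex.hasSum_taylorSeries_of_entire hHd 2 (β : ℂ)
    refine this.congr_fun ?_ |> fun h => h
    intro m
    simp only [smul_eq_mul]
    rw [mul_left_comm, hcoef, ← mul_assoc, mul_comm, ← mul_pow]
    push_cast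
    ring
  have hβne : (β:ℂ) ≠ 1 := by exact_mod_cast hβ1.ne
  have h2β : 0 < 2 - β := by linarith
  have hsplit := hser.summable.sum_add_tsum_nat_add K
  rw [hser.tsum_eq] at hsplit
  have htail : ‖∑' m, (b (m + K) - P 1) * ((2 - β : ℝ) : ℂ) ^ (m + K)‖ ≤ 3 * (B + 1) * (32 / 5) * M * (27/32) ^ K := by
    have hg : HasSum (fun m : ℕ => 3 * (B + 1) * M * (27/32 : ℝ) ^ K * (27/32) ^ m) (3 * (B + 1) * M * (27/32) ^ K * (1 - 27/32)⁻¹) :=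
      (hasSum_geometric_of_lt_one (by norm_num) (by norm_num)).mul_left _
    have := tsum_of_norm_bounded hg (f := fun m => (b (m + K) - P 1) * ((2 - β : ℝ) : ℂ) ^ (m + K)) (by
      intro m
      rw [norm_mul, norm_pow, norm_real, Real.norm_of_nonneg h2β.le]
      calc _ ≤ 3 * (B + 1) * M * (3 / 4) ^ (m + K) * (9/8) ^ (m + K) := by
            gcongr
            · exact hbd _
            · linarith
        _ = 3 * (B + 1) * M * ((3 / 4) * (9/8)) ^ (m + K) := by rw [mul_pow]; ring
        _ = _ := by norm_num; rw [pow_add]; ring)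
    refine this.trans (le_of_eq ?_)
    norm_num
    ring
  have hgeom : ∑ m ∈ Finset.range K, (b m - P 1) * ((2 - β : ℝ) : ℂ) ^ m =
      ∑ m ∈ Finset.range K, b m * ((2 - β : ℝ) : ℂ) ^ m - P 1 * ((((2 - β : ℝ) : ℂ) ^ K - 1) / (1 - β)) := by
    simp only [sub_mul, Finset.sum_sub_distrib, ← Finset.mul_sum]
    rw [geom_sum_eq]
    · congr 3
      push_cast; ring
    · push_cast
      intro h
      apply hβne
      linear_combination -h
  rw [hHs' _ hβne, hgeom] at hsplit
  set tail := ∑' m, (b (m + K) - P 1) * ((2 - β : ℝ) : ℂ) ^ (m + K) with htl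
  have hmain : 1 ≤ (∑ m ∈ Finset.range K, b m * ((2 - β : ℝ) : ℂ) ^ m).re := by
    rw [re_sum]
    have h0 : ∀ m, (b m * ((2 - β : ℝ) : ℂ) ^ m).re = (b m).re * (2 - β) ^ m := by
      intro m
      rw [← ofReal_pow, re_mul_ofReal]
    simp only [h0]
    calc (1:ℝ) ≤ (b 0).re * (2 - β) ^ 0 := by simpa using hb00
      _ ≤ _ := Finset.single_le_sum (f := fun m => (b m).re * (2 - β) ^ m) (fun m _ => by
          have := (Complex.le_def.1 (hb0 m)).1
          simp at this
          positivity) (by simp; omega)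
  have e1 : (1 - (β:ℂ)) ≠ 0 := sub_ne_zero.2 hβne.symm
  have e2 : ((β:ℂ) - 1) ≠ 0 := sub_ne_zero.2 hβne
  have hkey : riemannZeta β * P β = ∑ m ∈ Finset.range K, b m * ((2 - β : ℝ) : ℂ) ^ m - P 1 * (((2 - β : ℝ) : ℂ) ^ K / (1 - β)) + tail := by
    have e3 : ((β:ℂ) - 1)⁻¹ = -(1 - (β:ℂ))⁻¹ := by rw [← inv_neg]; ring_nf
    rw [e3] at hsplit
    linear_combination -hsplit
  have hre := congrArg Complex.re hkey
  rw [add_re, sub_re] at hre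
  have h6 : (P 1 * (((2 - β : ℝ) : ℂ) ^ K / (1 - β))).re ≤ ‖P 1‖ * (2 - β) ^ K / (1 - β) := by
    refine (re_le_norm _).trans (le_of_eq ?_)
    rw [norm_mul, norm_div, norm_pow, norm_real, Real.norm_of_nonneg h2β.le]
    have : ‖(1 - (β:ℂ))‖ = 1 - β := by
      rw [← ofReal_one, ← ofReal_sub, norm_real, Real.norm_of_nonneg (by linarith)]
    rw [this]; ring
  have h7 : -‖tail‖ ≤ tail.re := (abs_le.1 (abs_re_le_norm tail)).1
  linarith

end P4
end SW

namespace SW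
section P5
open Complex MeasureTheory Filter Topology DirichletCharacter
open scoped ComplexOrder

theorem siegel_lower : ∃ c A : ℝ, 0 < c ∧ 0 < A ∧ ∀ (f : ℕ → ℂ) (P : ℂ → ℂ) (M : ℝ), 0 ≤ f → f 1 = 1 →
    LSeries.abscissaOfAbsConv f ≤ 1 → Differentiable ℂ P →
    (∀ s : ℂ, 1 < s.re → LSeries f s = riemannZeta s * P s) → 1 ≤ M →
    (∀ s ∈ Metric.closedBall (2:ℂ) (4/3), ‖P s‖ ≤ M) →
    ∀ β : ℝ, 7/8 ≤ β → β < 1 → (riemannZeta β * P β).re ≤ 0 →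
      c * (1 - β) * M ^ (-(A * (1 - β))) ≤ ‖P 1‖ := by
  obtain ⟨C1, hC1, h⟩ := siegel_ineq
  set L := Real.log (32/27) with hL
  have hL0 : 0 < L := Real.log_pos (by norm_num)
  have hlC : 0 < Real.log (2 * C1) := Real.log_pos (by linarith)
  refine ⟨1 / 2 * Real.exp (-(Real.log (2 * C1) / L + 1)), 1 / L, by positivity, by positivity, ?_⟩
  intro f P M h1 h2 h3 h4 h5 hM1 h6 β hβ hβ1 hneg
  have hM0 : 0 < M := by linarith
  set K := ⌈Real.log (2 * C1 * M) / L⌉₊ with hK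
  have hpos : 0 < Real.log (2 * C1 * M) / L := div_pos (Real.log_pos (by nlinarith)) hL0
  have hK1 : 1 ≤ K := Nat.one_le_iff_ne_zero.2 (by rw [hK]; exact (Nat.ceil_pos.2 hpos).ne')
  have hKl : Real.log (2 * C1 * M) / L ≤ K := Nat.le_ceil _
  have hKu : (K:ℝ) ≤ Real.log (2 * C1 * M) / L + 1 := (Nat.ceil_lt_add_one hpos.le).le
  have := h f P M h1 h2 h3 h4 h5 h6 β hβ hβ1 hneg K hK1
  have ht : C1 * M * (27/32) ^ K ≤ 1 / 2 := by
    have e : (27/32 : ℝ) ^ K = Real.exp (-(K * L)) := by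
      rw [← Real.rpow_natCast, Real.rpow_def_of_pos (by norm_num)]
      congr 1
      have : Real.log (27/32) = -L := by rw [hL, ← Real.log_inv]; norm_num
      rw [this]; ring
    have h8 : 2 * C1 * M ≤ Real.exp (K * L) := by
      rw [← Real.log_le_iff_le_exp (by positivity)]
      rwa [div_le_iff₀ hL0] at hKl
    rw [e, Real.exp_neg, ← div_eq_mul_inv, div_le_iff₀ (Real.exp_pos _)]
    linarith
  have hx : 0 < 1 - β := by linarith
  have h9 : (2 - β) ^ K ≤ Real.exp ((1 - β) * K) := by
    have : 2 - β ≤ Real.exp (1 - β) := by have := Real.add_one_le_exp (1 - β); linarith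
    calc (2 - β) ^ K ≤ Real.exp (1 - β) ^ K := by
          gcongr
          linarith
      _ = _ := by rw [← Real.exp_nat_mul]; ring_nf
  have h10 : Real.exp ((1 - β) * K) ≤ Real.exp (Real.log (2 * C1) / L + 1) * M ^ (1 / L * (1 - β)) := by
    rw [Real.rpow_def_of_pos hM0, ← Real.exp_add]
    apply Real.exp_le_exp.2
    have e : Real.log (2 * C1 * M) = Real.log (2 * C1) + Real.log M := Real.log_mul (by positivity) (by positivity)
    rw [e] at hKu
    calc (1 - β) * K ≤ (1 - β) * ((Real.log (2 * C1) + Real.log M) / L + 1) := by gcongr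
      _ = (1 - β) * (Real.log (2 * C1) / L + 1) + Real.log M * (1 / L * (1 - β)) := by ring
      _ ≤ _ := by
        gcongr
        have : 0 ≤ Real.log (2 * C1) / L + 1 := by positivity
        nlinarith
  have h11 : 1 / 2 ≤ ‖P 1‖ * (2 - β) ^ K / (1 - β) := by linarith
  rw [le_div_iff₀ hx] at h11
  have h12 : 1 / 2 * (1 - β) ≤ ‖P 1‖ * (Real.exp (Real.log (2 * C1) / L + 1) * M ^ (1 / L * (1 - β))) := by
    refine h11.trans ?_
    gcongr
    exact h9.trans h10
  rw [Real.rpow_neg hM0.le, Real.exp_neg, mul_right_comm, mul_right_comm (1/2)]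
  have hE := Real.exp_pos (Real.log (2 * C1) / L + 1)
  have hMp : 0 < M ^ (1 / L * (1 - β)) := Real.rpow_pos_of_pos hM0 _
  rw [← div_eq_mul_inv, ← div_eq_mul_inv, div_div, div_mul_eq_mul_div, div_le_iff₀ (by positivity)]
  calc _ ≤ _ := h12
    _ = _ := by ring

/-- arithmetic function of a character -/
noncomputable def U {N : ℕ} (χ : DirichletCharacter ℂ N) : ArithmeticFunction ℂ :=
  toArithmeticFunction (fun n => χ n)

noncomputable def UL {N : ℕ} (χ : DirichletCharacter ℂ N) : ArithmeticFunction ℂ :=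
  toArithmeticFunction (fun n => χ n * (ArithmeticFunction.vonMangoldt n : ℂ))

noncomputable def DD (u : ArithmeticFunction ℂ) : ArithmeticFunction ℂ :=
  toArithmeticFunction (fun n => u n * (Real.log n : ℂ))

lemma DD_apply (u : ArithmeticFunction ℂ) (n : ℕ) : DD u n = u n * (Real.log n : ℂ) := by
  simp [DD, toArithmeticFunction]
  rintro rfl; simp

lemma DD_mul (u v : ArithmeticFunction ℂ) : DD (u * v) = DD u * v + u * DD v := by
  ext n
  rw [ArithmeticFunction.add_apply, DD_apply, ArithmeticFunction.mul_apply, ArithmeticFunction.mul_apply,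
    ArithmeticFunction.mul_apply, Finset.sum_mul, ← Finset.sum_add_distrib]
  apply Finset.sum_congr rfl
  rintro ⟨a, b⟩ hab
  rw [Nat.mem_divisorsAntidiagonal] at hab
  obtain ⟨rfl, hn⟩ := hab
  simp only [DD_apply]
  have ha : (a:ℝ) ≠ 0 := by intro h; simp at h; simp [h] at hn
  have hb : (b:ℝ) ≠ 0 := by intro h; simp at h; simp [h] at hn
  push_cast [Real.log_mul ha hb]
  ring

lemma DD_U {N : ℕ} (χ : DirichletCharacter ℂ N) : DD (U χ) = U χ * UL χ := by
  ext n
  have := congrFun (convolution_twist_vonMangoldt χ) n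
  rw [DD_apply]
  have e : LSeries.convolution ((fun n : ℕ => χ n) * (fun n : ℕ => (ArithmeticFunction.vonMangoldt n : ℂ))) (fun n : ℕ => χ n) n = (UL χ * U χ) n := rfl
  have e' := e.symm.trans this
  rw [mul_comm (U χ) (UL χ), e']
  by_cases hn : n = 0
  · subst hn; simp
  · simp [U, toArithmeticFunction, hn]

lemma U_one {N : ℕ} (χ : DirichletCharacter ℂ N) : U χ 1 = 1 := by
  simp [U, toArithmeticFunction]

lemma nonneg_of_log (u g : ArithmeticFunction ℂ) (h1 : u 1 = 1) (h : DD u = u * g) (hg : ∀ n, 0 ≤ g n)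
    (hg1 : g 1 = 0) : ∀ n, 0 ≤ u n := by
  intro n
  induction n using Nat.strong_induction_on with
  | _ n ih =>
    rcases Nat.lt_or_ge n 2 with hn | hn
    · interval_cases n
      · simp
      · rw [h1]; exact zero_le_one
    · have h2 : u n * (Real.log n : ℂ) = ∑ x ∈ n.divisorsAntidiagonal, u x.1 * g x.2 := by
        rw [← DD_apply, h, ArithmeticFunction.mul_apply]
      have h3 : 0 ≤ u n * (Real.log n : ℂ) := by
        rw [h2]
        apply Finset.sum_nonneg
        rintro ⟨a, b⟩ hab
        rw [Nat.mem_divisorsAntidiagonal] at hab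
        obtain ⟨rfl, h0⟩ := hab
        by_cases hb : b = 1
        · simp [hb, hg1]
        · have ha0 : 0 < a := Nat.pos_of_ne_zero (by rintro rfl; simp at h0)
          have hb0 : b ≠ 0 := by rintro rfl; simp at h0
          have hb2 : 2 ≤ b := by omega
          exact mul_nonneg (ih a (by nlinarith)) (hg b)
      have hl : 0 < Real.log n := Real.log_pos (by exact_mod_cast hn)
      have : u n = (u n * (Real.log n : ℂ)) * ((Real.log n)⁻¹ : ℝ) := by
        push_cast
        rw [mul_assoc, mul_inv_cancel₀ (by exact_mod_cast hl.ne'), mul_one]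
      rw [this]
      exact mul_nonneg h3 (by exact_mod_cast (inv_pos.2 hl).le)

lemma summable_U {N : ℕ} (χ : DirichletCharacter ℂ N) {s : ℂ} (hs : 1 < s.re) :
    LSeriesSummable (U χ) s := by
  apply summable_of_bdd _ hs
  intro n
  simp only [U, toArithmeticFunction, ArithmeticFunction.coe_mk]
  split_ifs
  · simp
  · exact χ.norm_le_one _

lemma LSeries_U {N : ℕ} [NeZero N] (χ : DirichletCharacter ℂ N) {s : ℂ} (hs : 1 < s.re) :
    LSeries (U χ) s = LFunction χ s := by
  rw [LFunction_eq_LSeries χ hs]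
  apply LSeries_congr
  intro n hn
  simp [U, toArithmeticFunction, hn]

/-- real characters: values -/
lemma real_val {N : ℕ} {χ : DirichletCharacter ℂ N} (h : χ ^ 2 = 1) (a : ZMod N) :
    χ a = 0 ∨ χ a = 1 ∨ χ a = -1 := by
  by_cases ha : IsUnit a
  · right
    have : χ a ^ 2 = 1 := by
      rw [← MulChar.pow_apply' χ (by norm_num), h, MulChar.one_apply ha]
    exact sq_eq_one_iff.mp this
  · left; exact χ.map_nonunit ha

lemma conj_LFunction {N : ℕ} [NeZero N] {χ : DirichletCharacter ℂ N} (h : χ ^ 2 = 1) (hχ : χ ≠ 1) (x : ℝ) :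
    (LFunction χ x).im = 0 := by
  have hd := differentiable_LFunction hχ
  have hd2 : Differentiable ℂ (fun s => (starRingEnd ℂ) (LFunction χ ((starRingEnd ℂ) s))) := by
    intro s
    have := (hd ((starRingEnd ℂ) s)).conj_conj
    rw [Complex.conj_conj] at this
    exact this
  have heq : (fun s => (starRingEnd ℂ) (LFunction χ ((starRingEnd ℂ) s))) = LFunction χ := by
    refine AnalyticOnNhd.eq_of_eventuallyEq (𝕜 := ℂ) (z₀ := 2) (fun z _ => hd2.analyticAt z) (fun z _ => hd.analyticAt z) ?_
    · have : {s : ℂ | 1 < s.re} ∈ 𝓝 (2:ℂ) := (isOpen_lt continuous_const continuous_re).mem_nhds (by simp)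
      filter_upwards [this] with s hs
      have hs' : 1 < ((starRingEnd ℂ) s).re := by simpa using hs
      rw [LFunction_eq_LSeries χ hs, LFunction_eq_LSeries χ hs', LSeries, LSeries, conj_tsum]
      apply tsum_congr
      intro n
      by_cases hn : n = 0
      · simp [hn]
      · rw [LSeries.term_of_ne_zero hn, LSeries.term_of_ne_zero hn, map_div₀]
        congr 1
        · rcases real_val h (n : ZMod N) with h | h | h <;> simp [h]
        · have := Complex.cpow_conj (n:ℂ) s (by rw [natCast_arg]; exact Real.pi_pos.ne)
          rw [this]; simp
  have := congrFun heq (x : ℂ)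
  simp only [conj_ofReal] at this
  exact Complex.conj_eq_iff_im.1 this

end P5
end SW

namespace SW
section P6


theorem divisor_bound {ε : ℝ} (hε : 0 < ε) : ∃ C : ℝ, 1 ≤ C ∧ ∀ n : ℕ, n ≠ 0 →
    (n.divisors.card : ℝ) ≤ C * (n:ℝ) ^ ε := by
  set B : ℝ := max 1 (1 / (ε * Real.log 2)) with hB
  have hB1 : 1 ≤ B := le_max_left _ _
  have hl2 : 0 < Real.log 2 := Real.log_pos (by norm_num)
  set Y : ℕ := ⌈(2:ℝ) ^ (1 / ε)⌉₊ with hY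
  refine ⟨B ^ Y, one_le_pow₀ hB1, ?_⟩
  intro n hn
  rw [Nat.card_divisors hn]
  have h1 : ∀ p ∈ n.primeFactors, ((n.factorization p : ℝ) + 1) ≤ (if p < Y then B else 1) * ((p:ℝ) ^ (n.factorization p)) ^ ε := by
    intro p hp
    have hp2 : 2 ≤ p := (Nat.prime_of_mem_primeFactors hp).two_le
    have hp2' : (2:ℝ) ≤ p := by exact_mod_cast hp2
    set a := n.factorization p
    have hpa : ((p:ℝ) ^ a) ^ ε = ((p:ℝ) ^ ε) ^ a := by
      rw [← Real.rpow_natCast, ← Real.rpow_natCast, ← Real.rpow_mul (by positivity), ← Real.rpow_mul (by positivity), mul_comm]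
    split_ifs with h
    · have h2 : (1:ℝ) + ε * Real.log 2 * a ≤ ((p:ℝ) ^ a) ^ ε := by
        rw [hpa]
        calc (1:ℝ) + ε * Real.log 2 * a ≤ Real.exp (ε * Real.log 2 * a) := by
              have := Real.add_one_le_exp (ε * Real.log 2 * a); linarith
          _ = ((2:ℝ) ^ ε) ^ a := by
              rw [Real.rpow_def_of_pos (by norm_num), ← Real.exp_nat_mul]; ring_nf
          _ ≤ _ := by gcongr
      have h3 : 1 ≤ B * (ε * Real.log 2) := by
        have : 1 / (ε * Real.log 2) ≤ B := le_max_right _ _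
        rwa [div_le_iff₀ (by positivity)] at this
      have ha : (0:ℝ) ≤ a := by positivity
      calc (a:ℝ) + 1 ≤ B * (1 + ε * Real.log 2 * a) := by nlinarith
        _ ≤ _ := by gcongr
    · push Not at h
      have h2 : (2:ℝ) ≤ (p:ℝ) ^ ε := by
        have : (2:ℝ) ^ (1 / ε) ≤ p := (Nat.le_ceil _).trans (by exact_mod_cast h)
        calc (2:ℝ) = ((2:ℝ) ^ (1 / ε)) ^ ε := by
              rw [← Real.rpow_mul (by norm_num), one_div, inv_mul_cancel₀ hε.ne', Real.rpow_one]
          _ ≤ _ := by gcongr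
      rw [one_mul, hpa]
      calc (a:ℝ) + 1 ≤ 2 ^ a := by exact_mod_cast Nat.lt_two_pow_self
        _ ≤ _ := by gcongr
  push_cast
  calc _ ≤ ∏ p ∈ n.primeFactors, ((if p < Y then B else 1) * ((p:ℝ) ^ (n.factorization p)) ^ ε) :=
        Finset.prod_le_prod (fun p _ => by positivity) h1
    _ = (∏ p ∈ n.primeFactors, (if p < Y then B else 1)) * (n:ℝ) ^ ε := by
        rw [Finset.prod_mul_distrib, Real.finsetProd_rpow _ _ (fun p _ => by positivity)]
        congr 2
        conv_rhs => rw [← Nat.prod_factorization_pow_eq_self hn]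
        rw [Finsupp.prod]
        push_cast
        rfl
    _ ≤ _ := by
        gcongr
        rw [← Finset.prod_filter, Finset.prod_const]
        apply pow_le_pow_right₀ hB1
        calc _ ≤ (Finset.range Y).card := by
              apply Finset.card_le_card
              intro p hp
              simp at hp ⊢
              exact hp.2
          _ = Y := by simp

theorem omega_bound {ε : ℝ} (hε : 0 < ε) : ∃ C : ℝ, 1 ≤ C ∧ ∀ n : ℕ, n ≠ 0 →
    (2 ^ n.primeFactors.card : ℝ) ≤ C * (n:ℝ) ^ ε := by
  obtain ⟨C, hC, h⟩ := divisor_bound hε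
  refine ⟨C, hC, fun n hn => le_trans ?_ (h n hn)⟩
  rw [Nat.card_divisors hn]
  push_cast
  rw [← Finset.prod_const]
  apply Finset.prod_le_prod
  · intros; norm_num
  · intro p hp
    have : 1 ≤ n.factorization p := by
      rw [← Nat.support_factorization, Finsupp.mem_support_iff] at hp
      omega
    have : (1:ℝ) ≤ n.factorization p := by exact_mod_cast this
    linarith
end P6
end SW

namespace SW
section P7
open Complex MeasureTheory Filter Topology DirichletCharacter
open scoped ComplexOrder

lemma UL_one {N : ℕ} (χ : DirichletCharacter ℂ N) : UL χ 1 = 0 := by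
  simp [UL, toArithmeticFunction]

lemma UL_apply {N : ℕ} (χ : DirichletCharacter ℂ N) (n : ℕ) : UL χ n = χ n * (ArithmeticFunction.vonMangoldt n : ℂ) := by
  by_cases hn : n = 0
  · subst hn; simp
  · simp [UL, toArithmeticFunction, hn]

lemma triv_apply (a : ZMod 1) : (1 : DirichletCharacter ℂ 1) a = 1 :=
  MulChar.one_apply (isUnit_of_subsingleton a)

lemma absc_le_one {u : ArithmeticFunction ℂ} (h : ∀ s : ℂ, 1 < s.re → LSeriesSummable u s) :
    LSeries.abscissaOfAbsConv u ≤ 1 := by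
  have := LSeries.abscissaOfAbsConv_le_of_forall_lt_LSeriesSummable (f := u) (x := 1) (fun y hy => h y (by simpa using hy))
  simpa using this

lemma LSeries_zeta {s : ℂ} (hs : 1 < s.re) : LSeries (U (1 : DirichletCharacter ℂ 1)) s = riemannZeta s := by
  rw [LSeries_U _ hs, LFunction_modOne_eq]

/-- crude bound on the ball -/
lemma ball_bound : ∃ C : ℝ, 1 ≤ C ∧ ∀ (q : ℕ) [NeZero q] (χ : DirichletCharacter ℂ q), χ ≠ 1 →
    ∀ s ∈ Metric.closedBall (2:ℂ) (4/3), ‖LFunction χ s‖ ≤ C * q := by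
  obtain ⟨C, hC, h⟩ := bound_nonprincipal (δ := 1/3) (by norm_num) (by norm_num)
  refine ⟨max 1 (C * (10/3)), le_max_left _ _, ?_⟩
  intro q _ χ hχ s hs
  rw [Metric.mem_closedBall, dist_eq] at hs
  have hq : (1:ℝ) ≤ q := by exact_mod_cast NeZero.pos q
  have h1 := (abs_re_le_norm (s - 2)).trans hs
  have h2 := (abs_im_le_norm (s - 2)).trans hs
  simp at h1 h2
  rw [abs_le] at h1
  refine (h q χ hχ s (by linarith) (by linarith)).trans ?_
  have hT : 1 ≤ q * (|s.im| + 2) := by nlinarith [abs_nonneg s.im]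
  calc C * (q * (|s.im| + 2)) ^ (2 * (1/3) : ℝ) ≤ C * (q * (|s.im| + 2)) ^ (1:ℝ) := by
        gcongr
        norm_num
    _ = C * (q * (|s.im| + 2)) := by rw [Real.rpow_one]
    _ ≤ C * (q * (4/3 + 2)) := by gcongr
    _ = C * (10/3) * q := by ring
    _ ≤ _ := by gcongr; exact le_max_right _ _

lemma lowerAB : ∃ c A C3 : ℝ, 0 < c ∧ 0 < A ∧ 1 ≤ C3 ∧
    (∀ (q : ℕ) [NeZero q] (χ : DirichletCharacter ℂ q), χ ^ 2 = 1 → χ ≠ 1 →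
      ∀ β : ℝ, 7/8 ≤ β → β < 1 → (riemannZeta β * LFunction χ β).re ≤ 0 →
      c * (1 - β) * (C3 * q) ^ (-(A * (1 - β))) ≤ ‖LFunction χ 1‖) ∧
    (∀ (q : ℕ) [NeZero q] (α χ : DirichletCharacter ℂ q), α ^ 2 = 1 → α ≠ 1 → χ ^ 2 = 1 → χ ≠ 1 → α * χ ≠ 1 →
      ∀ β : ℝ, 7/8 ≤ β → β < 1 → LFunction α β = 0 →
      c * (1 - β) * ((C3 * q) ^ 3) ^ (-(A * (1 - β))) ≤ ‖LFunction α 1 * LFunction χ 1 * LFunction (α * χ) 1‖) := by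
  obtain ⟨c, A, hc, hA, h⟩ := siegel_lower
  obtain ⟨C3, hC3, hb⟩ := ball_bound
  refine ⟨c, A, C3, hc, hA, hC3, ?_, ?_⟩
  · intro q _ χ hχ2 hχ β hβ hβ1 hneg
    have hq : (1:ℝ) ≤ q := by exact_mod_cast NeZero.pos q
    have hsum : ∀ s : ℂ, 1 < s.re → LSeriesSummable (U (1 : DirichletCharacter ℂ 1) * U χ : ArithmeticFunction ℂ) s :=
      fun s hs => ArithmeticFunction.LSeriesSummable_mul (summable_U _ hs) (summable_U _ hs)
    refine h (U (1 : DirichletCharacter ℂ 1) * U χ : ArithmeticFunction ℂ) (LFunction χ) (C3 * q) ?_ ?_ (absc_le_one hsum)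
      (differentiable_LFunction hχ) ?_ (by nlinarith) (hb q χ hχ) β hβ hβ1 hneg
    · apply nonneg_of_log _ (UL (1 : DirichletCharacter ℂ 1) + UL χ)
      · simp [U_one]
      · rw [DD_mul, DD_U, DD_U]; ring
      · intro n
        rw [ArithmeticFunction.add_apply, UL_apply, UL_apply, triv_apply, ← add_mul]
        refine mul_nonneg ?_ (by exact_mod_cast ArithmeticFunction.vonMangoldt_nonneg)
        rcases real_val hχ2 (n : ZMod q) with h | h | h <;> rw [h] <;> norm_num
      · simp [UL_one]
    · simp [U_one]
    · intro s hs
      rw [ArithmeticFunction.LSeries_mul' (summable_U _ hs) (summable_U _ hs), LSeries_zeta hs, LSeries_U _ hs]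
  · intro q _ α χ hα2 hα hχ2 hχ hαχ β hβ hβ1 h0
    have hq : (1:ℝ) ≤ q := by exact_mod_cast NeZero.pos q
    set u : ArithmeticFunction ℂ := U (1 : DirichletCharacter ℂ 1) * (U α * U χ * U (α * χ)) with hu
    have hsum1 : ∀ s : ℂ, 1 < s.re → LSeriesSummable (U α * U χ : ArithmeticFunction ℂ) s :=
      fun s hs => ArithmeticFunction.LSeriesSummable_mul (summable_U _ hs) (summable_U _ hs)
    have hsum2 : ∀ s : ℂ, 1 < s.re → LSeriesSummable (U α * U χ * U (α * χ) : ArithmeticFunction ℂ) s :=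
      fun s hs => ArithmeticFunction.LSeriesSummable_mul (hsum1 s hs) (summable_U _ hs)
    have hsum : ∀ s : ℂ, 1 < s.re → LSeriesSummable u s :=
      fun s hs => ArithmeticFunction.LSeriesSummable_mul (summable_U _ hs) (hsum2 s hs)
    refine h u (fun s => LFunction α s * LFunction χ s * LFunction (α * χ) s) ((C3 * q) ^ 3) ?_ ?_ (absc_le_one hsum)
      (((differentiable_LFunction hα).mul (differentiable_LFunction hχ)).mul (differentiable_LFunction hαχ)) ?_ ?_ ?_ β hβ hβ1 ?_
    · apply nonneg_of_log _ (UL (1 : DirichletCharacter ℂ 1) + (UL α + UL χ + UL (α * χ)))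
      · simp [hu, U_one]
      · rw [hu, DD_mul, DD_mul, DD_mul, DD_U, DD_U, DD_U, DD_U]; ring
      · intro n
        have : (UL (1 : DirichletCharacter ℂ 1) + (UL α + UL χ + UL (α * χ))) n = (1 + α n) * (1 + χ n) * (ArithmeticFunction.vonMangoldt n : ℂ) := by
          simp only [ArithmeticFunction.add_apply, UL_apply, triv_apply, MulChar.mul_apply]
          ring
        rw [this]
        refine mul_nonneg ?_ (by exact_mod_cast ArithmeticFunction.vonMangoldt_nonneg)
        rcases real_val hχ2 (n : ZMod q) with h | h | h <;> rw [h] <;>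
        rcases real_val hα2 (n : ZMod q) with h | h | h <;> rw [h] <;> norm_num
      · simp [UL_one]
    · simp [hu, U_one]
    · intro s hs
      rw [hu, ArithmeticFunction.LSeries_mul' (summable_U _ hs) (hsum2 s hs), ArithmeticFunction.LSeries_mul' (hsum1 s hs) (summable_U _ hs), ArithmeticFunction.LSeries_mul' (summable_U _ hs) (summable_U _ hs), LSeries_zeta hs, LSeries_U _ hs, LSeries_U _ hs, LSeries_U _ hs]
    · exact one_le_pow₀ (by nlinarith)
    · intro s hs
      have h1 := hb q α hα s hs
      have h2 := hb q χ hχ s hs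
      have h3 := hb q (α * χ) hαχ s hs
      simp only [norm_mul]
      calc _ ≤ (C3 * q) * (C3 * q) * (C3 * q) := by gcongr
        _ = _ := by ring
    · simp [h0]

/-- zeta is negative just left of 1 -/
lemma zeta_neg : ∃ ε : ℝ, 0 < ε ∧ ∀ β : ℝ, 1 - ε < β → β < 1 → (riemannZeta β).re ≤ 0 := by
  have hc : ContinuousAt (fun x : ℝ => (Z1 x).re) 1 := by
    have := Z1_diff.continuous
    fun_prop
  have h1 : ∀ᶠ x : ℝ in 𝓝 1, 0 < (Z1 x).re := by
    apply hc.eventually_const_lt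
    simp [Z1_one]
  rw [Metric.eventually_nhds_iff] at h1
  obtain ⟨ε, hε, h⟩ := h1
  refine ⟨ε, hε, ?_⟩
  intro β h1 h2
  have := h (y := β) (by rw [Real.dist_eq, abs_lt]; constructor <;> linarith)
  have hne : (β:ℂ) ≠ 1 := by exact_mod_cast h2.ne
  rw [Z1_of_ne hne, ← ofReal_one, ← ofReal_sub, re_ofReal_mul] at this
  by_contra hh
  push Not at hh
  nlinarith

lemma real_pos_of_nonzero {q : ℕ} [NeZero q] {χ : DirichletCharacter ℂ q} (hχ2 : χ ^ 2 = 1) (hχ : χ ≠ 1)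
    {β : ℝ} (hβ : β < 1) (hz : ∀ x : ℝ, β ≤ x → x < 1 → LFunction χ x ≠ 0) : 0 ≤ (LFunction χ β).re := by
  have hz' : ∀ x : ℝ, β ≤ x → (LFunction χ x).re ≠ 0 := by
    intro x hx h
    have : LFunction χ x = 0 := Complex.ext h (conj_LFunction hχ2 hχ x)
    rcases lt_or_ge x 1 with h1 | h1
    · exact hz x hx h1 this
    · exact LFunction_ne_zero_of_one_le_re χ (Or.inl hχ) (by simpa using h1) this
  have hc : Continuous (fun x : ℝ => (LFunction χ x).re) := by
    exact continuous_re.comp ((differentiable_LFunction hχ).continuous.comp continuous_ofReal)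
  -- positive far out
  have hlarge : ∃ x : ℝ, β ≤ x ∧ 0 ≤ (LFunction χ x).re := by
    have ht : Tendsto (fun x : ℝ => LSeries (fun n => χ n) x) atTop (𝓝 (χ (1:ℕ))) :=
      LSeries.tendsto_atTop (by
        refine lt_of_le_of_lt (LSeries.abscissaOfAbsConv_le_of_forall_lt_LSeriesSummable (x := 1) ?_) (EReal.coe_lt_top 1)
        intro y hy
        exact summable_of_bdd (fun n => χ.norm_le_one _) (by simpa using hy))
    have ht2 : Tendsto (fun x : ℝ => (LSeries (fun n => χ n) x).re) atTop (𝓝 1) := by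
      have := (continuous_re.tendsto _).comp ht
      simp only [Nat.cast_one, map_one, one_re] at this
      exact this
    have h1 := ht2.eventually_const_lt (show (0:ℝ) < 1 by norm_num)
    obtain ⟨x, hx1, hx2⟩ := (h1.and (eventually_ge_atTop (2:ℝ))).exists
    refine ⟨x, by linarith, ?_⟩
    rw [LFunction_eq_LSeries χ (by simp; linarith)]
    exact hx1.le
  obtain ⟨x, hx, hx0⟩ := hlarge
  by_contra hneg
  push Not at hneg
  obtain ⟨y, hy, hy0⟩ := intermediate_value_Icc hx hc.continuousOn ⟨hneg.le, hx0⟩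
  exact hz' y hy.1 hy0

theorem siegel {ε : ℝ} (hε : 0 < ε) : ∃ c : ℝ, 0 < c ∧ ∀ (q : ℕ) [NeZero q] (χ : DirichletCharacter ℂ q),
    χ ^ 2 = 1 → χ ≠ 1 → c * (q:ℝ) ^ (-ε) ≤ ‖LFunction χ 1‖ := by
  obtain ⟨c, A, C3, hc, hA, hC3, hlA, hlB⟩ := lowerAB
  obtain ⟨ε0, hε0, hzeta⟩ := zeta_neg
  set η : ℝ := min (ε / 4) 1 with hη
  have hη0 : 0 < η := by positivity
  have hη1 : η ≤ 1 := min_le_right _ _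
  have hηε : 4 * η ≤ ε := by have := min_le_left (ε / 4) 1; linarith
  set ε1 : ℝ := min (min (1/8) ε0) (η / (3 * A)) with hε1
  have hε10 : 0 < ε1 := by positivity
  have hε1a : ε1 ≤ 1/8 := (min_le_left _ _).trans (min_le_left _ _)
  have hε1b : ε1 ≤ ε0 := (min_le_left _ _).trans (min_le_right _ _)
  have hε1c : A * ε1 * 3 ≤ η := by
    have : ε1 ≤ η / (3 * A) := min_le_right _ _
    rw [le_div_iff₀ (by positivity)] at this
    linarith
  by_cases hcase : ∀ (q : ℕ) [NeZero q] (χ : DirichletCharacter ℂ q), χ ^ 2 = 1 → χ ≠ 1 →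
      ∀ x : ℝ, 1 - ε1 < x → x < 1 → LFunction χ x ≠ 0
  · set β : ℝ := 1 - ε1 / 2 with hβ
    refine ⟨c * (ε1 / 2) * C3 ^ (-ε), by positivity, ?_⟩
    intro q _ χ hχ2 hχ
    have hq : (1:ℝ) ≤ q := by exact_mod_cast NeZero.pos q
    have hpos := real_pos_of_nonzero hχ2 hχ (β := β) (by linarith) (fun x h1 h2 => hcase q χ hχ2 hχ x (by linarith) h2)
    have hz := hzeta β (by linarith) (by linarith)
    have him := conj_LFunction hχ2 hχ β
    have := hlA q χ hχ2 hχ β (by linarith) (by linarith) (by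
      rw [mul_re, him]
      nlinarith)
    refine le_trans ?_ this
    have e : 1 - β = ε1 / 2 := by rw [hβ]; ring
    rw [e, mul_assoc, ← Real.mul_rpow (by positivity) (by positivity)]
    gcongr
    · nlinarith
    · nlinarith
  · push Not at hcase
    obtain ⟨q1, hq1, χ1, hχ12, hχ1, β, hβ0, hβ1, hz⟩ := hcase
    have hL1 : 0 < ‖LFunction χ1 1‖ := norm_pos_iff.2 (LFunction_apply_one_ne_zero hχ1)
    obtain ⟨C4, hC4, hup⟩ := bound_nonprincipal (δ := η / 2) (by positivity) (by linarith)
    obtain ⟨C5, hC5, hom⟩ := omega_bound hη0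
    have hq1' : (1:ℝ) ≤ q1 := by exact_mod_cast NeZero.pos q1
    have h1β : 0 < 1 - β := by linarith
    -- the lower bound constant at level N
    set c6 : ℝ := min (‖LFunction χ1 1‖ * C5⁻¹) (c * (1 - β) * C3 ^ (-η) * (C4 * 2 ^ η)⁻¹ * (C4 * 2 ^ η)⁻¹) with hc6
    have hc60 : 0 < c6 := by positivity
    refine ⟨c6 * C5⁻¹ * (q1:ℝ) ^ (-ε), by positivity, ?_⟩
    intro q _ χ hχ2 hχ
    have hq : (1:ℝ) ≤ q := by exact_mod_cast NeZero.pos q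
    set N := q * q1 with hN
    have hN0 : N ≠ 0 := mul_ne_zero (NeZero.ne q) (NeZero.ne q1)
    haveI : NeZero N := ⟨hN0⟩
    have hN1 : (1:ℝ) ≤ N := by exact_mod_cast NeZero.pos N
    have hNp : (0:ℝ) < N := by linarith
    set χ' := changeLevel (Dvd.intro q1 rfl : q ∣ N) χ with hχ'
    set α := changeLevel (Dvd.intro_left q rfl : q1 ∣ N) χ1 with hα
    have hχ'2 : χ' ^ 2 = 1 := by rw [hχ', ← map_pow, hχ2, map_one]
    have hα2 : α ^ 2 = 1 := by rw [hα, ← map_pow, hχ12, map_one]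
    have hχ'1 : χ' ≠ 1 := fun h => hχ ((changeLevel_eq_one_iff _).1 h)
    have hα1 : α ≠ 1 := fun h => hχ1 ((changeLevel_eq_one_iff _).1 h)
    have hEu : ∀ (r : ℕ) (ψ : DirichletCharacter ℂ r) (p : ℕ), 2 ≤ p → 1/2 ≤ ‖1 - ψ p * (p:ℂ) ^ (-(1:ℂ))‖ ∧ ‖1 - ψ p * (p:ℂ) ^ (-(1:ℂ))‖ ≤ 2 := by
      intro r ψ p hp
      have h1 : ‖ψ p * (p:ℂ) ^ (-(1:ℂ))‖ ≤ 1/2 := by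
        rw [norm_mul, cpow_neg_one, norm_inv, Complex.norm_natCast]
        have h2 : (2:ℝ) ≤ p := by exact_mod_cast hp
        have h3 : (p:ℝ)⁻¹ ≤ 2⁻¹ := by gcongr
        have := ψ.norm_le_one p
        have h4 : 0 ≤ (p:ℝ)⁻¹ := by positivity
        nlinarith [norm_nonneg (ψ p)]
      constructor
      · have := norm_sub_norm_le (1:ℂ) (ψ p * (p:ℂ) ^ (-(1:ℂ)))
        rw [norm_one] at this
        linarith
      · have := norm_sub_le (1:ℂ) (ψ p * (p:ℂ) ^ (-(1:ℂ)))
        rw [norm_one] at this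
        linarith
    have hlow : c6 * (N:ℝ) ^ (-(3 * η)) ≤ ‖LFunction χ' 1‖ := by
      by_cases hαχ : α * χ' = 1
      · have e : χ' = α := by
          have : α * χ' = α * α := by rw [hαχ, ← sq, hα2]
          exact mul_left_cancel this
        rw [e, hα, LFunction_changeLevel _ _ (Or.inl hχ1), norm_mul, norm_prod]
        have h1 : C5⁻¹ * (N:ℝ) ^ (-(3 * η)) ≤ ∏ p ∈ N.primeFactors, ‖1 - χ1 p * (p:ℂ) ^ (-(1:ℂ))‖ := by
          calc C5⁻¹ * (N:ℝ) ^ (-(3 * η)) ≤ C5⁻¹ * (N:ℝ) ^ (-η) := by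
                gcongr
                linarith
            _ = (C5 * (N:ℝ) ^ η)⁻¹ := by rw [Real.rpow_neg hNp.le, mul_inv]
            _ ≤ (2 ^ N.primeFactors.card : ℝ)⁻¹ := by
                gcongr
                exact hom N hN0
            _ = ∏ p ∈ N.primeFactors, (1/2:ℝ) := by simp
            _ ≤ _ := by
                apply Finset.prod_le_prod
                · intros; norm_num
                · intro p hp
                  exact (hEu q1 χ1 p (Nat.prime_of_mem_primeFactors hp).two_le).1
        calc c6 * (N:ℝ) ^ (-(3 * η)) ≤ (‖LFunction χ1 1‖ * C5⁻¹) * (N:ℝ) ^ (-(3 * η)) := by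
              gcongr
              exact min_le_left _ _
          _ = ‖LFunction χ1 1‖ * (C5⁻¹ * (N:ℝ) ^ (-(3 * η))) := by ring
          _ ≤ _ := by gcongr
      · have hzα : LFunction α β = 0 := by
          rw [hα, LFunction_changeLevel _ _ (Or.inl hχ1), hz, zero_mul]
        have h1 := hlB N α χ' hα2 hα1 hχ'2 hχ'1 hαχ β (by linarith) hβ1 hzα
        have hub : ∀ ψ : DirichletCharacter ℂ N, ψ ≠ 1 → ‖LFunction ψ 1‖ ≤ C4 * 2 ^ η * (N:ℝ) ^ η := by
          intro ψ hψ
          have := hup N ψ hψ 1 (by simp; positivity) (by simp)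
          simp only [one_im, abs_zero, zero_add] at this
          rw [Real.mul_rpow (by positivity) (by norm_num)] at this
          have e : 2 * (η / 2) = η := by ring
          rw [e] at this
          linarith
        have h2 : c * (1 - β) * C3 ^ (-η) * (N:ℝ) ^ (-η) ≤ c * (1 - β) * ((C3 * N) ^ 3) ^ (-(A * (1 - β))) := by
          rw [mul_assoc _ (C3 ^ (-η)), ← Real.mul_rpow (by positivity) (by positivity), ← Real.rpow_natCast, ← Real.rpow_mul (by positivity)]
          gcongr
          · nlinarith
          · push_cast
            nlinarith
        rw [norm_mul, norm_mul] at h1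
        have h3 : ‖LFunction α 1‖ * ‖LFunction χ' 1‖ * ‖LFunction (α * χ') 1‖ ≤ (C4 * 2 ^ η * (N:ℝ) ^ η) * ‖LFunction χ' 1‖ * (C4 * 2 ^ η * (N:ℝ) ^ η) := by
          gcongr
          · exact hub α hα1
          · exact hub _ hαχ
        have h4 := (h2.trans h1).trans h3
        have hD : 0 < C4 * 2 ^ η := by positivity
        have hNη : 0 < (N:ℝ) ^ η := by positivity
        calc c6 * (N:ℝ) ^ (-(3 * η)) ≤ (c * (1 - β) * C3 ^ (-η) * (C4 * 2 ^ η)⁻¹ * (C4 * 2 ^ η)⁻¹) * (N:ℝ) ^ (-(3 * η)) := by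
              gcongr
              exact min_le_right _ _
          _ = (c * (1 - β) * C3 ^ (-η) * (N:ℝ) ^ (-η)) * ((C4 * 2 ^ η) * (N:ℝ) ^ η)⁻¹ * ((C4 * 2 ^ η) * (N:ℝ) ^ η)⁻¹ := by
              have e : (N:ℝ) ^ (-(3 * η)) = (N:ℝ) ^ (-η) * ((N:ℝ) ^ η)⁻¹ * ((N:ℝ) ^ η)⁻¹ := by
                rw [← Real.rpow_neg hNp.le, ← Real.rpow_add hNp, ← Real.rpow_add hNp]
                congr 1; ring
              rw [e, mul_inv]; ring
          _ ≤ ((C4 * 2 ^ η * (N:ℝ) ^ η) * ‖LFunction χ' 1‖ * (C4 * 2 ^ η * (N:ℝ) ^ η)) * ((C4 * 2 ^ η) * (N:ℝ) ^ η)⁻¹ * ((C4 * 2 ^ η) * (N:ℝ) ^ η)⁻¹ := by gcongr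
          _ = ‖LFunction χ' 1‖ := by field_simp
    have hdown : ‖LFunction χ' 1‖ ≤ ‖LFunction χ 1‖ * (C5 * (N:ℝ) ^ η) := by
      rw [hχ', LFunction_changeLevel _ _ (Or.inl hχ), norm_mul, norm_prod]
      gcongr
      refine le_trans ?_ (hom N hN0)
      rw [← Finset.prod_const]
      apply Finset.prod_le_prod
      · intros; positivity
      · intro p hp
        exact (hEu q χ p (Nat.prime_of_mem_primeFactors hp).two_le).2
    have h5 := hlow.trans hdown
    have hNη : 0 < (N:ℝ) ^ η := by positivity
    calc c6 * C5⁻¹ * (q1:ℝ) ^ (-ε) * (q:ℝ) ^ (-ε) = c6 * C5⁻¹ * (N:ℝ) ^ (-ε) := by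
          rw [hN]; push_cast
          rw [Real.mul_rpow (by positivity) (by positivity)]; ring
      _ ≤ c6 * C5⁻¹ * (N:ℝ) ^ (-(3 * η) - η) := by
          gcongr
          linarith
      _ = c6 * (N:ℝ) ^ (-(3 * η)) * (C5 * (N:ℝ) ^ η)⁻¹ := by
          rw [Real.rpow_sub hNp, mul_inv]; ring
      _ ≤ ‖LFunction χ 1‖ * (C5 * (N:ℝ) ^ η) * (C5 * (N:ℝ) ^ η)⁻¹ := by gcongr
      _ = _ := by field_simp

end P7
end SW

namespace SW
section P8
open Complex MeasureTheory Filter Topology DirichletCharacter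

lemma two_le_T (q : ℕ) [NeZero q] (t : ℝ) : 2 ≤ (q : ℝ) * (|t| + 2) := by
  have h1 : (1 : ℝ) ≤ q := by exact_mod_cast NeZero.one_le
  nlinarith [abs_nonneg t]

lemma upper_L {δ : ℝ} (hδ : 0 < δ) (hδ2 : δ ≤ 1 / 2) :
    ∃ C : ℝ, 1 ≤ C ∧ ∀ (q : ℕ) [NeZero q] (χ : DirichletCharacter ℂ q) (w : ℂ) (r : ℝ), 0 < r → r ≤ 1 →
      1 - δ ≤ w.re → w.re ≤ 4 → (χ ≠ 1 ∨ r ≤ ‖w - 1‖) →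
      ‖LFunction χ w‖ ≤ C / r * ((q : ℝ) * (|w.im| + 2)) ^ (2 * δ) := by
  obtain ⟨C1, hC1, h1⟩ := bound_char hδ hδ2
  obtain ⟨C2, hC2, h2⟩ := bound_nonprincipal hδ hδ2
  refine ⟨C1 + C2 + 1, by linarith, ?_⟩
  intro q _ χ w r hr hr1 hw1 hw2 hor
  have hT := two_le_T q w.im
  set T : ℝ := (q : ℝ) * (|w.im| + 2) with hTdef
  have hT1 : 1 ≤ T ^ (2 * δ) := Real.one_le_rpow (by linarith) (by linarith)
  have hr' : 1 ≤ 1 / r := by rw [le_div_iff₀ hr]; linarith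
  by_cases hχ : χ = 1
  · have hw : r ≤ ‖w - 1‖ := by
      rcases hor with h | h
      · exact absurd hχ h
      · exact h
    have hw0 : 0 < ‖w - 1‖ := by linarith
    have hne : w ≠ 1 := by
      intro h; simp [h] at hw0
    obtain ⟨κ, hκ, _, _, hb⟩ := h1 q χ
    have hb' := hb w hne hw1 hw2
    have : ‖w - 1‖ * ‖LFunction χ w‖ ≤ ‖w - 1‖ * (C1 * T ^ (2 * δ)) + 1 := by
      rw [← norm_mul]
      calc ‖(w - 1) * LFunction χ w‖ = ‖((w - 1) * LFunction χ w - κ) + κ‖ := by ring_nf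
        _ ≤ _ := (norm_add_le _ _).trans (add_le_add hb' hκ)
    have h3 : ‖LFunction χ w‖ ≤ C1 * T ^ (2 * δ) + 1 / ‖w - 1‖ := by
      have h4 : ‖w - 1‖ * (C1 * T ^ (2 * δ) + 1 / ‖w - 1‖) = ‖w - 1‖ * (C1 * T ^ (2 * δ)) + 1 := by
        field_simp
      exact le_of_mul_le_mul_left (h4 ▸ this) hw0
    have h5 : 1 / ‖w - 1‖ ≤ 1 / r := one_div_le_one_div_of_le hr hw
    calc ‖LFunction χ w‖ ≤ C1 * T ^ (2 * δ) * 1 + 1 / r := by linarith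
      _ ≤ C1 * T ^ (2 * δ) * (1 / r) + (1 / r) * T ^ (2 * δ) := by
          gcongr
          exact le_mul_of_one_le_right (by positivity) hT1
      _ ≤ (C1 + C2 + 1) / r * T ^ (2 * δ) := by
          have : 0 ≤ C2 / r * T ^ (2 * δ) := by positivity
          have e : (C1 + C2 + 1) / r * T ^ (2 * δ) = C1 * T ^ (2 * δ) * (1 / r) + (1 / r) * T ^ (2 * δ) + C2 / r * T ^ (2 * δ) := by ring
          linarith
  · calc ‖LFunction χ w‖ ≤ C2 * T ^ (2 * δ) := h2 q χ hχ w hw1 hw2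
      _ ≤ (C1 + C2 + 1) / r * T ^ (2 * δ) := by
          gcongr
          rw [le_div_iff₀ hr]; nlinarith

lemma ne_one_of_im {s : ℂ} (h : 1 ≤ |s.im|) : s ≠ 1 := by
  rintro rfl; simp at h; linarith

lemma abs_im_le_norm_sub_one (w : ℂ) : |w.im| ≤ ‖w - 1‖ := by
  have := abs_im_le_norm (w - 1)
  simpa using this

lemma deriv_L_le {δ : ℝ} (hδ : 0 < δ) (hδ2 : δ ≤ 1 / 2) :
    ∃ D : ℝ, 1 ≤ D ∧ ∀ (q : ℕ) [NeZero q] (χ : DirichletCharacter ℂ q) (s : ℂ),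
      1 ≤ s.re → s.re ≤ 3 → (χ ≠ 1 ∨ 1 ≤ |s.im|) →
      ‖deriv (LFunction χ) s‖ ≤ D * ((q : ℝ) * (|s.im| + 2)) ^ (2 * δ) := by
  obtain ⟨C, hC, h⟩ := upper_L hδ hδ2
  refine ⟨4 * C / δ, by rw [le_div_iff₀ hδ]; linarith, ?_⟩
  intro q _ χ s hs1 hs3 hor
  have hT := two_le_T q s.im
  set T : ℝ := (q : ℝ) * (|s.im| + 2) with hTdef
  have key : ∀ w : ℂ, ‖w - s‖ ≤ δ → (χ ≠ 1 ∨ 1 / 2 ≤ |w.im|) := by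
    intro w hw
    rcases hor with h | h
    · exact Or.inl h
    · right
      have h1 : |(w - s).im| ≤ δ := (abs_im_le_norm _).trans hw
      rw [sub_im, abs_sub_comm] at h1
      have := abs_sub_abs_le_abs_sub s.im w.im
      linarith
  have hd : DifferentiableOn ℂ (LFunction χ) (Metric.closedBall s δ) := by
    intro w hw
    rw [Metric.mem_closedBall, dist_eq_norm] at hw
    refine (differentiableAt_LFunction χ w ?_).differentiableWithinAt
    rcases key w hw with h | h
    · exact Or.inr h
    · left; rintro rfl; simp at h; linarith
  have := Complex.norm_deriv_le_of_forall_mem_sphere_norm_le (f := LFunction χ) (c := s) (C := 4 * C * T ^ (2 * δ)) hδ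
    (hd.diffContOnCl_ball le_rfl) ?_
  · calc _ ≤ _ := this
      _ = _ := by ring
  · intro w hw
    have hw' : ‖w - s‖ = δ := by simpa [dist_eq_norm] using hw
    have hre : |(w - s).re| ≤ δ := (abs_re_le_norm _).trans hw'.le
    have him : |(w - s).im| ≤ δ := (abs_im_le_norm _).trans hw'.le
    rw [sub_re, abs_le] at hre
    rw [sub_im] at him
    have him2 : |w.im| ≤ |s.im| + 1 / 2 := by
      have := abs_sub_abs_le_abs_sub w.im s.im
      linarith
    have hb := h q χ w (1 / 2) (by norm_num) (by norm_num) (by linarith) (by linarith)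
      ((key w hw'.le).imp id (fun h => h.trans (abs_im_le_norm_sub_one w)))
    calc ‖LFunction χ w‖ ≤ _ := hb
      _ ≤ C / (1 / 2) * (2 * T) ^ (2 * δ) := by
          have : (q : ℝ) * (|w.im| + 2) ≤ 2 * T := by
            rw [hTdef]
            have : (0 : ℝ) ≤ q := by positivity
            nlinarith [abs_nonneg s.im]
          gcongr
      _ = C / (1 / 2) * (2 ^ (2 * δ) * T ^ (2 * δ)) := by rw [Real.mul_rpow (by norm_num) (by linarith)]
      _ ≤ C / (1 / 2) * (2 ^ (1 : ℝ) * T ^ (2 * δ)) := by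
          have : (2 : ℝ) ^ (2 * δ) ≤ 2 ^ (1 : ℝ) := Real.rpow_le_rpow_of_exponent_le (by norm_num) (by linarith)
          gcongr
      _ = _ := by rw [Real.rpow_one]; ring

lemma diff_L_le {δ D : ℝ} (hδ : 0 < δ) (hD : ∀ (q : ℕ) [NeZero q] (χ : DirichletCharacter ℂ q) (s : ℂ),
      1 ≤ s.re → s.re ≤ 3 → (χ ≠ 1 ∨ 1 ≤ |s.im|) →
      ‖deriv (LFunction χ) s‖ ≤ D * ((q : ℝ) * (|s.im| + 2)) ^ (2 * δ)) (hD1 : 1 ≤ D)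
    (q : ℕ) [NeZero q] (χ : DirichletCharacter ℂ q) (s w : ℂ) (hs1 : 1 ≤ s.re) (hs3 : s.re ≤ 3)
    (hw1 : 1 ≤ w.re) (hw3 : w.re ≤ 3) (hor : χ ≠ 1 ∧ |w.im| ≤ |s.im| ∨ 1 ≤ |s.im| ∧ w.im = s.im) :
    ‖LFunction χ w - LFunction χ s‖ ≤ D * ((q : ℝ) * (|s.im| + 2)) ^ (2 * δ) * ‖w - s‖ := by
  rcases hor with ⟨hχ, h⟩ | ⟨h1, h⟩
  · refine Convex.norm_image_sub_le_of_norm_deriv_le (s := {z : ℂ | z.re ∈ Set.Icc 1 3} ∩ {z : ℂ | z.im ∈ Set.Icc (-|s.im|) |s.im|}) (fun z hz => differentiableAt_LFunction χ z (Or.inr hχ)) ?_ ?_ ?_ ?_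
    · rintro z ⟨hz1, hz2⟩
      refine (hD q χ z hz1.1 hz1.2 (Or.inl hχ)).trans ?_
      have : |z.im| ≤ |s.im| := abs_le.2 hz2
      gcongr
    · exact ((convex_Icc (1 : ℝ) 3).linear_preimage Complex.reLm).inter ((convex_Icc (-|s.im|) |s.im|).linear_preimage Complex.imLm)
    · exact ⟨⟨hs1, hs3⟩, abs_le.1 le_rfl⟩
    · exact ⟨⟨hw1, hw3⟩, abs_le.1 h⟩
  · refine Convex.norm_image_sub_le_of_norm_deriv_le (s := {z : ℂ | z.re ∈ Set.Icc 1 3} ∩ {z : ℂ | z.im ∈ Set.Icc s.im s.im}) (fun z hz => differentiableAt_LFunction χ z (Or.inl (ne_one_of_im ?_))) ?_ ?_ ?_ ?_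
    · have : z.im = s.im := le_antisymm hz.2.2 hz.2.1
      rwa [this]
    · rintro z ⟨hz1, hz2⟩
      have : z.im = s.im := le_antisymm hz2.2 hz2.1
      have h2 := hD q χ z hz1.1 hz1.2 (Or.inr (this ▸ h1))
      rwa [this] at h2
    · exact ((convex_Icc (1 : ℝ) 3).linear_preimage Complex.reLm).inter ((convex_Icc s.im s.im).linear_preimage Complex.imLm)
    · exact ⟨⟨hs1, hs3⟩, le_rfl, le_rfl⟩
    · exact ⟨⟨hw1, hw3⟩, h ▸ le_rfl, h ▸ le_rfl⟩

end P8
end SW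

namespace SW
section P9
open Complex MeasureTheory Filter Topology DirichletCharacter

lemma lower_far {δ A D : ℝ} (hδ : 0 < δ) (hA1 : 1 ≤ A) (hD1 : 1 ≤ D)
    (hA : ∀ (q : ℕ) [NeZero q] (χ : DirichletCharacter ℂ q) (w : ℂ) (r : ℝ), 0 < r → r ≤ 1 →
      1 - δ ≤ w.re → w.re ≤ 4 → (χ ≠ 1 ∨ r ≤ ‖w - 1‖) →
      ‖LFunction χ w‖ ≤ A / r * ((q : ℝ) * (|w.im| + 2)) ^ (2 * δ))
    (hD : ∀ (q : ℕ) [NeZero q] (χ : DirichletCharacter ℂ q) (s : ℂ),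
      1 ≤ s.re → s.re ≤ 3 → (χ ≠ 1 ∨ 1 ≤ |s.im|) →
      ‖deriv (LFunction χ) s‖ ≤ D * ((q : ℝ) * (|s.im| + 2)) ^ (2 * δ)) (hδ2 : δ ≤ 1 / 2)
    (q : ℕ) [NeZero q] (χ : DirichletCharacter ℂ q) (s : ℂ) (hs1 : 1 < s.re) (hs2 : s.re ≤ 2)
    (hor : χ ≠ 1 ∨ 1 ≤ |s.im|) (r : ℝ) (hr0 : 0 < r) (hr1 : r ≤ 1) (hr : χ ^ 2 ≠ 1 ∨ r ≤ ‖s - 1‖) :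
    1 / (32 * A ^ 4 * D ^ 3) * r * ((q : ℝ) * (|s.im| + 2)) ^ (-(14 * δ)) ≤ ‖LFunction χ s‖ := by
  have hT := two_le_T q s.im
  set T : ℝ := (q : ℝ) * (|s.im| + 2) with hTdef
  set B : ℝ := T ^ (2 * δ) with hB
  have hB1 : 1 ≤ B := Real.one_le_rpow (by linarith) (by linarith)
  have hq1 : (1 : ℝ) ≤ q := by exact_mod_cast NeZero.one_le
  set η : ℝ := r / (32 * A ^ 4 * D ^ 4 * B ^ 8) with hη
  have hη0 : 0 < η := by positivity
  have hden : 1 ≤ A ^ 4 * D ^ 4 * B ^ 8 := by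
    have h1 : 1 ≤ A ^ 4 := one_le_pow₀ hA1
    have h2 : 1 ≤ D ^ 4 := one_le_pow₀ hD1
    have h3 : 1 ≤ B ^ 8 := one_le_pow₀ hB1
    exact one_le_mul_of_one_le_of_one_le (one_le_mul_of_one_le_of_one_le h1 h2) h3
  have hη1 : η ≤ 1 := by
    rw [hη, div_le_one (by positivity)]
    nlinarith
  set x : ℝ := max (s.re - 1) η with hx
  have hx0 : 0 < x := lt_of_lt_of_le hη0 (le_max_right _ _)
  have hx1 : x ≤ 1 := max_le (by linarith) hη1
  set w : ℂ := 1 + x + I * s.im with hw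
  have hwre : w.re = 1 + x := by simp [hw]
  have hwim : w.im = s.im := by simp [hw]
  have h341 := norm_LFunction_product_ge_one χ hx0 s.im
  rw [norm_mul, norm_mul, norm_pow, norm_pow] at h341
  have b0 : ‖LFunctionTrivChar q (1 + x)‖ ≤ A / x * B := by
    have := hA q 1 (1 + x) x hx0 hx1 (by simp; linarith) (by simp; linarith) (Or.inr (by simp [abs_of_pos hx0]))
    refine this.trans ?_
    have e : (q : ℝ) * (|(1 + (x : ℂ)).im| + 2) ≤ T := by
      simp [hTdef]
      nlinarith [abs_nonneg s.im]
    rw [hB]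
    gcongr
  have b2 : ‖LFunction (χ ^ 2) (1 + x + 2 * I * s.im)‖ ≤ A / r * (2 * B) := by
    have := hA q (χ ^ 2) (1 + x + 2 * I * s.im) r hr0 hr1 (by simp; linarith) (by simp; linarith) (hr.imp id ?_)
    · refine this.trans ?_
      have e : (q : ℝ) * (|(1 + (x : ℂ) + 2 * I * s.im).im| + 2) ≤ 2 * T := by
        simp [hTdef, abs_mul]
        nlinarith [abs_nonneg s.im]
      have e2 : (2 : ℝ) ^ (2 * δ) ≤ 2 := by
        calc (2 : ℝ) ^ (2 * δ) ≤ 2 ^ (1 : ℝ) := Real.rpow_le_rpow_of_exponent_le (by norm_num) (by linarith)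
          _ = 2 := Real.rpow_one 2
      calc A / r * ((q : ℝ) * (|(1 + (x : ℂ) + 2 * I * s.im).im| + 2)) ^ (2 * δ) ≤ A / r * (2 * T) ^ (2 * δ) := by gcongr
        _ = A / r * (2 ^ (2 * δ) * B) := by rw [Real.mul_rpow (by norm_num) (by linarith)]
        _ ≤ _ := by gcongr
    · intro h
      refine h.trans ?_
      rw [Complex.norm_def, Complex.norm_def]
      apply Real.sqrt_le_sqrt
      rw [normSq_apply, normSq_apply]
      have hxx : s.re - 1 ≤ x := le_max_left _ _
      simp
      nlinarith [sq_nonneg s.im]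
  set X := ‖LFunction χ (1 + x + I * s.im)‖ with hX
  have hX0 : 0 ≤ X := norm_nonneg _
  have hXw : X = ‖LFunction χ w‖ := rfl
  have h4 : (2 * D * η * B) ^ 4 ≤ X ^ 4 := by
    have h5 : 1 ≤ (A / x * B) ^ 3 * X ^ 4 * (A / r * (2 * B)) := by
      refine h341.le.trans ?_
      gcongr
    have h6 : (A / x * B) ^ 3 * X ^ 4 * (A / r * (2 * B)) = (2 * A ^ 4 * B ^ 4) / (x ^ 3 * r) * X ^ 4 := by
      field_simp
    rw [h6, ← mul_comm, mul_div_assoc', le_div_iff₀ (by positivity)] at h5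
    have h7 : η ^ 3 ≤ x ^ 3 := by gcongr; exact le_max_right _ _
    have h8 : η ^ 3 * r ≤ X ^ 4 * (2 * A ^ 4 * B ^ 4) := by nlinarith
    have h9 : r = η * (32 * A ^ 4 * D ^ 4 * B ^ 8) := by rw [hη]; field_simp
    have h10 : (2 * D * η * B) ^ 4 * (2 * A ^ 4 * B ^ 4) = η ^ 3 * r := by
      rw [h9]; ring
    rw [← h10] at h8
    exact le_of_mul_le_mul_right h8 (by positivity)
  have h11 : 2 * D * η * B ≤ X := le_of_pow_le_pow_left₀ (by norm_num) hX0 h4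
  have hdiff := diff_L_le hδ hD hD1 q χ s w hs1.le (by linarith) (by rw [hwre]; linarith) (by rw [hwre]; linarith)
    (hor.imp (fun h => ⟨h, by rw [hwim]⟩) (fun h => ⟨h, hwim⟩))
  have hws : ‖w - s‖ ≤ η := by
    have e : w - s = ((x - (s.re - 1) : ℝ) : ℂ) := by
      apply Complex.ext
      · simp [hwre]; ring
      · simp [hwim]
    rw [e, Complex.norm_real, Real.norm_eq_abs, abs_of_nonneg (sub_nonneg.2 (le_max_left _ _))]
    have : x ≤ (s.re - 1) + η := max_le (by linarith) (by linarith)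
    linarith
  have h12 : ‖LFunction χ w‖ - ‖LFunction χ s‖ ≤ D * B * η :=
    ((norm_sub_norm_le _ _).trans hdiff).trans (by gcongr)
  have h13 : D * B * η ≤ ‖LFunction χ s‖ := by
    rw [← hXw] at h12; nlinarith
  refine le_trans (le_of_eq ?_) h13
  have e : T ^ (-(14 * δ)) = (B ^ 7)⁻¹ := by
    rw [hB, ← Real.rpow_natCast, ← Real.rpow_mul (by linarith), ← Real.rpow_neg (by linarith)]
    congr 1; push_cast; ring
  rw [e, hη]
  field_simp

theorem lower_L {ε : ℝ} (hε : 0 < ε) : ∃ c : ℝ, 0 < c ∧ c ≤ 1 ∧ ∀ (q : ℕ) [NeZero q] (χ : DirichletCharacter ℂ q) (s : ℂ),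
    1 < s.re → s.re ≤ 2 → (χ ≠ 1 ∨ 1 ≤ |s.im|) →
    c * ((q : ℝ) * (|s.im| + 2)) ^ (-ε) ≤ ‖LFunction χ s‖ := by
  set δ : ℝ := min (ε / 17) (1 / 2) with hδdef
  have hδ : 0 < δ := lt_min (by positivity) (by norm_num)
  have hδ2 : δ ≤ 1 / 2 := min_le_right _ _
  have hδε : 17 * δ ≤ ε := by
    have := min_le_left (ε / 17) (1 / 2 : ℝ)
    linarith
  obtain ⟨A, hA1, hA⟩ := upper_L hδ hδ2
  obtain ⟨D, hD1, hD⟩ := deriv_L_le hδ hδ2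
  obtain ⟨c, hc, hsie⟩ := siegel hδ
  set cr : ℝ := min 1 (c / (2 * D)) with hcr
  have hcr0 : 0 < cr := lt_min (by norm_num) (by positivity)
  have hcr1 : cr ≤ 1 := min_le_left _ _
  set k : ℝ := 1 / (32 * A ^ 4 * D ^ 3) with hk
  have hk0 : 0 < k := by positivity
  refine ⟨min 1 (min (k * cr) (c / 2)), by positivity, min_le_left _ _, ?_⟩
  intro q _ χ s hs1 hs2 hor
  have hT := two_le_T q s.im
  have hq1 : (1 : ℝ) ≤ q := by exact_mod_cast NeZero.one_le
  set T : ℝ := (q : ℝ) * (|s.im| + 2) with hTdef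
  have hT1 : 1 ≤ T := by linarith
  set r : ℝ := cr * T ^ (-(3 * δ)) with hr
  have hr0 : 0 < r := by positivity
  have hr1 : r ≤ 1 := by
    have : T ^ (-(3 * δ)) ≤ 1 := Real.rpow_le_one_of_one_le_of_nonpos hT1 (by linarith)
    have h0 : 0 ≤ T ^ (-(3 * δ)) := by positivity
    nlinarith
  by_cases hfar : χ ^ 2 ≠ 1 ∨ r ≤ ‖s - 1‖
  · have := lower_far hδ hA1 hD1 hA hD hδ2 q χ s hs1 hs2 hor r hr0 hr1 hfar
    refine le_trans ?_ this
    rw [← hk, ← hTdef, hr]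
    have e : k * (cr * T ^ (-(3 * δ))) * T ^ (-(14 * δ)) = k * cr * T ^ (-(17 * δ)) := by
      rw [mul_assoc, mul_assoc, ← Real.rpow_add (by linarith), ← mul_assoc]; congr 2; ring
    rw [e]
    gcongr
    · exact (min_le_right _ _).trans (min_le_left _ _)
  · push Not at hfar
    obtain ⟨h2, hs⟩ := hfar
    have him : |s.im| < 1 := lt_of_le_of_lt (abs_im_le_norm_sub_one s) (by linarith)
    have hχ : χ ≠ 1 := by
      rcases hor with h | h
      · exact h
      · linarith
    have h3 := hsie q χ h2 hχ
    have h4 := diff_L_le hδ hD hD1 q χ s 1 hs1.le (by linarith) (by simp) (by simp) (Or.inl ⟨hχ, by simp⟩)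
    rw [← hTdef] at h4
    have h5 : ‖LFunction χ 1‖ - ‖LFunction χ s‖ ≤ D * T ^ (2 * δ) * r := by
      refine ((norm_sub_norm_le _ _).trans h4).trans ?_
      rw [norm_sub_rev]; gcongr
    have h6 : D * T ^ (2 * δ) * r ≤ c / 2 * T ^ (-δ) := by
      have e : T ^ (2 * δ) * T ^ (-(3 * δ)) = T ^ (-δ) := by
        rw [← Real.rpow_add (by linarith)]; congr 1; ring
      calc D * T ^ (2 * δ) * r = D * cr * (T ^ (2 * δ) * T ^ (-(3 * δ))) := by rw [hr]; ring
        _ = D * cr * T ^ (-δ) := by rw [e]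
        _ ≤ D * (c / (2 * D)) * T ^ (-δ) := by gcongr; exact min_le_right _ _
        _ = _ := by field_simp
    have h7 : c * T ^ (-δ) ≤ c * (q : ℝ) ^ (-δ) := by
      have : (q : ℝ) ≤ T := by rw [hTdef]; nlinarith [abs_nonneg s.im]
      have := Real.rpow_le_rpow_of_nonpos (by linarith) this (by linarith : -δ ≤ 0)
      gcongr
    have h8 : c / 2 * T ^ (-δ) ≤ ‖LFunction χ s‖ := by linarith
    refine le_trans ?_ h8
    gcongr
    · exact (min_le_right _ _).trans (min_le_right _ _)
    · linarith

end P9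
end SW

namespace SW
section P10
open Complex MeasureTheory Filter Topology DirichletCharacter

lemma logderiv_bound {f : ℂ → ℂ} {s : ℂ} {δ M m : ℝ} (hδ : 0 < δ) (hM : 1 ≤ M) (hm : 0 < m) (hm1 : m ≤ 1)
    (hd : ∀ w ∈ Metric.closedBall s δ, DifferentiableAt ℂ f w) (hb : ∀ w ∈ Metric.closedBall s δ, ‖f w‖ ≤ M)
    (hl : m ≤ ‖f s‖) (k : ℕ) :
    ‖iteratedDeriv k (fun z => -deriv f z / f z) s‖ ≤ k.factorial * (4 * M / (δ * m)) ^ (k + 1) := by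
  have hdiv : m / M ≤ 1 := by rw [div_le_one (by linarith)]; linarith
  set ρ : ℝ := m * δ / (4 * M) with hρ
  have hρ0 : 0 < ρ := by positivity
  have hρδ : ρ ≤ δ / 4 := by
    have : ρ = m / M * (δ / 4) := by rw [hρ]; field_simp
    rw [this]
    have : 0 < δ / 4 := by positivity
    nlinarith
  have hsub : ∀ w, ‖w - s‖ ≤ δ / 2 → ‖deriv f w‖ ≤ 2 * M / δ := by
    intro w hw
    have hin : ∀ z ∈ Metric.closedBall w (δ / 2), z ∈ Metric.closedBall s δ := by
      intro z hz
      rw [Metric.mem_closedBall, dist_eq_norm] at hz ⊢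
      calc ‖z - s‖ = ‖(z - w) + (w - s)‖ := by ring_nf
        _ ≤ _ := norm_add_le _ _
        _ ≤ δ := by linarith
    have := Complex.norm_deriv_le_of_forall_mem_sphere_norm_le (f := f) (c := w) (C := M) (R := δ / 2) (by positivity)
      (DifferentiableOn.diffContOnCl_ball (U := Metric.closedBall w (δ / 2)) (fun z hz => (hd z (hin z hz)).differentiableWithinAt) le_rfl)
      (fun z hz => hb z (hin z (Metric.sphere_subset_closedBall hz)))
    refine this.trans (le_of_eq (by field_simp))
  have hlow : ∀ w, ‖w - s‖ ≤ ρ → m / 2 ≤ ‖f w‖ := by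
    intro w hw
    have h1 : ‖f s - f w‖ ≤ 2 * M / δ * ‖s - w‖ := by
      refine Convex.norm_image_sub_le_of_norm_deriv_le (s := Metric.closedBall s (δ / 2)) ?_ ?_ (convex_closedBall _ _) ?_ ?_
      · intro z hz
        refine hd z (Metric.closedBall_subset_closedBall (by linarith) hz)
      · intro z hz
        exact hsub z (by simpa [dist_eq_norm] using hz)
      · rw [Metric.mem_closedBall, dist_eq_norm]; linarith
      · simp; positivity
    have h2 : 2 * M / δ * ‖s - w‖ ≤ m / 2 := by
      rw [norm_sub_rev]
      calc 2 * M / δ * ‖w - s‖ ≤ 2 * M / δ * ρ := by gcongr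
        _ = m / 2 := by rw [hρ]; field_simp; norm_num
    have h3 := norm_sub_norm_le (f s) (f w)
    linarith
  have hne : ∀ w, ‖w - s‖ ≤ ρ → f w ≠ 0 := by
    intro w hw h0
    have := hlow w hw
    rw [h0, norm_zero] at this
    linarith
  have hdd : DifferentiableOn ℂ (fun z => -deriv f z / f z) (Metric.closedBall s ρ) := by
    intro w hw
    have hw' : ‖w - s‖ ≤ ρ := by simpa [dist_eq_norm] using hw
    have han : AnalyticAt ℂ f w := by
      have hop : DifferentiableOn ℂ f (Metric.ball s δ) := fun z hz => (hd z (Metric.ball_subset_closedBall hz)).differentiableWithinAt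
      refine hop.analyticAt (Metric.isOpen_ball.mem_nhds ?_)
      rw [Metric.mem_ball, dist_eq_norm]; linarith
    exact ((han.deriv.differentiableAt.neg).div han.differentiableAt (hne w hw')).differentiableWithinAt
  have := Complex.norm_iteratedDeriv_le_of_forall_mem_sphere_norm_le (f := (fun z => -deriv f z / f z)) (c := s) k (C := 4 * M / (δ * m)) hρ0
    (hdd.diffContOnCl_ball le_rfl) ?_
  · refine this.trans (le_of_eq ?_)
    have : ρ = (4 * M / (δ * m))⁻¹ := by rw [hρ]; field_simp
    rw [this, pow_succ]
    simp only [inv_pow, div_inv_eq_mul]; ring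
  · intro z hz
    have hz' : ‖z - s‖ ≤ ρ := by
      have : ‖z - s‖ = ρ := by simpa [dist_eq_norm] using hz
      exact this.le
    rw [norm_div, norm_neg]
    calc ‖deriv f z‖ / ‖f z‖ ≤ (2 * M / δ) / (m / 2) := by
          gcongr
          · exact hsub z (by linarith)
          · exact hlow z hz'
      _ = 4 * M / (δ * m) := by field_simp; norm_num

lemma near_facts {q : ℕ} [NeZero q] {χ : DirichletCharacter ℂ q} {s w : ℂ} {δ : ℝ} (hδ2 : δ ≤ 1 / 2)
    (hor : χ ≠ 1 ∨ 1 ≤ |s.im|) (hs1 : 1 < s.re) (hs2 : s.re ≤ 2)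
    (hw : w ∈ Metric.closedBall s δ) : DifferentiableAt ℂ (LFunction χ) w ∧ 1 - δ ≤ w.re ∧ w.re ≤ 4 ∧
    (χ ≠ 1 ∨ 1 / 2 ≤ ‖w - 1‖) ∧ (q : ℝ) * (|w.im| + 2) ≤ 2 * ((q : ℝ) * (|s.im| + 2)) := by
  have hw' : ‖w - s‖ ≤ δ := by simpa [dist_eq_norm] using hw
  have hre : |(w - s).re| ≤ δ := (abs_re_le_norm _).trans hw'
  have him : |(w - s).im| ≤ δ := (abs_im_le_norm _).trans hw'
  rw [sub_re, abs_le] at hre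
  rw [sub_im] at him
  have him2 : |w.im| ≤ |s.im| + 1 / 2 := by
    have := abs_sub_abs_le_abs_sub w.im s.im
    linarith
  have hor2 : χ ≠ 1 ∨ 1 / 2 ≤ |w.im| := by
    refine hor.imp id fun h => ?_
    rw [abs_sub_comm] at him
    have := abs_sub_abs_le_abs_sub s.im w.im
    linarith
  refine ⟨differentiableAt_LFunction χ w ?_, by linarith, by linarith, hor2.imp id (fun h => h.trans (abs_im_le_norm_sub_one w)), ?_⟩
  · rcases hor2 with h | h
    · exact Or.inr h
    · left; rintro rfl; simp at h; linarith
  · have : (0 : ℝ) ≤ q := by positivity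
    nlinarith [abs_nonneg s.im]

lemma two_rpow_le {T δ : ℝ} (hδ2 : δ ≤ 1 / 2) (hT : 0 ≤ T) : (2 * T) ^ (2 * δ) ≤ 2 * T ^ (2 * δ) := by
  rw [Real.mul_rpow (by norm_num) hT]
  gcongr
  calc (2 : ℝ) ^ (2 * δ) ≤ 2 ^ (1 : ℝ) := Real.rpow_le_rpow_of_exponent_le (by norm_num) (by linarith)
    _ = 2 := Real.rpow_one 2

theorem logderiv_L (k : ℕ) {ε : ℝ} (hε : 0 < ε) : ∃ C : ℝ, 0 < C ∧ ∀ (q : ℕ) [NeZero q] (χ : DirichletCharacter ℂ q) (s : ℂ),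
    1 < s.re → s.re ≤ 2 → (χ ≠ 1 ∨ 1 ≤ |s.im|) →
    ‖iteratedDeriv k (fun z => -deriv (LFunction χ) z / LFunction χ z) s‖ ≤ C * ((q : ℝ) * (|s.im| + 2)) ^ ε := by
  set δ : ℝ := min (ε / (4 * (k + 1))) (1 / 2) with hδdef
  have hδ : 0 < δ := lt_min (by positivity) (by norm_num)
  have hδ2 : δ ≤ 1 / 2 := min_le_right _ _
  have hδε : 4 * δ * (k + 1) ≤ ε := by
    have := min_le_left (ε / (4 * (k + 1))) (1 / 2 : ℝ)
    rw [← hδdef, le_div_iff₀ (by positivity)] at this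
    linarith
  obtain ⟨A, hA1, hA⟩ := upper_L hδ hδ2
  obtain ⟨c, hc0, hc1, hc⟩ := lower_L (ε := 2 * δ) (by linarith)
  refine ⟨k.factorial * (16 * A / (δ * c)) ^ (k + 1), by positivity, ?_⟩
  intro q _ χ s hs1 hs2 hor
  have hT := two_le_T q s.im
  have hl := hc q χ s hs1 hs2 hor
  have hnf : ∀ w ∈ Metric.closedBall s δ, _ := fun w hw => near_facts (χ := χ) (w := w) hδ2 hor hs1 hs2 hw
  set T : ℝ := (q : ℝ) * (|s.im| + 2) with hTdef
  have hT1 : 1 ≤ T := by linarith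
  have hB1 : 1 ≤ T ^ (2 * δ) := Real.one_le_rpow hT1 (by linarith)
  have := logderiv_bound (f := LFunction χ) (s := s) (M := 4 * A * T ^ (2 * δ)) (m := c * T ^ (-(2 * δ))) hδ (by nlinarith) (by positivity) ?_
    (fun w hw => (hnf w hw).1) ?_ hl k
  · refine this.trans ?_
    have e : 4 * (4 * A * T ^ (2 * δ)) / (δ * (c * T ^ (-(2 * δ)))) = 16 * A / (δ * c) * T ^ (4 * δ) := by
      rw [Real.rpow_neg (by linarith), show 4 * δ = 2 * δ + 2 * δ by ring, Real.rpow_add (by linarith)]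
      field_simp; norm_num
    rw [e, mul_pow, ← Real.rpow_mul_natCast (by linarith), ← mul_assoc]
    push_cast
    gcongr
  · have : T ^ (-(2 * δ)) ≤ 1 := Real.rpow_le_one_of_one_le_of_nonpos hT1 (by linarith)
    have h0 : 0 ≤ T ^ (-(2 * δ)) := by positivity
    nlinarith
  · intro w hw
    obtain ⟨-, h1, h2, h3, h4⟩ := hnf w hw
    calc ‖LFunction χ w‖ ≤ _ := hA q χ w (1 / 2) (by norm_num) (by norm_num) h1 h2 h3
      _ ≤ A / (1 / 2) * (2 * T) ^ (2 * δ) := by gcongr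
      _ ≤ A / (1 / 2) * (2 * T ^ (2 * δ)) := by gcongr; exact two_rpow_le hδ2 (by linarith)
      _ = _ := by ring

lemma zeta_deriv_bound (k : ℕ) {ε : ℝ} (hε : 0 < ε) : ∃ C : ℝ, 0 < C ∧ ∀ (s : ℂ),
    1 < s.re → s.re ≤ 2 → 1 ≤ |s.im| → ‖iteratedDeriv k riemannZeta s‖ ≤ C * (|s.im| + 2) ^ ε := by
  set δ : ℝ := min (ε / 2) (1 / 2) with hδdef
  have hδ : 0 < δ := lt_min (by positivity) (by norm_num)
  have hδ2 : δ ≤ 1 / 2 := min_le_right _ _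
  have hδε : 2 * δ ≤ ε := by
    have := min_le_left (ε / 2) (1 / 2 : ℝ)
    linarith
  obtain ⟨A, hA1, hA⟩ := upper_L hδ hδ2
  refine ⟨k.factorial * (4 * A) / δ ^ k, by positivity, ?_⟩
  intro s hs1 hs2 him
  have hnf : ∀ w ∈ Metric.closedBall s δ, _ := fun w hw => near_facts (q := 1) (χ := 1) (w := w) hδ2 (Or.inr him) hs1 hs2 hw
  simp only [LFunction_modOne_eq, Nat.cast_one, one_mul] at hnf
  have := Complex.norm_iteratedDeriv_le_of_forall_mem_sphere_norm_le (f := riemannZeta) (c := s) k (C := 4 * A * (|s.im| + 2) ^ (2 * δ)) hδ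
    (DifferentiableOn.diffContOnCl_ball (U := Metric.closedBall s δ) (fun z hz => (hnf z hz).1.differentiableWithinAt) le_rfl) ?_
  · refine this.trans ?_
    rw [← mul_assoc, mul_div_right_comm]
    gcongr
    linarith [abs_nonneg s.im]
  · intro w hw
    obtain ⟨-, h1, h2, h3, h4⟩ := hnf w (Metric.sphere_subset_closedBall hw)
    have h5 := hA 1 1 w (1 / 2) (by norm_num) (by norm_num) h1 h2 h3
    simp only [LFunction_modOne_eq, Nat.cast_one, one_mul] at h5
    calc ‖riemannZeta w‖ ≤ _ := h5
      _ ≤ A / (1 / 2) * (2 * (|s.im| + 2)) ^ (2 * δ) := by gcongr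
      _ ≤ A / (1 / 2) * (2 * (|s.im| + 2) ^ (2 * δ)) := by gcongr; exact two_rpow_le hδ2 (by positivity)
      _ = _ := by ring

noncomputable def Hz (s : ℂ) : ℂ := -deriv Z1 s / Z1 s - dslope Z1 1 s

lemma Z1_ne {s : ℂ} (hs : 1 ≤ s.re) : Z1 s ≠ 0 := by
  by_cases h : s = 1
  · subst h; simp [Z1_one]
  · rw [Z1_of_ne h]
    exact mul_ne_zero (sub_ne_zero.2 h) (riemannZeta_ne_zero_of_one_le_re hs)

lemma Hz_analytic {s : ℂ} (hs : 1 ≤ s.re) : AnalyticAt ℂ Hz s := by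
  have h1 : AnalyticAt ℂ Z1 s := Z1_diff.analyticAt s
  have h2 : Differentiable ℂ (dslope Z1 1) := by
    rw [← differentiableOn_univ]
    exact (Complex.differentiableOn_dslope (by simp)).2 Z1_diff.differentiableOn
  exact (h1.deriv.neg.div h1 (Z1_ne hs)).sub (h2.analyticAt s)

lemma Hz_eq {s : ℂ} (hs : 1 < s.re) : -deriv riemannZeta s / riemannZeta s - riemannZeta s = Hz s := by
  have hne : s ≠ 1 := by rintro rfl; simp at hs
  have h0 : s - 1 ≠ 0 := sub_ne_zero.2 hne
  have hz : riemannZeta s ≠ 0 := riemannZeta_ne_zero_of_one_le_re hs.le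
  have hev : Z1 =ᶠ[𝓝 s] fun z => (z - 1) * riemannZeta z := by
    filter_upwards [isOpen_ne.mem_nhds hne] with z hz using Z1_of_ne hz
  have hd : deriv Z1 s = riemannZeta s + (s - 1) * deriv riemannZeta s := by
    rw [hev.deriv_eq]
    have h1 : HasDerivAt (fun z : ℂ => z - 1) 1 s := (hasDerivAt_id s).sub_const 1
    have := (h1.mul (differentiableAt_riemannZeta hne).hasDerivAt).deriv
    rw [one_mul] at this
    exact this
  rw [Hz, hd, dslope_of_ne _ hne, slope_def_field, Z1_of_ne hne, Z1_one]
  field_simp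
  ring

theorem logderiv_zeta (k : ℕ) {ε : ℝ} (hε : 0 < ε) : ∃ C : ℝ, 0 < C ∧ ∀ (s : ℂ),
    1 < s.re → s.re ≤ 2 →
    ‖iteratedDeriv k (fun z => -deriv riemannZeta z / riemannZeta z - riemannZeta z) s‖ ≤ C * (|s.im| + 2) ^ ε := by
  obtain ⟨C1, hC1, h1⟩ := logderiv_L k hε
  obtain ⟨C2, hC2, h2⟩ := zeta_deriv_bound k hε
  have hcomp : IsCompact ({s : ℂ | s.re ∈ Set.Icc 1 2} ∩ {s : ℂ | s.im ∈ Set.Icc (-1) 1}) :=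
    isCompact_Icc.reProdIm isCompact_Icc
  have han : ∀ s : ℂ, 1 ≤ s.re → AnalyticAt ℂ (iteratedDeriv k Hz) s := by
    intro s hs
    rw [iteratedDeriv_eq_iterate]
    exact (Hz_analytic hs).iterated_deriv k
  obtain ⟨C3, hC3⟩ := hcomp.exists_bound_of_continuousOn (f := iteratedDeriv k Hz)
    (fun s hs => (han s hs.1.1).continuousAt.continuousWithinAt)
  refine ⟨C1 + C2 + |C3|, by positivity, ?_⟩
  intro s hs1 hs2
  have hB : 1 ≤ (|s.im| + 2) ^ ε := Real.one_le_rpow (by linarith [abs_nonneg s.im]) hε.le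
  by_cases him : 1 ≤ |s.im|
  · have e1 := h1 1 1 s hs1 hs2 (Or.inr him)
    have e2 := h2 s hs1 hs2 him
    have hone : LFunction (1 : DirichletCharacter ℂ 1) = riemannZeta := LFunction_modOne_eq
    rw [hone] at e1
    simp only [Nat.cast_one, one_mul] at e1
    have hne : s ≠ 1 := by rintro rfl; simp at hs1
    have hza : AnalyticAt ℂ riemannZeta s := by
      have : DifferentiableOn ℂ riemannZeta {z | z ≠ 1} := fun z hz => (differentiableAt_riemannZeta hz).differentiableWithinAt
      exact this.analyticAt (isOpen_ne.mem_nhds hne)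
    have hz : riemannZeta s ≠ 0 := riemannZeta_ne_zero_of_one_le_re hs1.le
    have hA : AnalyticAt ℂ (fun z => -deriv riemannZeta z / riemannZeta z) s := hza.deriv.neg.div hza hz
    rw [iteratedDeriv_fun_sub hA.contDiffAt hza.contDiffAt]
    refine (norm_sub_le _ _).trans ?_
    have : 0 ≤ |C3| * (|s.im| + 2) ^ ε := by positivity
    linarith
  · push Not at him
    have hev : (fun z => -deriv riemannZeta z / riemannZeta z - riemannZeta z) =ᶠ[𝓝 s] Hz := by
      filter_upwards [(isOpen_lt continuous_const continuous_re).mem_nhds hs1] with z hz using Hz_eq hz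
    rw [hev.iteratedDeriv_eq]
    refine (hC3 s ⟨⟨hs1.le, hs2⟩, abs_le.1 him.le⟩).trans ?_
    have := le_abs_self C3
    have h5 := abs_nonneg C3
    nlinarith [mul_nonneg (add_nonneg hC1.le hC2.le) (by linarith : (0:ℝ) ≤ (|s.im| + 2) ^ ε)]

end P10
end SW

namespace SW
section P11
open Complex MeasureTheory Filter Topology

noncomputable def rz (y : ℝ) : ℂ := (Set.Ioc (0:ℝ) 1).indicator (fun _ => (1:ℂ)) y - (Set.Ioc (0:ℝ) 1).indicator (fun t : ℝ => (t:ℂ) ^ (1:ℂ)) y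

lemma rz_eq {y : ℝ} (hy : 0 < y) : rz y = ((max (1 - y) 0 : ℝ) : ℂ) := by
  unfold rz
  by_cases h : y ≤ 1
  · have hm : y ∈ Set.Ioc (0:ℝ) 1 := ⟨hy, h⟩
    rw [Set.indicator_of_mem hm, Set.indicator_of_mem hm, max_eq_left (by linarith)]
    simp
  · rw [Set.indicator_of_notMem (by simp; intro; linarith), Set.indicator_of_notMem (by simp; intro; linarith), max_eq_right (by linarith)]
    simp

lemma rz_mellin {s : ℂ} (hs : 0 < s.re) : HasMellin rz s (1 / (s * (s + 1))) := by
  have h1 := hasMellin_one_Ioc hs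
  have h2 := hasMellin_cpow_Ioc 1 (s := s) (by simp; linarith)
  have h3 := hasMellin_sub h1.1 h2.1
  rw [h1.2, h2.2] at h3
  have e : 1 / s - 1 / (s + 1) = 1 / (s * (s + 1)) := by
    have a1 : s ≠ 0 := by rintro rfl; simp at hs
    have a2 : s + 1 ≠ 0 := by intro h; have := congrArg re h; simp at this; linarith
    field_simp; ring
  rw [e] at h3
  exact h3

lemma ker_norm {σ y : ℝ} (hσ : 1 ≤ σ) : ‖1 / (((σ : ℂ) + y * I) * ((σ : ℂ) + y * I + 1))‖ ≤ (1 + y ^ 2)⁻¹ := by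
  rw [norm_div, norm_one, norm_mul, ← one_div]
  have h1 : √(1 + y ^ 2) ≤ ‖(σ : ℂ) + y * I‖ := by
    rw [Complex.norm_def, normSq_apply]
    apply Real.sqrt_le_sqrt
    simp; nlinarith
  have h2 : √(1 + y ^ 2) ≤ ‖(σ : ℂ) + y * I + 1‖ := by
    rw [Complex.norm_def, normSq_apply]
    apply Real.sqrt_le_sqrt
    simp; nlinarith
  apply one_div_le_one_div_of_le (by positivity)
  calc 1 + y ^ 2 = √(1 + y ^ 2) * √(1 + y ^ 2) := (Real.mul_self_sqrt (by positivity)).symm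
    _ ≤ _ := by gcongr

lemma ker_cont {σ : ℝ} (hσ : 1 ≤ σ) : Continuous fun y : ℝ => 1 / (((σ : ℂ) + y * I) * ((σ : ℂ) + y * I + 1)) := by
  refine Continuous.div continuous_const (by fun_prop) ?_
  intro y
  refine mul_ne_zero ?_ ?_
  · intro h; have := congrArg re h; simp at this; linarith
  · intro h; have := congrArg re h; simp at this; linarith

lemma ker_int {σ : ℝ} (hσ : 1 ≤ σ) : Integrable fun y : ℝ => 1 / (((σ : ℂ) + y * I) * ((σ : ℂ) + y * I + 1)) := by
  refine Integrable.mono' integrable_inv_one_add_sq (ker_cont hσ).aestronglyMeasurable ?_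
  exact Eventually.of_forall fun y => ker_norm hσ

lemma rz_inv {σ : ℝ} (hσ : 1 ≤ σ) {u : ℝ} (hu : 0 < u) :
    (1 / (2 * Real.pi)) * ∫ y : ℝ, (u : ℂ) ^ (-((σ : ℂ) + y * I)) * (1 / (((σ : ℂ) + y * I) * ((σ : ℂ) + y * I + 1))) = ((max (1 - u) 0 : ℝ) : ℂ) := by
  have hm : ∀ y : ℝ, mellin rz ((σ : ℂ) + y * I) = 1 / (((σ : ℂ) + y * I) * ((σ : ℂ) + y * I + 1)) := fun y =>
    (rz_mellin (by simp; linarith)).2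
  have := mellinInv_mellin_eq σ rz hu (rz_mellin (by simp; linarith)).1 ?_ ?_
  · rw [rz_eq hu, mellinInv] at this
    rw [← this]
    simp only [hm, smul_eq_mul]
    rw [Complex.real_smul]
    push_cast
    rfl
  · have := ker_int hσ
    unfold Complex.VerticalIntegrable
    simp only [hm]
    exact this
  · have hev : (fun y : ℝ => ((max (1 - y) 0 : ℝ) : ℂ)) =ᶠ[𝓝 u] rz := by
      filter_upwards [lt_mem_nhds hu] with y hy using (rz_eq hy).symm
    refine ContinuousAt.congr ?_ hev
    exact (by fun_prop : Continuous fun y : ℝ => ((max (1 - y) 0 : ℝ) : ℂ)).continuousAt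

lemma half_pow_le (y : ℝ) : (|y| + 2) ^ (1 / 2 : ℝ) * (1 + y ^ 2)⁻¹ ≤ 5 * (1 + ‖y‖ ^ 2) ^ (-(3 / 2 : ℝ) / 2) := by
  have h0 : 0 < 1 + y ^ 2 := by positivity
  have h1 : (|y| + 2) ^ 2 ≤ 5 * (1 + y ^ 2) := by
    have := sq_abs y
    nlinarith [sq_nonneg (2 * |y| - 1)]
  have h2 : (|y| + 2) ^ (1 / 2 : ℝ) ≤ 5 * (1 + y ^ 2) ^ (1 / 4 : ℝ) := by
    calc (|y| + 2) ^ (1 / 2 : ℝ) = ((|y| + 2) ^ 2) ^ (1 / 4 : ℝ) := by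
          rw [← Real.rpow_natCast, ← Real.rpow_mul (by positivity)]; norm_num
      _ ≤ (5 * (1 + y ^ 2)) ^ (1 / 4 : ℝ) := by gcongr
      _ = 5 ^ (1 / 4 : ℝ) * (1 + y ^ 2) ^ (1 / 4 : ℝ) := Real.mul_rpow (by norm_num) h0.le
      _ ≤ 5 * (1 + y ^ 2) ^ (1 / 4 : ℝ) := by
          gcongr
          calc (5 : ℝ) ^ (1 / 4 : ℝ) ≤ 5 ^ (1 : ℝ) := Real.rpow_le_rpow_of_exponent_le (by norm_num) (by norm_num)
            _ = 5 := Real.rpow_one 5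
  calc _ ≤ 5 * (1 + y ^ 2) ^ (1 / 4 : ℝ) * (1 + y ^ 2)⁻¹ := by gcongr
    _ = 5 * ((1 + y ^ 2) ^ (1 / 4 : ℝ) * (1 + y ^ 2) ^ (-1 : ℝ)) := by rw [Real.rpow_neg_one]; ring
    _ = _ := by
      rw [← Real.rpow_add h0, Real.norm_eq_abs, sq_abs]; norm_num

theorem riesz : ∃ C : ℝ, 0 < C ∧ ∀ (a : ℕ → ℂ) (σ M x : ℝ), 1 ≤ σ → 0 < x → 0 ≤ M → LSeriesSummable a σ →
    (∀ y : ℝ, ‖LSeries a (σ + y * I)‖ ≤ M * (|y| + 2) ^ (1 / 2 : ℝ)) →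
    ‖∑ n ∈ Finset.Icc 1 ⌊x⌋₊, a n * ((1 - n / x : ℝ) : ℂ)‖ ≤ C * M * x ^ σ := by
  set J : ℝ := ∫ y : ℝ, 5 * (1 + ‖y‖ ^ 2) ^ (-(3 / 2 : ℝ) / 2) with hJ
  have hJi : Integrable fun y : ℝ => 5 * (1 + ‖y‖ ^ 2) ^ (-(3 / 2 : ℝ) / 2) :=
    (integrable_rpow_neg_one_add_norm_sq (by simp; norm_num)).const_mul 5
  have hJ0 : 0 ≤ J := integral_nonneg fun y => by positivity
  refine ⟨J + 1, by linarith, ?_⟩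
  intro a σ M x hσ hx hM hs hb
  set K : ℝ → ℂ := fun y => 1 / (((σ : ℂ) + y * I) * ((σ : ℂ) + y * I + 1)) with hK
  set F : ℕ → ℝ → ℂ := fun n y => LSeries.term a (σ + y * I) n * ((x : ℂ) ^ ((σ : ℂ) + y * I) * K y) with hF
  have hxn : ∀ y : ℝ, ‖(x : ℂ) ^ ((σ : ℂ) + y * I)‖ = x ^ σ := by
    intro y
    rw [norm_cpow_eq_rpow_re_of_pos hx]; simp
  have hxc : Continuous fun y : ℝ => (x : ℂ) ^ ((σ : ℂ) + y * I) := by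
    refine Continuous.const_cpow (by fun_prop) (Or.inl (by exact_mod_cast hx.ne'))
  have htn : ∀ n (y : ℝ), ‖LSeries.term a (σ + y * I) n‖ = ‖LSeries.term a σ n‖ := by
    intro n y
    rw [LSeries.norm_term_eq, LSeries.norm_term_eq]; simp
  have htc : ∀ n, Continuous fun y : ℝ => LSeries.term a (σ + y * I) n := by
    intro n
    by_cases hn : n = 0
    · subst hn; simp; exact continuous_const
    · simp only [LSeries.term_of_ne_zero hn]
      refine Continuous.div continuous_const (Continuous.const_cpow (by fun_prop) (Or.inl (by exact_mod_cast hn))) ?_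
      intro y
      simp [cpow_eq_zero_iff, hn]
  have hFn : ∀ n y, ‖F n y‖ = ‖LSeries.term a σ n‖ * x ^ σ * ‖K y‖ := by
    intro n y
    rw [hF]; simp only [norm_mul, htn, hxn]; ring
  have hKi : Integrable K := ker_int hσ
  have hFi : ∀ n, Integrable (F n) := by
    intro n
    refine Integrable.mono' (hKi.norm.const_mul (‖LSeries.term a σ n‖ * x ^ σ)) ?_ (Eventually.of_forall fun y => (hFn n y).le)
    exact ((htc n).mul (hxc.mul (ker_cont hσ))).aestronglyMeasurable
  have hsum : Summable fun n => ∫ y, ‖F n y‖ := by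
    simp only [hFn, integral_const_mul]
    exact (hs.norm.mul_right _).mul_right _
  have hH := hasSum_integral_of_summable_integral_norm hFi hsum
  have hval : ∀ n, ∫ y, F n y = if n = 0 then 0 else (2 * Real.pi : ℝ) * (a n * ((max (1 - n / x) 0 : ℝ) : ℂ)) := by
    intro n
    by_cases hn : n = 0
    · subst hn; simp [hF]
    · rw [if_neg hn]
      have hn0 : (0 : ℝ) < n := by exact_mod_cast Nat.pos_of_ne_zero hn
      rw [← rz_inv hσ (u := n / x) (by positivity)]
      have e : ∀ y, F n y = a n * (((n / x : ℝ) : ℂ) ^ (-((σ : ℂ) + y * I)) * K y) := by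
        intro y
        simp only [hF, LSeries.term_of_ne_zero hn]
        have hnx : (n : ℂ) ^ ((σ : ℂ) + y * I) = ((n / x : ℝ) : ℂ) ^ ((σ : ℂ) + y * I) * (x : ℂ) ^ ((σ : ℂ) + y * I) := by
          rw [← Complex.mul_cpow_ofReal_nonneg (by positivity) hx.le, ← ofReal_mul, div_mul_cancel₀ _ hx.ne']; simp
        have hx0 : (x : ℂ) ^ ((σ : ℂ) + y * I) ≠ 0 := by
          rw [← norm_ne_zero_iff, hxn]; positivity
        rw [cpow_neg, hnx]
        field_simp
      simp only [e, integral_const_mul]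
      have hpi : ((2 * Real.pi : ℝ) : ℂ) * (1 / (2 * (Real.pi : ℂ))) = 1 := by
        have : (Real.pi : ℂ) ≠ 0 := by exact_mod_cast Real.pi_ne_zero
        push_cast
        field_simp
      rw [mul_left_comm, ← mul_assoc ((2 * Real.pi : ℝ) : ℂ), hpi, one_mul]
  have hfin : HasSum (fun n => ∫ y, F n y) (∑ n ∈ Finset.Icc 1 ⌊x⌋₊, (2 * Real.pi : ℝ) * (a n * ((1 - n / x : ℝ) : ℂ))) := by
    have : ∑ n ∈ Finset.Icc 1 ⌊x⌋₊, (2 * Real.pi : ℝ) * (a n * ((1 - n / x : ℝ) : ℂ)) = ∑ n ∈ Finset.Icc 1 ⌊x⌋₊, ∫ y, F n y := by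
      refine Finset.sum_congr rfl fun n hn => ?_
      rw [Finset.mem_Icc] at hn
      rw [hval, if_neg (by omega), max_eq_left]
      rw [sub_nonneg, div_le_one hx]
      exact (Nat.le_floor_iff hx.le).1 hn.2
    rw [this]
    apply hasSum_sum_of_ne_finset_zero
    intro n hn
    rw [hval]
    split_ifs with h
    · rfl
    · rw [max_eq_right]
      · simp
      · rw [sub_nonpos, one_le_div hx]
        rw [Finset.mem_Icc] at hn
        have : ⌊x⌋₊ < n := by omega
        exact ((Nat.floor_lt hx.le).1 this).le
  have heq := hfin.unique hH
  have hintg : ‖∫ y, ∑' n, F n y‖ ≤ ∫ y : ℝ, (M * x ^ σ) * (5 * (1 + ‖y‖ ^ 2) ^ (-(3 / 2 : ℝ) / 2)) := by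
    refine norm_integral_le_of_norm_le (hJi.const_mul _) (Eventually.of_forall fun y => ?_)
    have : ∑' n, F n y = LSeries a (σ + y * I) * ((x : ℂ) ^ ((σ : ℂ) + y * I) * K y) := by
      simp only [hF]; rw [tsum_mul_right]; rfl
    rw [this, norm_mul, norm_mul, hxn]
    calc _ ≤ M * (|y| + 2) ^ (1 / 2 : ℝ) * (x ^ σ * (1 + y ^ 2)⁻¹) := by
          gcongr
          · exact hb y
          · exact ker_norm hσ
      _ = M * x ^ σ * ((|y| + 2) ^ (1 / 2 : ℝ) * (1 + y ^ 2)⁻¹) := by ring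
      _ ≤ _ := mul_le_mul_of_nonneg_left (half_pow_le y) (by positivity)
  rw [integral_const_mul, ← hJ, ← heq, ← Finset.mul_sum, norm_mul, Complex.norm_real, Real.norm_eq_abs, abs_of_pos (by positivity)] at hintg
  have hpi : 1 ≤ 2 * Real.pi := by linarith [Real.pi_gt_three]
  calc ‖∑ n ∈ Finset.Icc 1 ⌊x⌋₊, a n * ((1 - n / x : ℝ) : ℂ)‖ ≤ 2 * Real.pi * ‖∑ n ∈ Finset.Icc 1 ⌊x⌋₊, a n * ((1 - n / x : ℝ) : ℂ)‖ :=
        le_mul_of_one_le_left (norm_nonneg _) hpi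
    _ ≤ M * x ^ σ * J := hintg
    _ ≤ (J + 1) * M * x ^ σ := by
      have : 0 ≤ M * x ^ σ := by positivity
      nlinarith

end P11
end SW

namespace SW
section P12
open Complex MeasureTheory Filter Topology DirichletCharacter

lemma logMul_iter (f : ℕ → ℂ) (k n : ℕ) : (LSeries.logMul^[k] f) n = ((Real.log n ^ k : ℝ) : ℂ) * f n := by
  induction k generalizing f with
  | zero => simp
  | succ k ih =>
    rw [Function.iterate_succ_apply, ih]
    simp only [LSeries.logMul]
    rw [← Complex.natCast_log]
    push_cast; ring

lemma one_le_log {x : ℝ} (hx : 3 ≤ x) : 1 ≤ Real.log x := by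
  rw [Real.le_log_iff_exp_le (by linarith)]
  linarith [Real.exp_one_lt_d9]

theorem riesz_log : ∃ C : ℝ, 0 < C ∧ ∀ (f : ℕ → ℂ) (F : ℂ → ℂ) (k : ℕ) (M x : ℝ), 0 ≤ M → 3 ≤ x →
    (∀ s : ℂ, 1 < s.re → LSeriesSummable f s) → (∀ s : ℂ, 1 < s.re → LSeries f s = F s) →
    (∀ s : ℂ, 1 < s.re → s.re ≤ 2 → ‖iteratedDeriv k F s‖ ≤ M * (|s.im| + 2) ^ (1 / 2 : ℝ)) →
    ‖∑ n ∈ Finset.Icc 1 ⌊x⌋₊, ((Real.log n ^ k : ℝ) : ℂ) * f n * ((1 - n / x : ℝ) : ℂ)‖ ≤ C * M * x := by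
  obtain ⟨C, hC, hr⟩ := riesz
  refine ⟨C * Real.exp 1, by positivity, ?_⟩
  intro f F k M x hM hx hs hF hb
  have hl := one_le_log hx
  have hx0 : 0 < x := by linarith
  set σ : ℝ := 1 + 1 / Real.log x with hσ
  have hσ1 : 1 < σ := by
    have : 0 < 1 / Real.log x := by positivity
    linarith
  have hσ2 : σ ≤ 2 := by
    have : 1 / Real.log x ≤ 1 := by rw [div_le_one (by linarith)]; exact hl
    linarith
  have habs : LSeries.abscissaOfAbsConv f ≤ 1 := by
    have := LSeries.abscissaOfAbsConv_le_of_forall_lt_LSeriesSummable (f := f) (x := 1) (fun y hy => hs y (by simpa using hy))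
    simpa using this
  have hlt : ∀ s : ℂ, 1 < s.re → LSeries.abscissaOfAbsConv f < s.re := fun s h =>
    habs.trans_lt (by exact_mod_cast h)
  have := hr (LSeries.logMul^[k] f) σ M x hσ1.le hx0 hM ?_ ?_
  · simp only [logMul_iter] at this
    refine this.trans (le_of_eq ?_)
    have : x ^ σ = x * Real.exp 1 := by
      rw [hσ, Real.rpow_add hx0, Real.rpow_one, Real.rpow_def_of_pos hx0, mul_one_div_cancel (by linarith)]
    rw [this]; ring
  · apply LSeriesSummable_of_abscissaOfAbsConv_lt_re
    rw [LSeries.absicssaOfAbsConv_logPowMul]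
    exact hlt _ (by simpa using hσ1)
  · intro y
    set s : ℂ := σ + y * I with hsdef
    have hre : s.re = σ := by simp [hsdef]
    have him : s.im = y := by simp [hsdef]
    have h1 := LSeries_iteratedDeriv k (hlt s (by rw [hre]; exact hσ1))
    have h2 : iteratedDeriv k (LSeries f) s = iteratedDeriv k F s := by
      apply Filter.EventuallyEq.iteratedDeriv_eq
      filter_upwards [(isOpen_lt continuous_const continuous_re).mem_nhds (show 1 < s.re by rw [hre]; exact hσ1)] with z hz using hF z hz
    have h3 := hb s (by rw [hre]; exact hσ1) (by rw [hre]; exact hσ2)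
    rw [← h2, h1, norm_mul, norm_pow, norm_neg, norm_one, one_pow, one_mul, him] at h3
    exact h3

theorem riesz_char (k : ℕ) : ∃ C : ℝ, 0 < C ∧ ∀ (q : ℕ) [NeZero q] (χ : DirichletCharacter ℂ q) (x : ℝ), χ ≠ 1 → 3 ≤ x →
    ‖∑ n ∈ Finset.Icc 1 ⌊x⌋₊, ((Real.log n ^ k : ℝ) : ℂ) * (χ n * (ArithmeticFunction.vonMangoldt n : ℂ)) * ((1 - n / x : ℝ) : ℂ)‖ ≤ C * q * x := by
  obtain ⟨C1, hC1, h1⟩ := riesz_log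
  obtain ⟨C2, hC2, h2⟩ := logderiv_L k (ε := 1 / 2) (by norm_num)
  refine ⟨C1 * C2, by positivity, ?_⟩
  intro q _ χ x hχ hx
  have hq1 : (1 : ℝ) ≤ q := by exact_mod_cast NeZero.one_le
  have := h1 (fun n => χ n * (ArithmeticFunction.vonMangoldt n : ℂ)) (fun z => -deriv (LFunction χ) z / LFunction χ z) k (C2 * q) x (by positivity) hx
    (fun s hs => LSeriesSummable_twist_vonMangoldt χ hs) (fun s hs => ?_) (fun s hs1 hs2 => ?_)
  · refine this.trans (le_of_eq (by ring))
  · have := LSeries_twist_vonMangoldt_eq χ hs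
    rw [deriv_LFunction_eq_deriv_LSeries χ hs, LFunction_eq_LSeries χ hs, ← this]
    rfl
  · refine (h2 q χ s hs1 hs2 (Or.inl hχ)).trans ?_
    rw [Real.mul_rpow (by positivity) (by positivity), mul_assoc]
    gcongr
    calc (q : ℝ) ^ (1 / 2 : ℝ) ≤ (q : ℝ) ^ (1 : ℝ) := Real.rpow_le_rpow_of_exponent_le hq1 (by norm_num)
      _ = q := Real.rpow_one _

theorem riesz_zeta (k : ℕ) : ∃ C : ℝ, 0 < C ∧ ∀ (x : ℝ), 3 ≤ x →
    ‖∑ n ∈ Finset.Icc 1 ⌊x⌋₊, ((Real.log n ^ k : ℝ) : ℂ) * ((ArithmeticFunction.vonMangoldt n : ℂ) - 1) * ((1 - n / x : ℝ) : ℂ)‖ ≤ C * x := by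
  obtain ⟨C1, hC1, h1⟩ := riesz_log
  obtain ⟨C2, hC2, h2⟩ := logderiv_zeta k (ε := 1 / 2) (by norm_num)
  refine ⟨C1 * C2, by positivity, ?_⟩
  intro x hx
  have hs1 : ∀ s : ℂ, 1 < s.re → LSeriesSummable (fun n => (ArithmeticFunction.vonMangoldt n : ℂ)) s := fun s hs =>
    ArithmeticFunction.LSeriesSummable_vonMangoldt hs
  have hs2 : ∀ s : ℂ, 1 < s.re → LSeriesSummable 1 s := fun s hs => LSeriesSummable_one_iff.2 hs
  exact h1 (fun n => (ArithmeticFunction.vonMangoldt n : ℂ) - 1) (fun z => -deriv riemannZeta z / riemannZeta z - riemannZeta z) k C2 x hC2.le hx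
    (fun s hs => (hs1 s hs).sub (hs2 s hs)) (fun s hs => by
      rw [← ArithmeticFunction.LSeries_vonMangoldt_eq_deriv_riemannZeta_div hs, ← LSeries_one_eq_riemannZeta hs, ← LSeries_sub (hs1 s hs) (hs2 s hs)]
      rfl) h2

end P12
end SW

namespace SW
section P13
open Complex MeasureTheory Filter Topology DirichletCharacter

lemma log_pow_le (m : ℕ) {ε : ℝ} (hε : 0 < ε) : ∃ C : ℝ, 0 < C ∧ ∀ x : ℝ, 1 ≤ x → Real.log x ^ m ≤ C * x ^ ε := by
  set δ : ℝ := ε / (m + 1) with hδ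
  have hδ0 : 0 < δ := by positivity
  refine ⟨(1 / δ) ^ m, by positivity, ?_⟩
  intro x hx
  have h1 : Real.log x ≤ x ^ δ / δ := Real.log_le_rpow_div (by linarith) hδ0
  have h0 : 0 ≤ Real.log x := Real.log_nonneg hx
  calc Real.log x ^ m ≤ (x ^ δ / δ) ^ m := by gcongr
    _ = (1 / δ) ^ m * x ^ (δ * m) := by
      rw [div_pow, ← Real.rpow_mul_natCast (by linarith)]; ring
    _ ≤ (1 / δ) ^ m * x ^ ε := by
      gcongr
      · rw [hδ, div_mul_eq_mul_div, div_le_iff₀ (by positivity)]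
        nlinarith

lemma noncoprime_card (q N : ℕ) [NeZero q] (hN : 1 ≤ N) :
    ((Finset.Icc 1 N).filter (fun n : ℕ => ¬ IsUnit (n : ZMod q) ∧ IsPrimePow n)).card ≤ (q + 1) * (Nat.log 2 N + 1) := by
  have hsub : (Finset.Icc 1 N).filter (fun n : ℕ => ¬ IsUnit (n : ZMod q) ∧ IsPrimePow n) ⊆
      ((Finset.range (q + 1)) ×ˢ (Finset.range (Nat.log 2 N + 1))).image (fun z : ℕ × ℕ => z.1 ^ z.2) := by
    intro n hn
    rw [Finset.mem_filter, Finset.mem_Icc] at hn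
    obtain ⟨⟨h1, h2⟩, h3, h4⟩ := hn
    obtain ⟨p, j, hp, hj, rfl⟩ := (isPrimePow_nat_iff _).1 h4
    rw [Finset.mem_image]
    refine ⟨(p, j), ?_, rfl⟩
    rw [Finset.mem_product, Finset.mem_range, Finset.mem_range]
    constructor
    · have : p ∣ q := by
        by_contra hpq
        apply h3
        rw [ZMod.isUnit_iff_coprime]
        exact Nat.Coprime.pow_left j ((Nat.Prime.coprime_iff_not_dvd hp).2 hpq)
      have := Nat.le_of_dvd (NeZero.pos q) this
      simp; omega
    · have h5 : 2 ^ j ≤ N := (Nat.pow_le_pow_left hp.two_le j).trans h2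
      have := Nat.le_log_of_pow_le (by norm_num) h5
      simp; omega
  refine (Finset.card_le_card hsub).trans (Finset.card_image_le.trans ?_)
  simp

/-- weight -/
noncomputable def Wq (q n : ℕ) : ℝ :=
  (q.totient : ℝ) * (if (n : ZMod q) = 1 then ArithmeticFunction.vonMangoldt n else 0) - 1

lemma Wq_ge (q n : ℕ) : -1 ≤ Wq q n := by
  unfold Wq
  have : 0 ≤ (q.totient : ℝ) * (if (n : ZMod q) = 1 then ArithmeticFunction.vonMangoldt n else 0) := by
    apply mul_nonneg (by positivity)
    split_ifs
    · exact ArithmeticFunction.vonMangoldt_nonneg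
    · rfl
  linarith

lemma Wq_expand (q n : ℕ) [NeZero q] : ((Wq q n : ℝ) : ℂ) =
    (∑ χ ∈ (Finset.univ : Finset (DirichletCharacter ℂ q)).erase 1, χ n * (ArithmeticFunction.vonMangoldt n : ℂ)) +
    ((ArithmeticFunction.vonMangoldt n : ℂ) - 1) -
    (if IsUnit (n : ZMod q) then 0 else (ArithmeticFunction.vonMangoldt n : ℂ)) := by
  have h := DirichletCharacter.sum_characters_eq ℂ (n : ZMod q)
  rw [← Finset.add_sum_erase _ _ (Finset.mem_univ (1 : DirichletCharacter ℂ q))] at h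
  rw [← Finset.sum_mul]
  have h1 : (1 : DirichletCharacter ℂ q) (n : ZMod q) = if IsUnit (n : ZMod q) then 1 else 0 := by
    split_ifs with hu
    · exact MulChar.one_apply hu
    · exact MulChar.map_nonunit _ hu
  rw [h1] at h
  unfold Wq
  have h2 : (∑ χ ∈ (Finset.univ : Finset (DirichletCharacter ℂ q)).erase 1, χ n) = (if (n : ZMod q) = 1 then (q.totient : ℂ) else 0) - if IsUnit (n : ZMod q) then 1 else 0 := by
    rw [← h]; ring
  rw [h2]
  push_cast
  split_ifs <;> simp <;> ring

theorem riesz_AP (k : ℕ) : ∃ C : ℝ, 0 < C ∧ ∀ (q : ℕ) [NeZero q] (x : ℝ), 3 ≤ x →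
    |∑ n ∈ Finset.Icc 1 ⌊x⌋₊, Real.log n ^ k * Wq q n * (x - n)| ≤ C * (q : ℝ) ^ 2 * x ^ 2 := by
  obtain ⟨C1, hC1, h1⟩ := riesz_char k
  obtain ⟨C2, hC2, h2⟩ := riesz_zeta k
  obtain ⟨C3, hC3, h3⟩ := log_pow_le (k + 2) (ε := 1) one_pos
  refine ⟨C1 + C2 + 8 * C3, by positivity, ?_⟩
  intro q _ x hx
  have hx0 : 0 < x := by linarith
  have hq1 : (1 : ℝ) ≤ q := by exact_mod_cast NeZero.one_le
  set N := ⌊x⌋₊ with hN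
  have hN1 : 1 ≤ N := by rw [hN, Nat.one_le_floor_iff]; linarith
  have hNx : (N : ℝ) ≤ x := Nat.floor_le hx0.le
  have hl1 : 1 ≤ Real.log x := one_le_log hx
  -- the noncoprime part
  have hE : ‖∑ n ∈ Finset.Icc 1 N, ((Real.log n ^ k : ℝ) : ℂ) * (if IsUnit (n : ZMod q) then 0 else (ArithmeticFunction.vonMangoldt n : ℂ)) * ((1 - n / x : ℝ) : ℂ)‖ ≤ 8 * C3 * (q : ℝ) ^ 2 * x := by
    have hz : ∀ n ∈ Finset.Icc 1 N, n ∉ (Finset.Icc 1 N).filter (fun n : ℕ => ¬ IsUnit (n : ZMod q) ∧ IsPrimePow n) →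
        ((Real.log n ^ k : ℝ) : ℂ) * (if IsUnit (n : ZMod q) then 0 else (ArithmeticFunction.vonMangoldt n : ℂ)) * ((1 - n / x : ℝ) : ℂ) = 0 := by
      intro n hn hn2
      split_ifs with hu
      · simp
      · have : ¬ IsPrimePow n := by
          intro hp; apply hn2; rw [Finset.mem_filter]; exact ⟨hn, hu, hp⟩
        have : ArithmeticFunction.vonMangoldt n = 0 := ArithmeticFunction.vonMangoldt_eq_zero_iff.2 this
        simp [this]
    rw [← Finset.sum_subset (Finset.filter_subset _ _) hz]
    have hb : ∀ n ∈ (Finset.Icc 1 N).filter (fun n : ℕ => ¬ IsUnit (n : ZMod q) ∧ IsPrimePow n),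
        ‖((Real.log n ^ k : ℝ) : ℂ) * (if IsUnit (n : ZMod q) then 0 else (ArithmeticFunction.vonMangoldt n : ℂ)) * ((1 - n / x : ℝ) : ℂ)‖ ≤ Real.log x ^ (k + 1) := by
      intro n hn
      rw [Finset.mem_filter, Finset.mem_Icc] at hn
      obtain ⟨⟨hn1, hn2⟩, hu, -⟩ := hn
      rw [if_neg hu, norm_mul, norm_mul, Complex.norm_real, Complex.norm_real, Complex.norm_real]
      have hn0 : (0 : ℝ) < n := by exact_mod_cast hn1
      have hnx : (n : ℝ) ≤ x := le_trans (by exact_mod_cast hn2) hNx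
      have hln : Real.log n ≤ Real.log x := Real.log_le_log hn0 hnx
      have hln0 : 0 ≤ Real.log n := Real.log_natCast_nonneg n
      have a1 : ‖Real.log n ^ k‖ ≤ Real.log x ^ k := by
        rw [Real.norm_of_nonneg (by positivity)]; gcongr
      have a2 : ‖ArithmeticFunction.vonMangoldt n‖ ≤ Real.log x := by
        rw [Real.norm_of_nonneg ArithmeticFunction.vonMangoldt_nonneg]
        exact ArithmeticFunction.vonMangoldt_le_log.trans hln
      have a3 : ‖1 - n / x‖ ≤ 1 := by
        have : n / x ≤ 1 := by rw [div_le_one hx0]; exact hnx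
        have h0 : 0 ≤ n / x := by positivity
        rw [Real.norm_of_nonneg (by linarith)]; linarith
      calc _ ≤ Real.log x ^ k * Real.log x * 1 := by gcongr
        _ = _ := by ring
    refine (norm_sum_le_of_le _ hb).trans ?_
    rw [Finset.sum_const, nsmul_eq_mul]
    have hcard := noncoprime_card q N hN1
    have hlog2 : (Nat.log 2 N : ℝ) ≤ 2 * Real.log x := by
      have h5 : (2 : ℝ) ^ (Nat.log 2 N) ≤ x := by
        have : 2 ^ (Nat.log 2 N) ≤ N := Nat.pow_log_le_self 2 (by omega)
        exact le_trans (by exact_mod_cast this) hNx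
      have h6 := Real.log_le_log (by positivity) h5
      rw [Real.log_pow] at h6
      have h7 : (1 / 2 : ℝ) ≤ Real.log 2 := by linarith [Real.log_two_gt_d9]
      nlinarith [(Nat.cast_nonneg (Nat.log 2 N) : (0 : ℝ) ≤ _)]
    have hcard2 : (((Finset.Icc 1 N).filter (fun n : ℕ => ¬ IsUnit (n : ZMod q) ∧ IsPrimePow n)).card : ℝ) ≤ (q + 1) * (3 * Real.log x) := by
      calc _ ≤ (((q + 1) * (Nat.log 2 N + 1) : ℕ) : ℝ) := by exact_mod_cast hcard
        _ = (q + 1) * (Nat.log 2 N + 1) := by push_cast; ring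
        _ ≤ _ := by gcongr; linarith
    have h3x := h3 x (by linarith)
    rw [Real.rpow_one] at h3x
    calc _ ≤ (q + 1) * (3 * Real.log x) * Real.log x ^ (k + 1) := by gcongr
      _ = 3 * (q + 1) * Real.log x ^ (k + 2) := by ring
      _ ≤ 3 * (q + 1) * (C3 * x) := by gcongr
      _ ≤ 8 * C3 * (q : ℝ) ^ 2 * x := by
        have : 0 < C3 * x := by positivity
        have : 3 * ((q : ℝ) + 1) ≤ 8 * (q : ℝ) ^ 2 := by nlinarith
        nlinarith
  have hsum : ∑ n ∈ Finset.Icc 1 N, ((Real.log n ^ k : ℝ) : ℂ) * ((Wq q n : ℝ) : ℂ) * ((1 - n / x : ℝ) : ℂ) =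
      (∑ χ ∈ (Finset.univ : Finset (DirichletCharacter ℂ q)).erase 1, ∑ n ∈ Finset.Icc 1 N, ((Real.log n ^ k : ℝ) : ℂ) * (χ n * (ArithmeticFunction.vonMangoldt n : ℂ)) * ((1 - n / x : ℝ) : ℂ)) +
      (∑ n ∈ Finset.Icc 1 N, ((Real.log n ^ k : ℝ) : ℂ) * ((ArithmeticFunction.vonMangoldt n : ℂ) - 1) * ((1 - n / x : ℝ) : ℂ)) -
      ∑ n ∈ Finset.Icc 1 N, ((Real.log n ^ k : ℝ) : ℂ) * (if IsUnit (n : ZMod q) then 0 else (ArithmeticFunction.vonMangoldt n : ℂ)) * ((1 - n / x : ℝ) : ℂ) := by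
    rw [Finset.sum_comm, ← Finset.sum_add_distrib, ← Finset.sum_sub_distrib]
    refine Finset.sum_congr rfl fun n _ => ?_
    rw [Wq_expand, mul_sub, mul_add, Finset.mul_sum, sub_mul, add_mul, Finset.sum_mul]
  have hchars : ‖∑ χ ∈ (Finset.univ : Finset (DirichletCharacter ℂ q)).erase 1, ∑ n ∈ Finset.Icc 1 N, ((Real.log n ^ k : ℝ) : ℂ) * (χ n * (ArithmeticFunction.vonMangoldt n : ℂ)) * ((1 - n / x : ℝ) : ℂ)‖ ≤ C1 * (q : ℝ) ^ 2 * x := by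
    refine (norm_sum_le_of_le _ (fun χ hχ => h1 q χ x (Finset.ne_of_mem_erase hχ) hx)).trans ?_
    rw [Finset.sum_const, nsmul_eq_mul]
    have hc : ((Finset.univ : Finset (DirichletCharacter ℂ q)).erase 1).card ≤ q := by
      refine (Finset.card_erase_le).trans ?_
      rw [Finset.card_univ, ← Nat.card_eq_fintype_card, DirichletCharacter.card_eq_totient_of_hasEnoughRootsOfUnity]
      exact Nat.totient_le q
    calc _ ≤ (q : ℝ) * (C1 * q * x) := by gcongr
      _ = _ := by ring
  have hfin : ‖∑ n ∈ Finset.Icc 1 N, ((Real.log n ^ k : ℝ) : ℂ) * ((Wq q n : ℝ) : ℂ) * ((1 - n / x : ℝ) : ℂ)‖ ≤ (C1 + C2 + 8 * C3) * (q : ℝ) ^ 2 * x := by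
    rw [hsum]
    refine (norm_sub_le _ _).trans ((add_le_add ((norm_add_le _ _).trans (add_le_add hchars (h2 x hx))) hE).trans ?_)
    have : C2 * x ≤ C2 * (q : ℝ) ^ 2 * x := by
      have : 1 ≤ (q : ℝ) ^ 2 := one_le_pow₀ hq1
      have : C2 * x * 1 ≤ C2 * x * (q : ℝ) ^ 2 := by gcongr
      linarith
    linarith
  have e1 : ∑ n ∈ Finset.Icc 1 N, ((Real.log n ^ k : ℝ) : ℂ) * ((Wq q n : ℝ) : ℂ) * ((1 - n / x : ℝ) : ℂ) = ((∑ n ∈ Finset.Icc 1 N, Real.log n ^ k * Wq q n * (1 - n / x) : ℝ) : ℂ) := by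
    push_cast; rfl
  have e2 : ∑ n ∈ Finset.Icc 1 N, Real.log n ^ k * Wq q n * (x - n) = x * ∑ n ∈ Finset.Icc 1 N, Real.log n ^ k * Wq q n * (1 - n / x) := by
    rw [Finset.mul_sum]
    refine Finset.sum_congr rfl fun n _ => ?_
    field_simp
  rw [e1, Complex.norm_real, Real.norm_eq_abs] at hfin
  rw [e2, abs_mul, abs_of_pos hx0]
  nlinarith

end P13
end SW

namespace SW
section P14
open MeasureTheory Filter Topology

lemma tail_sum (a β : ℕ → ℝ) (N : ℕ) {u v h L : ℝ} (hu : 0 ≤ u) (huv : u ≤ v) (hh : 0 ≤ h) (hL : 0 ≤ L)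
    (ha : ∀ n : ℕ, (n : ℝ) ≤ v → -L ≤ a n) (h0 : ∀ n, 0 ≤ β n) (hβ : ∀ n, β n ≤ h)
    (hz : ∀ n : ℕ, ((n : ℝ) ≤ u ∨ v < n) → β n = 0) :
    -(L * h * (v - u + 1)) ≤ ∑ n ∈ Finset.Icc 1 N, a n * β n := by
  have hv : 0 ≤ v := hu.trans huv
  have h1 : ∑ n ∈ Finset.Icc 1 N, (if n ∈ Finset.Ioc ⌊u⌋₊ ⌊v⌋₊ then -(L * h) else 0) ≤ ∑ n ∈ Finset.Icc 1 N, a n * β n := by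
    refine Finset.sum_le_sum fun n _ => ?_
    split_ifs with hn
    · rw [Finset.mem_Ioc] at hn
      have hnv : (n : ℝ) ≤ v := (Nat.le_floor_iff hv).1 hn.2
      have := ha n hnv
      nlinarith [h0 n, hβ n]
    · rw [hz n, mul_zero]
      rw [Finset.mem_Ioc, not_and_or] at hn
      rcases hn with hn | hn
      · left; push Not at hn; exact (Nat.le_floor_iff hu).1 hn
      · right; push Not at hn; exact (Nat.floor_lt hv).1 hn
  refine le_trans ?_ h1
  rw [← Finset.sum_filter, Finset.sum_const, nsmul_eq_mul]
  have h2 : (((Finset.Icc 1 N).filter (fun n => n ∈ Finset.Ioc ⌊u⌋₊ ⌊v⌋₊)).card : ℝ) ≤ v - u + 1 := by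
    have h3 : ((Finset.Icc 1 N).filter (fun n => n ∈ Finset.Ioc ⌊u⌋₊ ⌊v⌋₊)).card ≤ (Finset.Ioc ⌊u⌋₊ ⌊v⌋₊).card := by
      apply Finset.card_le_card
      intro n hn
      exact (Finset.mem_filter.1 hn).2
    rw [Nat.card_Ioc] at h3
    have h4 : ((⌊v⌋₊ - ⌊u⌋₊ : ℕ) : ℝ) ≤ v - u + 1 := by
      rw [Nat.cast_sub (Nat.floor_le_floor huv)]
      linarith [Nat.floor_le hv, Nat.lt_floor_add_one u]
    exact le_trans (by exact_mod_cast h3) h4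
  have : 0 ≤ L * h := by positivity
  nlinarith

lemma smooth_eq (a : ℕ → ℝ) {y : ℝ} (hy : 0 ≤ y) {N : ℕ} (hN : ⌊y⌋₊ ≤ N) :
    ∑ n ∈ Finset.Icc 1 ⌊y⌋₊, a n * (y - n) = ∑ n ∈ Finset.Icc 1 N, a n * max (y - n) 0 := by
  rw [← Finset.sum_subset (Finset.Icc_subset_Icc le_rfl hN)]
  · refine Finset.sum_congr rfl fun n hn => ?_
    rw [max_eq_left]
    rw [sub_nonneg]
    exact (Nat.le_floor_iff hy).1 (Finset.mem_Icc.1 hn).2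
  · intro n hn hn2
    rw [max_eq_right, mul_zero]
    rw [Finset.mem_Icc] at hn hn2
    have : ⌊y⌋₊ < n := by omega
    rw [sub_nonpos]
    exact ((Nat.floor_lt hy).1 this).le

lemma unsmooth (a : ℕ → ℝ) {x h L R : ℝ} (hh : 0 < h) (hx : h < x) (hL : 0 ≤ L)
    (ha : ∀ n : ℕ, (n : ℝ) ≤ x + h → -L ≤ a n)
    (h1 : |∑ n ∈ Finset.Icc 1 ⌊x - h⌋₊, a n * ((x - h) - n)| ≤ R)
    (h2 : |∑ n ∈ Finset.Icc 1 ⌊x⌋₊, a n * (x - n)| ≤ R)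
    (h3 : |∑ n ∈ Finset.Icc 1 ⌊x + h⌋₊, a n * ((x + h) - n)| ≤ R) :
    |∑ n ∈ Finset.Icc 1 ⌊x⌋₊, a n| ≤ 2 * R / h + L * (h + 1) := by
  set N := ⌊x + h⌋₊ with hN
  have hx0 : 0 ≤ x := by linarith
  rw [smooth_eq a (by linarith) (Nat.floor_le_floor (by linarith) : ⌊x - h⌋₊ ≤ N)] at h1
  rw [smooth_eq a (by linarith) (Nat.floor_le_floor (by linarith) : ⌊x⌋₊ ≤ N)] at h2
  rw [smooth_eq a (by linarith) le_rfl] at h3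
  have hS : h * ∑ n ∈ Finset.Icc 1 ⌊x⌋₊, a n = ∑ n ∈ Finset.Icc 1 N, a n * (if (n : ℝ) ≤ x then h else 0) := by
    rw [← Finset.sum_subset (Finset.Icc_subset_Icc le_rfl (Nat.floor_le_floor (by linarith) : ⌊x⌋₊ ≤ N)), Finset.mul_sum]
    · refine Finset.sum_congr rfl fun n hn => ?_
      rw [if_pos ((Nat.le_floor_iff hx0).1 (Finset.mem_Icc.1 hn).2)]; ring
    · intro n hn hn2
      rw [Finset.mem_Icc] at hn hn2
      have : ⌊x⌋₊ < n := by omega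
      rw [if_neg (not_le.2 ((Nat.floor_lt hx0).1 this)), mul_zero]
  have u1 := tail_sum a (fun n => max (x + h - n) 0 - max (x - n) 0 - (if (n : ℝ) ≤ x then h else 0)) N (u := x) (v := x + h) hx0 (by linarith) hh.le hL ha
    ?_ ?_ ?_
  have u2 := tail_sum a (fun n => (if (n : ℝ) ≤ x then h else 0) - max (x - n) 0 + max (x - h - n) 0) N (u := x - h) (v := x) (by linarith) (by linarith) hh.le hL
    (fun n hn => ha n (by linarith)) ?_ ?_ ?_
  · simp only [mul_sub, mul_add, Finset.sum_sub_distrib, Finset.sum_add_distrib] at u1 u2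
    rw [← hS] at u1 u2
    simp only [← mul_sub] at u1 u2
    rw [abs_le] at h1 h2 h3
    have hR : h * |∑ n ∈ Finset.Icc 1 ⌊x⌋₊, a n| ≤ 2 * R + L * h * (h + 1) := by
      rcases abs_cases (∑ n ∈ Finset.Icc 1 ⌊x⌋₊, a n) with ⟨e, _⟩ | ⟨e, _⟩ <;> rw [e] <;> nlinarith
    rw [← mul_le_mul_iff_right₀ hh]
    refine hR.trans (le_of_eq ?_)
    field_simp
  all_goals intro n
  · by_cases c1 : (n : ℝ) ≤ x
    · simp only [if_pos c1]; rw [max_eq_left (by linarith)]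
      rcases max_cases (x - h - n) 0 with ⟨e, _⟩ | ⟨e, _⟩ <;> rw [e] <;> linarith
    · simp only [if_neg c1]; rw [max_eq_right (by linarith), max_eq_right (by linarith)]; simp
  · by_cases c1 : (n : ℝ) ≤ x
    · simp only [if_pos c1]; rw [max_eq_left (by linarith)]
      rcases max_cases (x - h - n) 0 with ⟨e, _⟩ | ⟨e, _⟩ <;> rw [e] <;> linarith
    · simp only [if_neg c1]; rw [max_eq_right (by linarith), max_eq_right (by linarith)]; simp; linarith
  · rintro (c | c)
    · simp only [if_pos (by linarith : (n : ℝ) ≤ x)]; rw [max_eq_left (by linarith), max_eq_left (by linarith)]; ring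
    · simp only [if_neg (by linarith : ¬ (n : ℝ) ≤ x)]; rw [max_eq_right (by linarith), max_eq_right (by linarith)]; ring
  · by_cases c1 : (n : ℝ) ≤ x
    · simp only [if_pos c1]; rw [max_eq_left (by linarith), max_eq_left (by linarith)]; linarith
    · simp only [if_neg c1]; rw [max_eq_right (by linarith : x - (n : ℝ) ≤ 0)]
      rcases max_cases (x + h - n) 0 with ⟨e, _⟩ | ⟨e, _⟩ <;> rw [e] <;> linarith
  · by_cases c1 : (n : ℝ) ≤ x
    · simp only [if_pos c1]; rw [max_eq_left (by linarith), max_eq_left (by linarith)]; linarith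
    · simp only [if_neg c1]; rw [max_eq_right (by linarith : x - (n : ℝ) ≤ 0)]
      rcases max_cases (x + h - n) 0 with ⟨e, _⟩ | ⟨e, _⟩ <;> rw [e] <;> linarith
  · rintro (c | c)
    · simp only [if_pos c]; rw [max_eq_left (by linarith), max_eq_left (by linarith)]; ring
    · simp only [if_neg (by linarith : ¬ (n : ℝ) ≤ x)]; rw [max_eq_right (by linarith), max_eq_right (by linarith)]; ring

theorem sharp_AP (k : ℕ) : ∃ C : ℝ, 0 < C ∧ ∀ (q : ℕ) [NeZero q] (x : ℝ), 6 ≤ x →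
    |∑ n ∈ Finset.Icc 1 ⌊x⌋₊, Real.log n ^ (2 * k) * Wq q n| ≤ C * (q : ℝ) ^ 2 * x * Real.log x ^ k := by
  obtain ⟨C1, hC1, h1⟩ := riesz_AP (2 * k)
  obtain ⟨C2, hC2, h2⟩ := log_pow_le (2 * k) (ε := 1) one_pos
  refine ⟨16 * C1 + 2 ^ (2 * k) + 2 * C2, by positivity, ?_⟩
  intro q _ x hx
  have hx0 : 0 < x := by linarith
  have hq1 : (1 : ℝ) ≤ q := by exact_mod_cast NeZero.one_le
  have hq2 : (1 : ℝ) ≤ (q : ℝ) ^ 2 := one_le_pow₀ hq1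
  have hl1 : 1 ≤ Real.log x := one_le_log (by linarith)
  set l := Real.log x with hl
  have hlk : 1 ≤ l ^ k := one_le_pow₀ hl1
  set h : ℝ := x / (2 * l ^ k) with hh
  have hh0 : 0 < h := by positivity
  have hhx : h ≤ x / 2 := by
    rw [hh]; gcongr; linarith
  have hmain : ∀ y : ℝ, 3 ≤ y → y ≤ 2 * x → |∑ n ∈ Finset.Icc 1 ⌊y⌋₊, Real.log n ^ (2 * k) * Wq q n * (y - n)| ≤ 4 * C1 * (q : ℝ) ^ 2 * x ^ 2 := by
    intro y hy hyx
    refine (h1 q y hy).trans ?_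
    calc C1 * (q : ℝ) ^ 2 * y ^ 2 ≤ C1 * (q : ℝ) ^ 2 * (2 * x) ^ 2 := by gcongr
      _ = _ := by ring
  have hl2 : Real.log (2 * x) ≤ 2 * l := by
    rw [Real.log_mul (by norm_num) hx0.ne']
    linarith [Real.log_two_lt_d9]
  have hl20 : 0 ≤ Real.log (2 * x) := Real.log_nonneg (by linarith)
  have := unsmooth (fun n => Real.log n ^ (2 * k) * Wq q n) (L := Real.log (2 * x) ^ (2 * k)) hh0 (by linarith) (by positivity) ?_
    (hmain (x - h) (by linarith) (by linarith)) (hmain x (by linarith) (by linarith)) (hmain (x + h) (by linarith) (by linarith))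
  · refine this.trans ?_
    have e1 : 2 * (4 * C1 * (q : ℝ) ^ 2 * x ^ 2) / h = 16 * C1 * (q : ℝ) ^ 2 * x * l ^ k := by
      rw [hh]; field_simp; norm_num
    have e2 : Real.log (2 * x) ^ (2 * k) * h ≤ 2 ^ (2 * k) * (x * l ^ k) := by
      calc Real.log (2 * x) ^ (2 * k) * h ≤ (2 * l) ^ (2 * k) * h := by gcongr
        _ = 2 ^ (2 * k) * (x * l ^ k) / 2 := by
          rw [hh, mul_pow, two_mul, pow_add l]; field_simp
        _ ≤ _ := by
          have : 0 < 2 ^ (2 * k) * (x * l ^ k) := by positivity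
          linarith
    have e3 : Real.log (2 * x) ^ (2 * k) ≤ 2 * C2 * x := by
      have := h2 (2 * x) (by linarith)
      rw [Real.rpow_one] at this
      linarith
    have e4 : 2 * C2 * x ≤ 2 * C2 * (x * l ^ k) := by
      have : x ≤ x * l ^ k := le_mul_of_one_le_right hx0.le hlk
      have : C2 * x ≤ C2 * (x * l ^ k) := by gcongr
      linarith
    have e5 : (2 ^ (2 * k) + 2 * C2) * (x * l ^ k) ≤ (2 ^ (2 * k) + 2 * C2) * (x * l ^ k) * (q : ℝ) ^ 2 :=
      le_mul_of_one_le_right (by positivity) hq2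
    rw [e1]
    nlinarith
  · intro n hn
    by_cases hn0 : n = 0
    · subst hn0
      simp only [Nat.cast_zero, Real.log_zero]
      by_cases hk : 2 * k = 0
      · simp only [hk, pow_zero, one_mul]; exact Wq_ge q 0
      · simp [hk]; positivity
    have hn1 : (1 : ℝ) ≤ n := by exact_mod_cast Nat.one_le_iff_ne_zero.2 hn0
    have a1 : Real.log n ≤ Real.log (2 * x) := Real.log_le_log (by linarith) (by linarith)
    have a0 : 0 ≤ Real.log n := Real.log_nonneg hn1
    have a2 : Real.log n ^ (2 * k) ≤ Real.log (2 * x) ^ (2 * k) := by gcongr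
    have a3 : 0 ≤ Real.log n ^ (2 * k) := by positivity
    have := Wq_ge q n
    nlinarith

end P14
end SW

namespace SW
section P15
open MeasureTheory Filter Topology

lemma abel_ineq (b g : ℕ → ℝ) {m : ℕ} {M : ℝ} (hg : ∀ n, m + 1 ≤ n → g (n + 1) ≤ g n) (hg0 : ∀ n, m + 1 ≤ n → 0 ≤ g n)
    (N : ℕ) (hN : m + 1 ≤ N) (hB : ∀ n, m ≤ n → n ≤ N → |∑ i ∈ Finset.Icc 1 n, b i| ≤ M) :
    |∑ n ∈ Finset.Ioc m N, b n * g n| ≤ 2 * M * g (m + 1) := by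
  have hM : 0 ≤ M := (abs_nonneg _).trans (hB m le_rfl (by omega))
  have key : |∑ n ∈ Finset.Ioc m N, b n * g n - (∑ i ∈ Finset.Icc 1 N, b i) * g N| ≤ M * (2 * g (m + 1) - g N) := by
    induction N, hN using Nat.le_induction with
    | base =>
      rw [Finset.sum_Ioc_succ_top le_rfl, Finset.Ioc_self, Finset.sum_empty, zero_add, Finset.sum_Icc_succ_top (by omega)]
      have h0 := hg0 (m + 1) le_rfl
      rw [show b (m + 1) * g (m + 1) - (∑ i ∈ Finset.Icc 1 m, b i + b (m + 1)) * g (m + 1) = - ((∑ i ∈ Finset.Icc 1 m, b i) * g (m + 1)) by ring, abs_neg, abs_mul, abs_of_nonneg h0]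
      have := hB m le_rfl (by omega)
      nlinarith
    | succ N hN ih =>
      have ih' := ih (fun n h1 h2 => hB n h1 (by omega))
      rw [Finset.sum_Ioc_succ_top (by omega), Finset.sum_Icc_succ_top (by omega)]
      have h1 := hB N (by omega) (by omega)
      have h2 := hg N hN
      set S := ∑ n ∈ Finset.Ioc m N, b n * g n
      set B := ∑ i ∈ Finset.Icc 1 N, b i
      rw [show S + b (N + 1) * g (N + 1) - (B + b (N + 1)) * g (N + 1) = (S - B * g N) + B * (g N - g (N + 1)) by ring]
      refine (abs_add_le _ _).trans ?_
      rw [abs_mul, abs_of_nonneg (by linarith : 0 ≤ g N - g (N + 1))]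
      nlinarith
  have h1 := hB N (by omega) le_rfl
  have h0 := hg0 N hN
  set S := ∑ n ∈ Finset.Ioc m N, b n * g n
  set B := ∑ i ∈ Finset.Icc 1 N, b i
  have : |S| ≤ |S - B * g N| + |B * g N| := by
    calc |S| = |(S - B * g N) + B * g N| := by ring_nf
      _ ≤ _ := abs_add_le _ _
  rw [abs_mul, abs_of_nonneg h0] at this
  nlinarith

lemma log_half : 1 / 2 ≤ Real.log 2 := by linarith [Real.log_two_gt_d9]

lemma Wq_div_log_le (q n : ℕ) (hq : 1 ≤ q) (hn : 2 ≤ n) : |Wq q n / Real.log n| ≤ 3 * q := by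
  have hn2 : (2 : ℝ) ≤ n := by exact_mod_cast hn
  have hq1 : (1 : ℝ) ≤ q := by exact_mod_cast hq
  have hl : 1 / 2 ≤ Real.log n := log_half.trans (Real.log_le_log (by norm_num) hn2)
  have hl0 : 0 < Real.log n := by linarith
  rw [abs_div, abs_of_pos hl0, div_le_iff₀ hl0, abs_le]
  constructor
  · have := Wq_ge q n
    nlinarith
  · unfold Wq
    have h1 : (if (n : ZMod q) = 1 then ArithmeticFunction.vonMangoldt n else 0) ≤ Real.log n := by
      split_ifs
      · exact ArithmeticFunction.vonMangoldt_le_log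
      · exact hl0.le
    have h2 : (q.totient : ℝ) ≤ q := by exact_mod_cast Nat.totient_le q
    have h3 : (q.totient : ℝ) * (if (n : ZMod q) = 1 then ArithmeticFunction.vonMangoldt n else 0) ≤ q * Real.log n := by
      calc _ ≤ (q.totient : ℝ) * Real.log n := by gcongr
        _ ≤ _ := by gcongr
    nlinarith

theorem sum_Wq (k : ℕ) : ∃ C : ℝ, 0 < C ∧ ∀ (q : ℕ) [NeZero q] (x : ℝ), 49 ≤ x →
    |∑ n ∈ Finset.Icc 2 ⌊x⌋₊, Wq q n / Real.log n| ≤ C * (q : ℝ) ^ 2 * (x / Real.log x ^ k) := by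
  obtain ⟨C1, hC1, h1⟩ := sharp_AP k
  obtain ⟨C2, hC2, h2⟩ := log_pow_le k (ε := 1 / 2) (by norm_num)
  refine ⟨3 * C2 + 4 * C1 * 4 ^ k, by positivity, ?_⟩
  intro q _ x hx
  have hx0 : 0 < x := by linarith
  have hqn : 1 ≤ q := NeZero.one_le
  have hq1 : (1 : ℝ) ≤ q := by exact_mod_cast hqn
  have hl1 : 1 ≤ Real.log x := one_le_log (by linarith)
  set l := Real.log x with hl
  have hlk : 1 ≤ l ^ k := one_le_pow₀ hl1
  have hsq : 7 ≤ √x := Real.le_sqrt_of_sq_le (by linarith)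
  have hss : √x * √x = x := Real.mul_self_sqrt hx0.le
  set m := ⌊√x⌋₊ with hm
  set N := ⌊x⌋₊ with hN
  have hm7 : 7 ≤ m := Nat.le_floor (by exact_mod_cast hsq)
  have hmle : (m : ℝ) ≤ √x := Nat.floor_le (by positivity)
  have hNle : (N : ℝ) ≤ x := Nat.floor_le hx0.le
  have hmN : m + 1 ≤ N := by
    apply Nat.le_floor
    push_cast
    nlinarith
  have hsplit : ∑ n ∈ Finset.Icc 2 N, Wq q n / Real.log n = ∑ n ∈ Finset.Icc 2 m, Wq q n / Real.log n + ∑ n ∈ Finset.Ioc m N, Wq q n / Real.log n := by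
    rw [← Finset.sum_union]
    · congr 1
      ext n; simp only [Finset.mem_Icc, Finset.mem_union, Finset.mem_Ioc]; omega
    · rw [Finset.disjoint_left]; intro n; simp only [Finset.mem_Icc, Finset.mem_Ioc]; omega
  have hA : |∑ n ∈ Finset.Icc 2 m, Wq q n / Real.log n| ≤ 3 * C2 * (q : ℝ) ^ 2 * (x / l ^ k) := by
    calc _ ≤ ∑ n ∈ Finset.Icc 2 m, |Wq q n / Real.log n| := Finset.abs_sum_le_sum_abs _ _
      _ ≤ ∑ n ∈ Finset.Icc 2 m, (3 * q : ℝ) := Finset.sum_le_sum fun n hn => Wq_div_log_le q n hqn (Finset.mem_Icc.1 hn).1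
      _ = ((m - 1 : ℕ) : ℝ) * (3 * q) := by rw [Finset.sum_const, Nat.card_Icc, nsmul_eq_mul]; rfl
      _ ≤ √x * (3 * q) := by
        gcongr
        exact le_trans (by exact_mod_cast Nat.sub_le m 1) hmle
      _ ≤ √x * (3 * q ^ 2) := by gcongr; nlinarith
      _ = 3 * q ^ 2 * √x := by ring
      _ ≤ 3 * q ^ 2 * (C2 * (x / l ^ k)) := by
        gcongr
        rw [mul_div_assoc', le_div_iff₀ (by positivity)]
        have := h2 x (by linarith)
        rw [← Real.sqrt_eq_rpow] at this
        calc √x * l ^ k ≤ √x * (C2 * √x) := by gcongr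
          _ = C2 * x := by rw [mul_left_comm, hss]
      _ = _ := by ring
  have hlogm : l / 2 ≤ Real.log (m + 1) := by
    have : Real.log (√x) = l / 2 := by rw [Real.log_sqrt hx0.le]
    rw [← this]
    exact Real.log_le_log (by positivity) (Nat.lt_floor_add_one _).le
  have hpos : ∀ n : ℕ, m + 1 ≤ n → 0 < Real.log n := by
    intro n hn
    apply Real.log_pos
    have : 2 ≤ n := by omega
    have : (2 : ℝ) ≤ n := by exact_mod_cast this
    linarith
  have hB : |∑ n ∈ Finset.Ioc m N, Wq q n / Real.log n| ≤ 4 * C1 * 4 ^ k * (q : ℝ) ^ 2 * (x / l ^ k) := by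
    have := abel_ineq (fun n => Real.log n ^ (2 * k) * Wq q n) (fun n => 1 / Real.log n ^ (2 * k + 1)) (m := m) (M := C1 * (q : ℝ) ^ 2 * x * l ^ k) ?_ ?_ N hmN ?_
    · have e : ∑ n ∈ Finset.Ioc m N, Real.log n ^ (2 * k) * Wq q n * (1 / Real.log n ^ (2 * k + 1)) = ∑ n ∈ Finset.Ioc m N, Wq q n / Real.log n := by
        refine Finset.sum_congr rfl fun n hn => ?_
        have := hpos n (Finset.mem_Ioc.1 hn).1
        field_simp
        ring
      rw [e] at this
      refine this.trans ?_
      push_cast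
      have e2 : 1 / Real.log ((m : ℝ) + 1) ^ (2 * k + 1) ≤ 1 / (l / 2) ^ (2 * k + 1) := by gcongr
      calc _ ≤ 2 * (C1 * (q : ℝ) ^ 2 * x * l ^ k) * (1 / (l / 2) ^ (2 * k + 1)) := by gcongr
        _ = 4 * C1 * 4 ^ k * (q : ℝ) ^ 2 * (x / l ^ k) * (1 / l) := by
          rw [div_pow, show (4 : ℝ) ^ k = 2 ^ k * 2 ^ k by rw [← mul_pow]; norm_num]
          field_simp
          ring
        _ ≤ 4 * C1 * 4 ^ k * (q : ℝ) ^ 2 * (x / l ^ k) * 1 := by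
          gcongr
          rw [div_le_one (by linarith)]; exact hl1
        _ = _ := by ring
    · intro n hn
      have h3 := hpos n hn
      have h4 : Real.log n ≤ Real.log ((n + 1 : ℕ) : ℝ) := Real.log_le_log (by
        have : 0 < n := by omega
        exact_mod_cast this) (by push_cast; linarith)
      gcongr
    · intro n hn
      have h3 := hpos n hn
      positivity
    · intro n hn1 hn2
      have hn6 : 6 ≤ n := by omega
      have := h1 q (n : ℝ) (by exact_mod_cast hn6)
      rw [Nat.floor_natCast] at this
      refine this.trans ?_
      have hnx : (n : ℝ) ≤ x := le_trans (by exact_mod_cast hn2) hNle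
      have hn1' : (1 : ℝ) ≤ n := by
        have : 1 ≤ n := by omega
        exact_mod_cast this
      have h5 : Real.log n ≤ l := Real.log_le_log (by linarith) hnx
      have h6 : 0 ≤ Real.log n := Real.log_nonneg hn1'
      gcongr
  rw [hsplit]
  refine (abs_add_le _ _).trans ?_
  linarith

lemma log_integral (x : ℝ) (hx : 2 ≤ x) :
    |∑ n ∈ Finset.Icc 2 ⌊x⌋₊, 1 / Real.log n - ∫ t in (2 : ℝ)..x, 1 / Real.log t| ≤ 2 := by
  set N := ⌊x⌋₊ with hN
  have hN2 : 2 ≤ N := Nat.le_floor (by exact_mod_cast hx)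
  have hNle : (N : ℝ) ≤ x := Nat.floor_le (by linarith)
  have hNgt : x < N + 1 := Nat.lt_floor_add_one x
  have hanti : ∀ a b : ℝ, 2 ≤ a → a ≤ b → 1 / Real.log b ≤ 1 / Real.log a := by
    intro a b ha hab
    have h1 : 0 < Real.log a := Real.log_pos (by linarith)
    have h2 : Real.log a ≤ Real.log b := Real.log_le_log (by linarith) hab
    gcongr
  have hao : AntitoneOn (fun t : ℝ => 1 / Real.log t) (Set.Icc ((2 : ℕ) : ℝ) N) := by
    intro a ha b hb hab
    exact hanti a b (by exact_mod_cast ha.1) hab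
  have hcont : ContinuousOn (fun t : ℝ => 1 / Real.log t) (Set.Ici 2) := by
    intro t ht
    have : 2 ≤ t := ht
    refine (ContinuousAt.div continuousAt_const (Real.continuousAt_log (by linarith)) (Real.log_pos (by linarith)).ne').continuousWithinAt
  have hintg : ∀ a b : ℝ, 2 ≤ a → 2 ≤ b → IntervalIntegrable (fun t : ℝ => 1 / Real.log t) volume a b := by
    intro a b ha hb
    apply ContinuousOn.intervalIntegrable
    apply hcont.mono
    intro t ht
    exact le_trans (le_min ha hb) ht.1
  have h1 := hao.integral_le_sum_Ico hN2
  have h2 := hao.sum_le_integral_Ico hN2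
  have hN2r : (2 : ℝ) ≤ N := by exact_mod_cast hN2
  have h3 := intervalIntegral.integral_add_adjacent_intervals (hintg 2 N le_rfl hN2r) (hintg N x hN2r hx)
  have h4 : 0 ≤ ∫ t in (N : ℝ)..x, 1 / Real.log t := by
    apply intervalIntegral.integral_nonneg hNle
    intro t ht
    have := Real.log_nonneg (by linarith [ht.1] : 1 ≤ t)
    positivity
  have hlog2 : 1 / Real.log 2 ≤ 2 := by
    rw [div_le_iff₀ (by linarith [log_half])]; linarith [log_half]
  have h5 : ∫ t in (N : ℝ)..x, 1 / Real.log t ≤ 2 := by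
    have : ∫ t in (N : ℝ)..x, 1 / Real.log t ≤ ∫ t in (N : ℝ)..x, (2 : ℝ) := by
      apply intervalIntegral.integral_mono_on hNle (hintg _ _ hN2r hx) (by simp)
      intro t ht
      exact (hanti 2 t le_rfl (by linarith [ht.1])).trans hlog2
    rw [intervalIntegral.integral_const, smul_eq_mul] at this
    linarith
  have s1 : ∑ n ∈ Finset.Icc 2 N, 1 / Real.log n = ∑ n ∈ Finset.Ico 2 N, 1 / Real.log n + 1 / Real.log N := by
    rw [← Finset.Ico_succ_right_eq_Icc, Nat.succ_eq_succ, Nat.succ_eq_add_one, Finset.sum_Ico_succ_top hN2]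
  have s2 : ∑ n ∈ Finset.Icc 2 N, 1 / Real.log n = 1 / Real.log 2 + ∑ n ∈ Finset.Ico 2 N, 1 / Real.log ((n + 1 : ℕ) : ℝ) := by
    rw [← Finset.Ico_succ_right_eq_Icc, Nat.succ_eq_succ, Nat.succ_eq_add_one, Finset.sum_eq_sum_Ico_succ_bot (by omega),
      ← Finset.sum_Ico_add' (fun n : ℕ => 1 / Real.log (n : ℝ)) 2 N 1]
    norm_num
  have h6 : 0 ≤ 1 / Real.log N := by
    have := Real.log_nonneg (by linarith : 1 ≤ (N : ℝ)); positivity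
  have h7 : 1 / Real.log N ≤ 1 / Real.log 2 := hanti 2 N le_rfl hN2r
  norm_num only [Nat.cast_ofNat] at h1 h2
  push_cast at h1 h2 s1 s2
  rw [abs_le]
  constructor <;> linarith

end P15
end SW

namespace SW
section P16
open MeasureTheory Filter Topology

noncomputable def piq (q : ℕ) (N : ℕ) : ℕ :=
  ((Finset.Icc 1 N).filter (fun n : ℕ => n.Prime ∧ (n : ZMod q) = 1)).card

lemma ppow_card (N : ℕ) :
    ((Finset.Icc 2 N).filter (fun n : ℕ => IsPrimePow n ∧ ¬ n.Prime)).card ≤ (Nat.sqrt N + 1) * (Nat.log 2 N + 1) := by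
  classical
  have : (Finset.Icc 2 N).filter (fun n : ℕ => IsPrimePow n ∧ ¬ n.Prime) ⊆
      ((Finset.range (Nat.sqrt N + 1)) ×ˢ (Finset.range (Nat.log 2 N + 1))).image (fun z : ℕ × ℕ => z.1 ^ z.2) := by
    intro n hn
    rw [Finset.mem_filter, Finset.mem_Icc] at hn
    obtain ⟨⟨h2, hN⟩, hp, hnp⟩ := hn
    rw [isPrimePow_nat_iff] at hp
    obtain ⟨p, j, hpp, hj, rfl⟩ := hp
    rw [Finset.mem_image]
    have hj2 : 2 ≤ j := by
      by_contra h
      have : j = 1 := by omega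
      subst this
      rw [pow_one] at hnp
      exact hnp hpp
    refine ⟨(p, j), ?_, rfl⟩
    rw [Finset.mem_product, Finset.mem_range, Finset.mem_range]
    constructor
    · apply Nat.lt_succ_of_le
      rw [Nat.le_sqrt']
      exact (Nat.pow_le_pow_right hpp.pos hj2).trans hN
    · apply Nat.lt_succ_of_le
      apply Nat.le_log_of_pow_le (by norm_num)
      exact (Nat.pow_le_pow_left hpp.two_le j).trans hN
  refine (Finset.card_le_card this).trans (Finset.card_image_le.trans ?_)
  rw [Finset.card_product, Finset.card_range, Finset.card_range]

lemma ppow_bound (k : ℕ) : ∃ C > 0, ∀ x : ℝ, 49 ≤ x →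
    (((Finset.Icc 2 ⌊x⌋₊).filter (fun n : ℕ => IsPrimePow n ∧ ¬ n.Prime)).card : ℝ) ≤ C * (x / Real.log x ^ k) := by
  obtain ⟨C2, hC2, h2⟩ := log_pow_le (k + 1) (ε := 1 / 2) (by norm_num)
  refine ⟨6 * C2, by positivity, fun x hx => ?_⟩
  have hx0 : 0 < x := by linarith
  have hl1 : 1 ≤ Real.log x := one_le_log (by linarith)
  have hN := Nat.floor_le hx0.le
  have e1 : ((Nat.sqrt ⌊x⌋₊ : ℕ) : ℝ) ≤ √x := by
    refine Real.le_sqrt_of_sq_le ?_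
    refine le_trans ?_ hN
    have := Nat.sqrt_le' ⌊x⌋₊
    exact_mod_cast this
  have e2 : ((Nat.log 2 ⌊x⌋₊ : ℕ) : ℝ) ≤ 2 * Real.log x := by
    have h3 : (2 : ℝ) ^ (Nat.log 2 ⌊x⌋₊) ≤ x := by
      refine le_trans ?_ hN
      have := Nat.pow_log_le_self 2 (x := ⌊x⌋₊) (by
        have : 0 < ⌊x⌋₊ := Nat.floor_pos.2 (by linarith)
        omega)
      exact_mod_cast this
    have := Real.log_le_log (by positivity) h3
    rw [Real.log_pow] at this
    have h4 := log_half
    have h5 : ((Nat.log 2 ⌊x⌋₊ : ℕ) : ℝ) * (1 / 2) ≤ (Nat.log 2 ⌊x⌋₊ : ℕ) * Real.log 2 := by gcongr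
    linarith
  have e3 : 1 ≤ √x := Real.one_le_sqrt.2 (by linarith)
  have h6 := h2 x (by linarith)
  rw [← Real.sqrt_eq_rpow] at h6
  have h7 := ppow_card ⌊x⌋₊
  calc (((Finset.Icc 2 ⌊x⌋₊).filter (fun n : ℕ => IsPrimePow n ∧ ¬ n.Prime)).card : ℝ)
      ≤ ((Nat.sqrt ⌊x⌋₊ : ℕ) + 1) * ((Nat.log 2 ⌊x⌋₊ : ℕ) + 1) := by exact_mod_cast h7
    _ ≤ (√x + √x) * (2 * Real.log x + Real.log x) := by gcongr
    _ = 6 * √x * (Real.log x ^ (k + 1) / Real.log x ^ k) := by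
      field_simp; ring
    _ ≤ 6 * √x * (C2 * √x / Real.log x ^ k) := by gcongr
    _ = 6 * C2 * ((√x * √x) / Real.log x ^ k) := by ring
    _ = _ := by rw [Real.mul_self_sqrt hx0.le]

theorem pi_AP (k : ℕ) : ∃ C > 0, ∀ (q : ℕ) [NeZero q] (x : ℝ), 49 ≤ x →
    |(q.totient : ℝ) * (piq q ⌊x⌋₊ : ℝ) - ∫ t in (2 : ℝ)..x, 1 / Real.log t| ≤ C * (q : ℝ) ^ 2 * (x / Real.log x ^ k) := by
  obtain ⟨C1, hC1, h1⟩ := sum_Wq k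
  obtain ⟨C2, hC2, h2⟩ := ppow_bound k
  obtain ⟨C3, hC3, h3⟩ := log_pow_le k (ε := 1) (by norm_num)
  refine ⟨C1 + C2 + 2 * C3, by positivity, fun q _ x hx => ?_⟩
  have hx0 : 0 < x := by linarith
  have hl1 : 1 ≤ Real.log x := one_le_log (by linarith)
  have hq1 : (1 : ℝ) ≤ q := by exact_mod_cast NeZero.one_le
  have hq2 : (1 : ℝ) ≤ (q : ℝ) ^ 2 := one_le_pow₀ hq1
  have a1 := h1 q x hx
  have a2 := h2 x hx
  have a3 := log_integral x (by linarith)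
  set N := ⌊x⌋₊ with hN
  set I := ∫ t in (2 : ℝ)..x, 1 / Real.log t
  have hpi : (piq q N : ℝ) = ∑ n ∈ Finset.Icc 2 N, (if n.Prime ∧ (n : ZMod q) = 1 then (1 : ℝ) else 0) := by
    rw [← Finset.sum_filter, Finset.sum_const, nsmul_eq_mul, mul_one, piq]
    congr 2
    ext n
    simp only [Finset.mem_filter, Finset.mem_Icc]
    constructor
    · rintro ⟨⟨_, h⟩, h', h''⟩
      exact ⟨⟨h'.two_le, h⟩, h', h''⟩
    · rintro ⟨⟨_, h⟩, h', h''⟩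
      exact ⟨⟨h'.one_le, h⟩, h', h''⟩
  have hcard : (((Finset.Icc 2 N).filter (fun n : ℕ => IsPrimePow n ∧ ¬ n.Prime)).card : ℝ) = ∑ n ∈ Finset.Icc 2 N, (if IsPrimePow n ∧ ¬ n.Prime then (1 : ℝ) else 0) := by
    rw [← Finset.sum_filter, Finset.sum_const, nsmul_eq_mul, mul_one]
  have hterm : ∀ n ∈ Finset.Icc 2 N, |Wq q n / Real.log n - ((q.totient : ℝ) * (if n.Prime ∧ (n : ZMod q) = 1 then (1 : ℝ) else 0) - 1 / Real.log n)| ≤ q * (if IsPrimePow n ∧ ¬ n.Prime then (1 : ℝ) else 0) := by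
    intro n hn
    rw [Finset.mem_Icc] at hn
    have hlog : 0 < Real.log n := Real.log_pos (by
      have : 1 < n := by omega
      exact_mod_cast this)
    have htot : (q.totient : ℝ) ≤ q := by exact_mod_cast Nat.totient_le q
    rw [Wq, sub_div, sub_sub_sub_cancel_right, mul_div_assoc, ← mul_sub, abs_mul, Nat.abs_cast]
    refine mul_le_mul htot ?_ (abs_nonneg _) (by positivity)
    by_cases hq : (n : ZMod q) = 1
    · by_cases hp : n.Prime
      · simp [hq, hp, ArithmeticFunction.vonMangoldt_apply_prime hp, hlog.ne']
      · by_cases hpp : IsPrimePow n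
        · simp only [hq, hp, hpp]
          simp only [if_true, false_and, if_false, sub_zero, not_false_eq_true, and_self]
          rw [abs_of_nonneg (div_nonneg ArithmeticFunction.vonMangoldt_nonneg hlog.le), div_le_one hlog]
          exact ArithmeticFunction.vonMangoldt_le_log
        · simp [hq, hp, hpp, ArithmeticFunction.vonMangoldt_eq_zero_iff.2 hpp]
    · simp only [hq, and_false, if_false, zero_div, sub_zero, abs_zero]
      split_ifs <;> norm_num
  have hsum : |∑ n ∈ Finset.Icc 2 N, Wq q n / Real.log n - ((q.totient : ℝ) * (piq q N : ℝ) - ∑ n ∈ Finset.Icc 2 N, 1 / Real.log n)| ≤ q * (C2 * (x / Real.log x ^ k)) := by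
    rw [hpi, Finset.mul_sum, ← Finset.sum_sub_distrib, ← Finset.sum_sub_distrib]
    refine (Finset.abs_sum_le_sum_abs _ _).trans ((Finset.sum_le_sum hterm).trans ?_)
    rw [← Finset.mul_sum, ← hcard]
    gcongr
  have h4 := h3 x (by linarith)
  rw [Real.rpow_one] at h4
  have h5 : 2 ≤ 2 * C3 * (q : ℝ) ^ 2 * (x / Real.log x ^ k) := by
    have : 1 ≤ C3 * x / Real.log x ^ k := by
      rw [le_div_iff₀ (by positivity), one_mul]; exact h4
    calc (2 : ℝ) ≤ 2 * (1 * (C3 * x / Real.log x ^ k)) := by linarith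
      _ ≤ 2 * ((q : ℝ) ^ 2 * (C3 * x / Real.log x ^ k)) := by gcongr
      _ = _ := by ring
  have h6 : q * (C2 * (x / Real.log x ^ k)) ≤ C2 * (q : ℝ) ^ 2 * (x / Real.log x ^ k) := by
    calc q * (C2 * (x / Real.log x ^ k)) ≤ (q : ℝ) ^ 2 * (C2 * (x / Real.log x ^ k)) := by
          gcongr; nlinarith
      _ = _ := by ring
  rw [abs_le] at *
  constructor <;> nlinarith [a1.1, a1.2, a3.1, a3.2, hsum.1, hsum.2]

end P16
end SW

namespace SW
section P17
open MeasureTheory Filter Topology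

noncomputable def cA : ArithmeticFunction ℝ := ⟨fun n => (ArithmeticFunction.moebius n : ℝ) / n, by simp⟩
noncomputable def cB : ArithmeticFunction ℝ := ⟨fun n => 1 / (n : ℝ) ^ 2, by simp⟩
noncomputable def cc : ArithmeticFunction ℝ := cA * cB

lemma cA_mult : cA.IsMultiplicative := by
  rw [ArithmeticFunction.IsMultiplicative.iff_ne_zero]
  refine ⟨by simp [cA], fun {m n} hm hn h => ?_⟩
  simp only [cA, ArithmeticFunction.coe_mk]
  rw [ArithmeticFunction.isMultiplicative_moebius.map_mul_of_coprime h]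
  push_cast
  field_simp

lemma cB_mult : cB.IsMultiplicative := by
  rw [ArithmeticFunction.IsMultiplicative.iff_ne_zero]
  refine ⟨by simp [cB], fun {m n} hm hn h => ?_⟩
  simp only [cB, ArithmeticFunction.coe_mk]
  push_cast
  field_simp

lemma cc_mult : cc.IsMultiplicative := cA_mult.mul cB_mult

lemma cc_prime_pow (q : ℕ) (hq : q.Prime) (k : ℕ) :
    cc (q ^ (k + 1)) = (1 - (q : ℝ)) / (q : ℝ) ^ (2 * (k + 1)) := by
  have hq0 : (q : ℝ) ≠ 0 := by exact_mod_cast hq.ne_zero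
  rw [cc, ArithmeticFunction.mul_apply, Nat.sum_divisorsAntidiagonal (fun i j => cA i * cB j), Nat.sum_divisors_prime_pow hq, Finset.sum_range_succ', Finset.sum_range_succ']
  have h0 : ∑ i ∈ Finset.range k, cA (q ^ (i + 1 + 1)) * cB (q ^ (k + 1) / q ^ (i + 1 + 1)) = 0 := by
    refine Finset.sum_eq_zero fun i _ => ?_
    have : ArithmeticFunction.moebius (q ^ (i + 1 + 1)) = 0 := by
      rw [ArithmeticFunction.moebius_apply_prime_pow hq (by omega)]
      simp
    simp [cA, this]
  rw [h0]
  have e1 : q ^ (k + 1) / q ^ (0 + 1) = q ^ k := by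
    rw [zero_add, Nat.pow_div (by omega) hq.pos, Nat.add_sub_cancel]
  rw [e1]
  simp only [cA, cB, ArithmeticFunction.coe_mk, zero_add, pow_one, ArithmeticFunction.moebius_apply_prime hq, pow_zero, Nat.div_one]
  push_cast
  simp only [ArithmeticFunction.moebius_apply_one]
  push_cast
  field_simp
  ring

noncomputable def gg (n : ℕ) : ℝ := cc n / (n.totient : ℝ)

lemma gg_mul {m n : ℕ} (h : m.Coprime n) : gg (m * n) = gg m * gg n := by
  unfold gg
  rw [cc_mult.map_mul_of_coprime h, Nat.totient_mul h]
  push_cast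
  rw [mul_div_mul_comm]

lemma gg_one : gg 1 = 1 := by simp [gg, cc_mult.map_one]
lemma gg_zero : gg 0 = 0 := by simp [gg]

lemma gg_prime_pow (q : ℕ) (hq : q.Prime) (k : ℕ) :
    gg (q ^ (k + 1)) = - (q : ℝ) * ((1 / (q : ℝ) ^ 3)) ^ (k + 1) := by
  have hq0 : (q : ℝ) ≠ 0 := by exact_mod_cast hq.ne_zero
  have hq1 : (q : ℝ) - 1 ≠ 0 := by
    have := hq.one_lt
    have : (1 : ℝ) < q := by exact_mod_cast this
    linarith
  rw [gg, cc_prime_pow q hq, Nat.totient_prime_pow_succ hq]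
  push_cast [hq.one_le]
  rw [div_pow, one_pow, ← pow_mul]
  field_simp
  ring

lemma gg_abs (n : ℕ) : |gg n| ≤ 1 / (n : ℝ) ^ 2 := by
  induction n using Nat.recOnPosPrimePosCoprime with
  | zero => simp [gg_zero]
  | one => simp [gg_one]
  | prime_pow p k hp hk =>
    obtain ⟨k, rfl⟩ : ∃ j, k = j + 1 := ⟨k - 1, by omega⟩
    have h1 : (1 : ℝ) ≤ p := by exact_mod_cast hp.one_le
    rw [gg_prime_pow p hp, neg_mul, abs_neg, abs_of_nonneg (by positivity), div_pow, one_pow, mul_one_div,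
      div_le_div_iff₀ (by positivity) (by push_cast; positivity)]
    push_cast
    rw [← pow_mul, ← pow_mul, one_mul, ← pow_succ']
    exact pow_le_pow_right₀ h1 (by omega)
  | coprime a b ha hb hab iha ihb =>
    rw [gg_mul hab, abs_mul]
    push_cast
    calc |gg a| * |gg b| ≤ (1 / (a : ℝ) ^ 2) * (1 / (b : ℝ) ^ 2) := by gcongr
      _ = _ := by rw [mul_pow, div_mul_div_comm, one_mul]

lemma cc_eq (n : ℕ) (hn : n ≠ 0) : cc n = n.totient * gg n := by
  have : (n.totient : ℝ) ≠ 0 := by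
    have := Nat.totient_pos.2 (Nat.pos_of_ne_zero hn)
    positivity
  rw [gg]; field_simp

lemma cc_abs (n : ℕ) (hn : n ≠ 0) : |cc n| ≤ 1 / (n : ℝ) := by
  have h1 := gg_abs n
  have h0 : (0 : ℝ) < n := by exact_mod_cast Nat.pos_of_ne_zero hn
  have h2 : (n.totient : ℝ) ≤ n := by exact_mod_cast Nat.totient_le n
  rw [cc_eq n hn, abs_mul, Nat.abs_cast]
  calc (n.totient : ℝ) * |gg n| ≤ n * (1 / (n : ℝ) ^ 2) := by gcongr
    _ = _ := by field_simp

lemma gg_summable : Summable gg := by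
  refine Summable.of_norm_bounded (g := fun n : ℕ => 1 / (n : ℝ) ^ 2) ?_ gg_abs
  exact Real.summable_one_div_nat_pow.2 (by norm_num)

lemma gg_local (q : ℕ) (hq : q.Prime) : ∑' k, gg (q ^ k) = 1 - (q : ℝ) / ((q : ℝ) ^ 3 - 1) := by
  have h1 : (1 : ℝ) < q := by exact_mod_cast hq.one_lt
  have h3 : (1 : ℝ) < (q : ℝ) ^ 3 := one_lt_pow₀ h1 (by norm_num)
  have hs := hasSum_geometric_of_lt_one (r := 1 / (q : ℝ) ^ 3) (by positivity) (by rw [div_lt_one (by positivity)]; exact h3)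
  have h4 : HasSum (fun k => gg (q ^ (k + 1))) (- (q : ℝ) / (q : ℝ) ^ 3 * (1 - 1 / (q : ℝ) ^ 3)⁻¹) := by
    have := hs.mul_left (- (q : ℝ) / (q : ℝ) ^ 3)
    refine this.congr_fun ?_ |> fun h => h
    intro k
    rw [gg_prime_pow q hq, pow_succ]
    field_simp
  have h5 := (hasSum_nat_add_iff (f := fun k => gg (q ^ k)) 1).1 h4
  rw [h5.tsum_eq]
  simp only [Finset.range_one, Finset.sum_singleton, pow_zero, gg_one]
  have : (q : ℝ) ^ 3 - 1 ≠ 0 := by linarith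
  field_simp
  ring

lemma gg_tsum : ∑' n, gg n = ∏' q : Nat.Primes, (1 - ((q : ℕ) : ℝ) / (((q : ℕ) : ℝ) ^ 3 - 1)) := by
  rw [← EulerProduct.eulerProduct_tprod gg_one (fun {m n} h => gg_mul h) gg_summable.norm gg_zero]
  refine tprod_congr fun q => gg_local q q.2

lemma gg_tail (D : ℕ) (hD : 0 < D) : |∑' n, gg n - ∑ n ∈ Finset.Icc 1 D, gg n| ≤ 1 / (D : ℝ) := by
  have h1 : Tendsto (fun N => |∑ n ∈ Finset.range N, gg n - ∑ n ∈ Finset.Icc 1 D, gg n|) atTop (𝓝 |∑' n, gg n - ∑ n ∈ Finset.Icc 1 D, gg n|) :=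
    ((gg_summable.hasSum.tendsto_sum_nat).sub_const _).abs
  refine le_of_tendsto h1 ?_
  filter_upwards [eventually_ge_atTop (D + 1)] with N hN
  have e : ∑ n ∈ Finset.range N, gg n - ∑ n ∈ Finset.Icc 1 D, gg n = ∑ n ∈ Finset.Ioc D (N - 1), gg n := by
    rw [sub_eq_iff_eq_add, add_comm]
    have : Finset.range N = insert 0 (Finset.Icc 1 D ∪ Finset.Ioc D (N - 1)) := by
      ext a; simp only [Finset.mem_range, Finset.mem_insert, Finset.mem_union, Finset.mem_Icc, Finset.mem_Ioc]; omega
    rw [this, Finset.sum_insert (by simp), gg_zero, zero_add, Finset.sum_union]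
    rw [Finset.disjoint_left]
    intro a; simp only [Finset.mem_Icc, Finset.mem_Ioc]; omega
  rw [e]
  refine (Finset.abs_sum_le_sum_abs _ _).trans ?_
  calc ∑ n ∈ Finset.Ioc D (N - 1), |gg n| ≤ ∑ n ∈ Finset.Ioc D (N - 1), ((n : ℝ) ^ 2)⁻¹ := by
        refine Finset.sum_le_sum fun n _ => ?_
        have := gg_abs n
        rwa [one_div] at this
    _ ≤ (D : ℝ)⁻¹ - ((N - 1 : ℕ) : ℝ)⁻¹ := sum_Ioc_inv_sq_le_sub (by omega) (by omega)
    _ ≤ _ := by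
      have : 0 ≤ ((N - 1 : ℕ) : ℝ)⁻¹ := by positivity
      rw [one_div]; linarith

end P17
end SW

namespace SW
section P18
open MeasureTheory Filter Topology

noncomputable def ff (n : ℕ) : ℝ := ∑ d ∈ n.divisors, cc d

lemma zmod_one_iff (d p : ℕ) (hp : 1 ≤ p) : (p : ZMod d) = 1 ↔ d ∣ p - 1 := by
  rw [← ZMod.natCast_eq_zero_iff, Nat.cast_sub hp, sub_eq_zero, Nat.cast_one]

lemma sum_ff (N : ℕ) : ∑ p ∈ (Finset.Icc 1 N).filter Nat.Prime, ff (p - 1) = ∑ d ∈ Finset.Icc 1 N, cc d * (piq d N : ℝ) := by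
  have h1 : ∀ p ∈ (Finset.Icc 1 N).filter Nat.Prime, ff (p - 1) = ∑ d ∈ Finset.Icc 1 N, (if (p : ZMod d) = 1 then cc d else 0) := by
    intro p hp
    rw [Finset.mem_filter, Finset.mem_Icc] at hp
    rw [ff, ← Finset.sum_filter]
    refine Finset.sum_congr ?_ fun _ _ => rfl
    ext d
    rw [Finset.mem_filter, Finset.mem_Icc, zmod_one_iff d p hp.1.1, Nat.mem_divisors]
    have h2 := hp.2.two_le
    constructor
    · rintro ⟨h, _⟩
      have := Nat.le_of_dvd (by omega) h
      have := Nat.pos_of_dvd_of_pos h (by omega)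
      exact ⟨⟨this, by omega⟩, h⟩
    · rintro ⟨_, h⟩
      exact ⟨h, by omega⟩
  rw [Finset.sum_congr rfl h1, Finset.sum_comm]
  refine Finset.sum_congr rfl fun d _ => ?_
  rw [← Finset.sum_filter, Finset.sum_const, nsmul_eq_mul, mul_comm, piq, Finset.filter_filter]

lemma piq_le (m N : ℕ) (hm : 0 < m) : piq m N ≤ N / m := by
  have : piq m N ≤ (Finset.Icc 1 (N / m)).card := by
    refine Finset.card_le_card_of_injOn (fun n => (n - 1) / m) ?_ ?_
    · intro n hn
      simp only [Finset.coe_filter, Set.mem_ofPred_eq, Finset.mem_Icc] at hn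
      obtain ⟨⟨h1, h2⟩, h3, h4⟩ := hn
      rw [zmod_one_iff m n h1] at h4
      have h5 := h3.two_le
      simp only [Finset.coe_Icc, Set.mem_Icc]
      refine ⟨Nat.div_pos (Nat.le_of_dvd (by omega) h4) hm, Nat.div_le_div_right (by omega)⟩
    · intro a ha b hb hab
      simp only [Finset.coe_filter, Set.mem_ofPred_eq, Finset.mem_Icc] at ha hb
      have h1 := (zmod_one_iff m a ha.1.1).1 ha.2.2
      have h2 := (zmod_one_iff m b hb.1.1).1 hb.2.2
      have h3 := Nat.div_mul_cancel h1
      have h4 := Nat.div_mul_cancel h2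
      simp only at hab
      rw [hab, h4] at h3
      omega
  rwa [Nat.card_Icc, Nat.add_sub_cancel] at this

lemma li_bound (x : ℝ) (hx : 2 ≤ x) : |∫ t in (2 : ℝ)..x, 1 / Real.log t| ≤ 2 * x := by
  have := intervalIntegral.norm_integral_le_of_norm_le_const (a := 2) (b := x) (f := fun t => 1 / Real.log t) (C := 2) ?_
  · rw [Real.norm_eq_abs, abs_of_nonneg (by linarith : 0 ≤ x - 2)] at this
    linarith
  · intro t ht
    rw [Set.uIoc_of_le hx] at ht
    have h1 := log_half
    have h2 : Real.log 2 ≤ Real.log t := Real.log_le_log (by norm_num) ht.1.le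
    rw [Real.norm_eq_abs, abs_of_nonneg (by apply div_nonneg zero_le_one; linarith), div_le_iff₀ (by linarith)]
    linarith

theorem avg_ff (K : ℕ) : ∃ C > 0, ∀ x : ℝ, 49 ≤ x →
    |∑ p ∈ (Finset.Icc 1 ⌊x⌋₊).filter Nat.Prime, ff (p - 1) - (∑' n, gg n) * ∫ t in (2 : ℝ)..x, 1 / Real.log t| ≤ C * (x / Real.log x ^ K) := by
  obtain ⟨C1, hC1, h1⟩ := pi_AP (2 * K)
  refine ⟨C1 + 6, by positivity, fun x hx => ?_⟩
  have hx0 : 0 < x := by linarith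
  have hl1 : 1 ≤ Real.log x := one_le_log (by linarith)
  have hI := li_bound x (by linarith)
  set I := ∫ t in (2 : ℝ)..x, 1 / Real.log t with hIdef
  set N := ⌊x⌋₊ with hN
  have hNx : (N : ℝ) ≤ x := Nat.floor_le hx0.le
  set D := ⌊Real.log x ^ K⌋₊ with hD
  have hlK : 1 ≤ Real.log x ^ K := one_le_pow₀ hl1
  have hD1 : 1 ≤ D := Nat.le_floor (by simpa using hlK)
  have hDle : (D : ℝ) ≤ Real.log x ^ K := Nat.floor_le (by linarith)
  have hDge : Real.log x ^ K ≤ 2 * D := by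
    have := Nat.lt_floor_add_one (Real.log x ^ K)
    have : (1 : ℝ) ≤ D := by exact_mod_cast hD1
    linarith
  have hDinv : 1 / (D : ℝ) ≤ 2 / Real.log x ^ K := by
    have : (1 : ℝ) ≤ D := by exact_mod_cast hD1
    rw [div_le_div_iff₀ (by linarith) (by linarith)]; linarith
  rw [sum_ff]
  -- extend to Icc 1 (max N D)
  have hext : ∑ d ∈ Finset.Icc 1 N, cc d * (piq d N : ℝ) = ∑ d ∈ Finset.Icc 1 (max N D), cc d * (piq d N : ℝ) := by
    refine Finset.sum_subset (Finset.Icc_subset_Icc_right (le_max_left _ _)) fun d hd hd' => ?_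
    rw [Finset.mem_Icc] at hd hd'
    have h2 : N < d := by omega
    have := piq_le d N (by omega)
    rw [Nat.div_eq_of_lt h2] at this
    simp [Nat.le_zero.1 this]
  have hsplit : ∑ d ∈ Finset.Icc 1 (max N D), cc d * (piq d N : ℝ) = ∑ d ∈ Finset.Icc 1 D, cc d * (piq d N : ℝ) + ∑ d ∈ Finset.Ioc D (max N D), cc d * (piq d N : ℝ) := by
    rw [← Finset.sum_union]
    · refine Finset.sum_congr ?_ fun _ _ => rfl
      have := le_max_right N D
      ext a; simp only [Finset.mem_union, Finset.mem_Icc, Finset.mem_Ioc]; omega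
    · rw [Finset.disjoint_left]
      intro a; simp only [Finset.mem_Icc, Finset.mem_Ioc]; omega
  have hA : |∑ d ∈ Finset.Icc 1 D, cc d * (piq d N : ℝ) - (∑ d ∈ Finset.Icc 1 D, gg d) * I| ≤ C1 * (x / Real.log x ^ K) := by
    rw [Finset.sum_mul, ← Finset.sum_sub_distrib]
    refine (Finset.abs_sum_le_sum_abs _ _).trans ?_
    calc ∑ d ∈ Finset.Icc 1 D, |cc d * (piq d N : ℝ) - gg d * I| ≤ ∑ d ∈ Finset.Icc 1 D, C1 * (x / Real.log x ^ (2 * K)) := by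
          refine Finset.sum_le_sum fun d hd => ?_
          rw [Finset.mem_Icc] at hd
          haveI : NeZero d := ⟨by omega⟩
          have h3 := h1 d x hx
          have h4 := gg_abs d
          have hd0 : (0 : ℝ) < d := by exact_mod_cast hd.1
          rw [cc_eq d (by omega), show (d.totient : ℝ) * gg d * (piq d N : ℝ) - gg d * I = gg d * ((d.totient : ℝ) * (piq d N : ℝ) - I) by ring, abs_mul]
          calc _ ≤ 1 / (d : ℝ) ^ 2 * (C1 * (d : ℝ) ^ 2 * (x / Real.log x ^ (2 * K))) := by gcongr
            _ = _ := by field_simp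
      _ = D * (C1 * (x / Real.log x ^ (2 * K))) := by
        rw [Finset.sum_const, Nat.card_Icc, Nat.add_sub_cancel, nsmul_eq_mul]
      _ ≤ Real.log x ^ K * (C1 * (x / Real.log x ^ (2 * K))) := by gcongr
      _ = _ := by
        rw [two_mul, pow_add]; field_simp
  have hB : |∑ d ∈ Finset.Ioc D (max N D), cc d * (piq d N : ℝ)| ≤ 2 * (x / Real.log x ^ K) := by
    refine (Finset.abs_sum_le_sum_abs _ _).trans ?_
    calc ∑ d ∈ Finset.Ioc D (max N D), |cc d * (piq d N : ℝ)| ≤ ∑ d ∈ Finset.Ioc D (max N D), x * ((d : ℝ) ^ 2)⁻¹ := by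
          refine Finset.sum_le_sum fun d hd => ?_
          rw [Finset.mem_Ioc] at hd
          have hd0 : (0 : ℝ) < d := by
            have : 0 < d := by omega
            exact_mod_cast this
          have h4 := cc_abs d (by omega)
          have h5 : (piq d N : ℝ) ≤ x / d := by
            have h6 : (piq d N : ℝ) ≤ ((N / d : ℕ) : ℝ) := by exact_mod_cast piq_le d N (by omega)
            refine h6.trans (Nat.cast_div_le.trans ?_)
            gcongr
          rw [abs_mul, Nat.abs_cast]
          calc _ ≤ 1 / (d : ℝ) * (x / d) := by gcongr
            _ = _ := by field_simp
      _ = x * ∑ d ∈ Finset.Ioc D (max N D), ((d : ℝ) ^ 2)⁻¹ := by rw [Finset.mul_sum]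
      _ ≤ x * ((D : ℝ)⁻¹ - ((max N D : ℕ) : ℝ)⁻¹) := by
        gcongr
        exact sum_Ioc_inv_sq_le_sub (by omega) (le_max_right _ _)
      _ ≤ x * (1 / D) := by
        gcongr
        have : 0 ≤ ((max N D : ℕ) : ℝ)⁻¹ := by positivity
        rw [one_div]; linarith
      _ ≤ x * (2 / Real.log x ^ K) := by gcongr
      _ = _ := by ring
  have hC : |(∑' n, gg n - ∑ d ∈ Finset.Icc 1 D, gg d) * I| ≤ 4 * (x / Real.log x ^ K) := by
    rw [abs_mul]
    calc _ ≤ (2 / Real.log x ^ K) * (2 * x) := by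
          gcongr
          exact (gg_tail D hD1).trans hDinv
      _ = _ := by ring
  rw [hext, hsplit]
  rw [abs_le] at *
  constructor <;> nlinarith [hA.1, hA.2, hB.1, hB.2, hC.1, hC.2]

end P18
end SW

namespace SW
section P19
open MeasureTheory Filter Topology

lemma inv_sin_le (p v : ℕ) (hv : 0 < v) (hvp : v < p) :
    1 / Real.sin (Real.pi * v / p) ≤ (p : ℝ) / 2 * (1 / (v : ℝ) + 1 / ((p : ℝ) - v)) ∧ 0 < Real.sin (Real.pi * v / p) := by
  have hv' : (0 : ℝ) < v := by exact_mod_cast hv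
  have hp' : (v : ℝ) < p := by exact_mod_cast hvp
  have hp0 : (0 : ℝ) < p := by linarith
  have key : ∀ w : ℝ, 0 < w → w ≤ p / 2 → 1 / Real.sin (Real.pi * w / p) ≤ (p : ℝ) / 2 * (1 / w) ∧ 0 < Real.sin (Real.pi * w / p) := by
    intro w hw hw2
    have hpi := Real.pi_pos
    have h1 : Real.pi * w / p ≤ Real.pi / 2 := by
      rw [div_le_iff₀ hp0]; nlinarith
    have h2 := Real.mul_le_sin (x := Real.pi * w / p) (by positivity) h1
    have h3 : 2 / Real.pi * (Real.pi * w / p) = 2 * w / p := by field_simp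
    rw [h3] at h2
    have h4 : 0 < 2 * w / p := by positivity
    refine ⟨?_, lt_of_lt_of_le h4 h2⟩
    calc 1 / Real.sin (Real.pi * w / p) ≤ 1 / (2 * w / p) := by gcongr
      _ = _ := by field_simp
  have hpv : (0 : ℝ) < p - v := by linarith
  rcases le_or_gt (v : ℝ) (p / 2) with h | h
  · obtain ⟨h1, h2⟩ := key v hv' h
    refine ⟨h1.trans ?_, h2⟩
    gcongr
    have : 0 < 1 / ((p : ℝ) - v) := by positivity
    linarith
  · obtain ⟨h1, h2⟩ := key ((p : ℝ) - v) hpv (by linarith)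
    have e : Real.sin (Real.pi * ((p : ℝ) - v) / p) = Real.sin (Real.pi * v / p) := by
      rw [← Real.sin_pi_sub]
      congr 1
      field_simp
      ring
    rw [e] at h1 h2
    refine ⟨h1.trans ?_, h2⟩
    gcongr
    have : 0 < 1 / (v : ℝ) := by positivity
    linarith

lemma geom_add (p : ℕ) [NeZero p] (v : ℕ) (hv : 0 < v) (hvp : v < p) (M : ℕ) :
    ‖∑ m ∈ Finset.range M, ZMod.stdAddChar ((v : ZMod p) * (m : ZMod p))‖ ≤ (p : ℝ) / 2 * (1 / (v : ℝ) + 1 / ((p : ℝ) - v)) := by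
  obtain ⟨h1, h2⟩ := inv_sin_le p v hv hvp
  set z : ℂ := ZMod.stdAddChar (v : ZMod p) with hz
  have hzn : ‖z‖ = 1 := by rw [hz, ZMod.stdAddChar_apply]; exact Circle.norm_coe _
  have hpow : ∀ m : ℕ, ZMod.stdAddChar ((v : ZMod p) * (m : ZMod p)) = z ^ m := by
    intro m
    rw [hz, ← AddChar.map_nsmul_eq_pow, nsmul_eq_mul, mul_comm]
  have hz1 : ‖z - 1‖ = 2 * Real.sin (Real.pi * v / p) := by
    have h3 := ZMod.stdAddChar_coe (N := p) (v : ℤ)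
    rw [hz]
    push_cast at h3
    rw [h3]
    have h4 : (2 * Real.pi * Complex.I * v / p : ℂ) = Complex.I * ((2 * Real.pi * v / p : ℝ) : ℂ) := by push_cast; ring
    rw [h4, Complex.norm_exp_I_mul_ofReal_sub_one, Real.norm_eq_abs, show 2 * Real.pi * v / p / 2 = Real.pi * v / p by ring, abs_of_pos (by positivity)]
  have hne : z ≠ 1 := by
    intro h
    rw [h] at hz1
    simp at hz1
    linarith
  rw [Finset.sum_congr rfl (fun m _ => hpow m), geom_sum_eq hne, norm_div, hz1]
  refine le_trans ?_ h1
  have h5 : ‖z ^ M - 1‖ ≤ 2 := by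
    refine (norm_sub_le _ _).trans ?_
    rw [norm_pow, hzn]; norm_num
  calc ‖z ^ M - 1‖ / (2 * Real.sin (Real.pi * v / p)) ≤ 2 / (2 * Real.sin (Real.pi * v / p)) := by gcongr
    _ = _ := by field_simp

theorem polya_vinogradov (p : ℕ) [Fact p.Prime] (χ : DirichletCharacter ℂ p) (hχ : χ ≠ 1) (M : ℕ) :
    ‖∑ m ∈ Finset.range M, χ (m : ZMod p)‖ ≤ √(p : ℝ) * (1 + Real.log p) := by
  have hp := (Fact.out : p.Prime)
  have hp0 : (0 : ℝ) < p := by exact_mod_cast hp.pos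
  have hχ' : χ⁻¹ ≠ 1 := by simpa using hχ
  set ψ : AddChar (ZMod p) ℂ := ZMod.stdAddChar with hψ
  set G := gaussSum χ⁻¹ ψ with hG
  have hGn : ‖G‖ = √(p : ℝ) := by
    have h1 := gaussSum_mul_gaussSum_eq_card hχ' (ZMod.isPrimitive_stdAddChar p)
    rw [← hψ, ← star_gaussSum_eq, ← hG, ZMod.card] at h1
    have h2 := congrArg norm h1
    rw [norm_mul, norm_star, Complex.norm_natCast] at h2
    rw [← h2, Real.sqrt_mul_self (norm_nonneg _)]
  have hfour : ∀ m : ZMod p, χ m * G = ∑ a, χ⁻¹ a * ψ (a * m) := by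
    intro m
    by_cases hm : m = 0
    · subst hm
      have : ¬ IsUnit (0 : ZMod p) := not_isUnit_zero
      rw [MulChar.map_nonunit χ this]
      simp only [zero_mul, mul_zero, AddChar.map_zero_eq_one, mul_one]
      exact (MulChar.sum_eq_zero_of_ne_one hχ').symm
    · have h1 := gaussSum_mulShift_eq χ⁻¹ ψ (Units.mk0 m hm)
      rw [inv_inv, Units.val_mk0] at h1
      rw [← h1, gaussSum]
      refine Finset.sum_congr rfl fun a _ => ?_
      rw [AddChar.mulShift_apply, mul_comm m a]
  have h1 : (∑ m ∈ Finset.range M, χ (m : ZMod p)) * G = ∑ a, χ⁻¹ a * ∑ m ∈ Finset.range M, ψ (a * (m : ZMod p)) := by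
    rw [Finset.sum_mul, Finset.sum_congr rfl (fun (m : ℕ) _ => hfour (m : ZMod p)), Finset.sum_comm]
    refine Finset.sum_congr rfl fun a _ => ?_
    rw [Finset.mul_sum]
  have h2 : ∑ a, χ⁻¹ a * ∑ m ∈ Finset.range M, ψ (a * (m : ZMod p)) = ∑ v ∈ Finset.range p, χ⁻¹ (v : ZMod p) * ∑ m ∈ Finset.range M, ψ ((v : ZMod p) * (m : ZMod p)) :=
    (sum_range_zmod (fun a : ZMod p => χ⁻¹ a * ∑ m ∈ Finset.range M, ψ (a * (m : ZMod p)))).symm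
  have h3 : ‖∑ v ∈ Finset.range p, χ⁻¹ (v : ZMod p) * ∑ m ∈ Finset.range M, ψ ((v : ZMod p) * (m : ZMod p))‖ ≤ ∑ v ∈ Finset.range (p - 1), (p : ℝ) / 2 * (1 / ((v + 1 : ℕ) : ℝ) + 1 / ((p : ℝ) - (v + 1 : ℕ))) := by
    obtain ⟨n, hn⟩ : ∃ n, p = n + 1 := ⟨p - 1, by have := hp.pos; omega⟩
    have hr : Finset.range p = Finset.range ((p - 1) + 1) := by congr 1; omega
    rw [hr, Finset.sum_range_succ']
    have : ¬ IsUnit (0 : ZMod p) := not_isUnit_zero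
    rw [Nat.cast_zero, MulChar.map_nonunit _ this, zero_mul, add_zero]
    refine (norm_sum_le _ _).trans (Finset.sum_le_sum fun v hv => ?_)
    rw [Finset.mem_range] at hv
    rw [norm_mul]
    calc _ ≤ 1 * ‖∑ m ∈ Finset.range M, ψ (((v + 1 : ℕ) : ZMod p) * (m : ZMod p))‖ := by
          gcongr
          exact DirichletCharacter.norm_le_one _ _
      _ ≤ _ := by
        rw [one_mul]
        exact geom_add p (v + 1) (by omega) (by omega) M
  have h4 : ∑ v ∈ Finset.range (p - 1), (p : ℝ) / 2 * (1 / ((v + 1 : ℕ) : ℝ) + 1 / ((p : ℝ) - (v + 1 : ℕ))) ≤ p * (1 + Real.log p) := by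
    have e1 : ∑ v ∈ Finset.range (p - 1), 1 / ((p : ℝ) - (v + 1 : ℕ)) = ∑ v ∈ Finset.range (p - 1), 1 / ((v + 1 : ℕ) : ℝ) := by
      rw [← Finset.sum_range_reflect]
      refine Finset.sum_congr rfl fun v hv => ?_
      rw [Finset.mem_range] at hv
      congr 1
      rw [sub_eq_iff_eq_add]
      norm_cast
      omega
    have e2 : ∑ v ∈ Finset.range (p - 1), 1 / ((v + 1 : ℕ) : ℝ) = ((harmonic (p - 1) : ℚ) : ℝ) := by
      rw [harmonic]
      push_cast
      simp only [one_div]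
    have e3 := harmonic_le_one_add_log (p - 1)
    have e4 : Real.log ((p - 1 : ℕ) : ℝ) ≤ Real.log p := by
      apply Real.log_le_log
      · have : 0 < p - 1 := by have := hp.two_le; omega
        exact_mod_cast this
      · exact_mod_cast Nat.sub_le p 1
    rw [← Finset.mul_sum, Finset.sum_add_distrib, e1, e2]
    calc (p : ℝ) / 2 * ((harmonic (p - 1) : ℚ) + (harmonic (p - 1) : ℚ)) = p * (harmonic (p - 1) : ℚ) := by ring
      _ ≤ _ := by gcongr; linarith
  have h5 : ‖∑ m ∈ Finset.range M, χ (m : ZMod p)‖ * √(p : ℝ) ≤ p * (1 + Real.log p) := by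
    rw [← hGn, ← norm_mul, h1, h2]
    exact h3.trans h4
  have hs : 0 < √(p : ℝ) := Real.sqrt_pos.2 hp0
  rw [← mul_le_mul_iff_left₀ hs]
  refine h5.trans (le_of_eq ?_)
  have h6 := Real.mul_self_sqrt hp0.le
  linear_combination (-(1 + Real.log p)) * h6

end P19
end SW

namespace SW
section P20
open MeasureTheory Filter Topology

lemma char_residue (p : ℕ) [Fact p.Prime] (e : ℕ) (he : e ∣ p - 1) :
    ∃ χ : DirichletCharacter ℂ p, orderOf χ = e ∧ ∀ u : (ZMod p)ˣ, (χ (u : ZMod p) = 1 ↔ ∃ y : (ZMod p)ˣ, y ^ e = u) := by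
  have hp := (Fact.out : p.Prime)
  have he0 : e ≠ 0 := by
    rintro rfl
    have := hp.two_le
    have := Nat.eq_zero_of_zero_dvd he
    omega
  obtain ⟨χ, hχ⟩ := MulChar.exists_mulChar_orderOf (ZMod p) (n := e) (R := ℂ) (by rwa [ZMod.card]) (Complex.isPrimitiveRoot_exp e he0)
  refine ⟨χ, hχ, fun u => ⟨fun h => ?_, ?_⟩⟩
  · obtain ⟨g, hg⟩ := IsCyclic.exists_monoid_generator (α := (ZMod p)ˣ)
    obtain ⟨a, ha⟩ := hg u
    simp only at ha
    have h1 : χ ^ a = 1 := by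
      have hg' : ∀ x, x ∈ Subgroup.zpowers g := by
        intro x
        obtain ⟨b, hb⟩ := hg x
        exact ⟨b, by simpa using hb⟩
      rw [MulChar.eq_iff hg', MulChar.pow_apply_coe, MulChar.one_apply_coe, ← map_pow, ← Units.val_pow_eq_pow_val, ha, h]
    have h2 := orderOf_dvd_of_pow_eq_one h1
    rw [hχ] at h2
    obtain ⟨t, rfl⟩ := h2
    exact ⟨g ^ t, by rw [← pow_mul, mul_comm, ha]⟩
  · rintro ⟨y, rfl⟩
    rw [Units.val_pow_eq_pow_val, map_pow, ← MulChar.pow_apply_coe, ← hχ, pow_orderOf_eq_one, MulChar.one_apply_coe]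

lemma geom_char (e : ℕ) (z : ℂ) (hz : z ^ e = 1) : ∑ j ∈ Finset.range e, z ^ j = if z = 1 then (e : ℂ) else 0 := by
  split_ifs with h
  · simp [h]
  · rw [geom_sum_eq h, hz, sub_self, zero_div]

lemma moebius_sum (k : ℕ) (hk : k ≠ 0) : ∑ d ∈ k.divisors, (ArithmeticFunction.moebius d : ℤ) = if k = 1 then 1 else 0 := by
  rw [← ArithmeticFunction.coe_mul_zeta_apply, ArithmeticFunction.moebius_mul_coe_zeta, ArithmeticFunction.one_apply]

lemma gcd_indicator (n e h : ℕ) (hn : 0 < n) (hh : 0 < h) (he : e ∣ n) :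
    (if h.gcd n = e then (1 : ℂ) else 0) = ∑ d ∈ (n / e).divisors, if d * e ∣ h then (ArithmeticFunction.moebius d : ℂ) else 0 := by
  have he0 : 0 < e := Nat.pos_of_dvd_of_pos he hn
  obtain ⟨k, rfl⟩ := he
  have hk : 0 < k := Nat.pos_of_mul_pos_left hn |> fun h => by
    rcases Nat.eq_zero_or_pos k with h0 | h0
    · simp [h0] at hn
    · exact h0
  rw [Nat.mul_div_cancel_left _ he0]
  by_cases heh : e ∣ h
  · obtain ⟨m, rfl⟩ := heh
    have hm : 0 < m := by
      rcases Nat.eq_zero_or_pos m with h0 | h0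
      · simp [h0] at hh
      · exact h0
    have h1 : ∀ d ∈ k.divisors, (if d * e ∣ e * m then (ArithmeticFunction.moebius d : ℂ) else 0) = if d ∣ m then (ArithmeticFunction.moebius d : ℂ) else 0 := by
      intro d _
      have : d * e ∣ e * m ↔ d ∣ m := by rw [mul_comm d e]; exact Nat.mul_dvd_mul_iff_left he0
      simp only [this]
    rw [Finset.sum_congr rfl h1, ← Finset.sum_filter]
    have h2 : k.divisors.filter (fun d => d ∣ m) = (m.gcd k).divisors := by
      ext d
      rw [Finset.mem_filter, Nat.mem_divisors, Nat.mem_divisors, Nat.dvd_gcd_iff]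
      have : m.gcd k ≠ 0 := Nat.gcd_ne_zero_right hk.ne'
      constructor
      · rintro ⟨⟨a, _⟩, b⟩; exact ⟨⟨b, a⟩, this⟩
      · rintro ⟨⟨a, b⟩, _⟩; exact ⟨⟨b, hk.ne'⟩, a⟩
    rw [h2]
    have h3 := moebius_sum (m.gcd k) (Nat.gcd_ne_zero_right hk.ne')
    have h4 := congrArg (fun z : ℤ => (z : ℂ)) h3
    push_cast at h4
    rw [h4, Nat.gcd_mul_left]
    have : e * m.gcd k = e ↔ m.gcd k = 1 := by
      constructor
      · intro h
        exact Nat.eq_of_mul_eq_mul_left he0 (by rw [h, mul_one])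
      · intro h; rw [h, mul_one]
    simp only [this]
  · have h1 : (e * k).gcd h ≠ e := by
      intro hc
      exact heh (hc ▸ Nat.gcd_dvd_right _ _)
    rw [Nat.gcd_comm, if_neg h1]
    symm
    refine Finset.sum_eq_zero fun d _ => ?_
    rw [if_neg]
    intro hc
    exact heh ((Dvd.intro_left _ rfl).trans hc)

lemma sum_multiples (n D : ℕ) (hD : 0 < D) (f : ℕ → ℂ) :
    ∑ h ∈ (Finset.Icc 1 n).filter (fun h => D ∣ h), f h = ∑ m ∈ Finset.Icc 1 (n / D), f (D * m) := by
  refine Finset.sum_nbij' (fun h => h / D) (fun m => D * m) ?_ ?_ ?_ ?_ ?_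
  · intro h hh
    simp only [Finset.mem_filter, Finset.mem_Icc] at hh ⊢
    exact ⟨Nat.div_pos (Nat.le_of_dvd (by omega) hh.2) hD, Nat.div_le_div_right hh.1.2⟩
  · intro m hm
    simp only [Finset.mem_filter, Finset.mem_Icc] at hm ⊢
    refine ⟨⟨Nat.mul_pos hD hm.1, ?_⟩, Dvd.intro _ rfl⟩
    calc D * m ≤ D * (n / D) := Nat.mul_le_mul_left _ hm.2
      _ ≤ n := Nat.mul_div_le _ _
  · intro h hh
    simp only [Finset.mem_filter] at hh
    exact Nat.mul_div_cancel' hh.2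
  · intro m _
    exact Nat.mul_div_cancel_left _ hD
  · intro h hh
    simp only [Finset.mem_filter] at hh
    rw [Nat.mul_div_cancel' hh.2]

lemma pv_Icc (p : ℕ) [Fact p.Prime] (χ : DirichletCharacter ℂ p) (hχ : χ ≠ 1) (M : ℕ) :
    ‖∑ m ∈ Finset.Icc 1 M, χ (m : ZMod p)‖ ≤ √(p : ℝ) * (1 + Real.log p) := by
  have h := polya_vinogradov p χ hχ (M + 1)
  rw [Finset.sum_range_succ'] at h
  have h0 : χ ((0 : ℕ) : ZMod p) = 0 := by
    rw [Nat.cast_zero]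
    exact MulChar.map_nonunit _ not_isUnit_zero
  rw [h0, add_zero] at h
  have : ∑ m ∈ Finset.Icc 1 M, χ (m : ZMod p) = ∑ k ∈ Finset.range M, χ ((k + 1 : ℕ) : ZMod p) := by
    rw [Finset.range_eq_Ico, Finset.sum_Ico_add' (fun k : ℕ => χ (k : ZMod p)) 0 M 1, zero_add]
    rfl
  rw [this]
  exact h

lemma gcd_char_sum (p : ℕ) [Fact p.Prime] (χ : DirichletCharacter ℂ p) (hχ : χ ≠ 1) (n e : ℕ) (hn : 0 < n) (he : e ∣ n) :
    ‖∑ h ∈ (Finset.Icc 1 n).filter (fun h : ℕ => h.gcd n = e), χ (h : ZMod p)‖ ≤ (n.divisors.card : ℝ) * (√(p : ℝ) * (1 + Real.log p)) := by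
  have he0 : 0 < e := Nat.pos_of_dvd_of_pos he hn
  have h1 : ∑ h ∈ (Finset.Icc 1 n).filter (fun h : ℕ => h.gcd n = e), χ (h : ZMod p) =
      ∑ d ∈ (n / e).divisors, (ArithmeticFunction.moebius d : ℂ) * ∑ h ∈ (Finset.Icc 1 n).filter (fun h : ℕ => d * e ∣ h), χ (h : ZMod p) := by
    rw [Finset.sum_filter]
    have h2 : ∀ h ∈ Finset.Icc 1 n, (if h.gcd n = e then χ (h : ZMod p) else 0) = ∑ d ∈ (n / e).divisors, (if d * e ∣ h then (ArithmeticFunction.moebius d : ℂ) * χ (h : ZMod p) else 0) := by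
      intro h hh
      rw [Finset.mem_Icc] at hh
      have h3 := gcd_indicator n e h hn (by omega) he
      have h4 : (if h.gcd n = e then χ (h : ZMod p) else 0) = (if h.gcd n = e then (1 : ℂ) else 0) * χ (h : ZMod p) := by
        split_ifs <;> simp
      rw [h4, h3, Finset.sum_mul]
      refine Finset.sum_congr rfl fun d _ => ?_
      split_ifs <;> simp
    rw [Finset.sum_congr rfl h2, Finset.sum_comm]
    refine Finset.sum_congr rfl fun d _ => ?_
    rw [← Finset.sum_filter, Finset.mul_sum]
  rw [h1]
  have hB0 : 0 ≤ √(p : ℝ) * (1 + Real.log p) := (norm_nonneg _).trans (pv_Icc p χ hχ 0)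
  refine (norm_sum_le _ _).trans ?_
  calc _ ≤ ∑ d ∈ (n / e).divisors, √(p : ℝ) * (1 + Real.log p) := by
        refine Finset.sum_le_sum fun d hd => ?_
        have hd0 : 0 < d := Nat.pos_of_mem_divisors hd
        rw [sum_multiples n (d * e) (Nat.mul_pos hd0 he0) (fun h => χ (h : ZMod p))]
        have h5 : ∑ m ∈ Finset.Icc 1 (n / (d * e)), χ ((d * e * m : ℕ) : ZMod p) = χ ((d * e : ℕ) : ZMod p) * ∑ m ∈ Finset.Icc 1 (n / (d * e)), χ (m : ZMod p) := by
          rw [Finset.mul_sum]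
          refine Finset.sum_congr rfl fun m _ => ?_
          rw [← map_mul]
          push_cast
          rfl
        rw [h5, norm_mul, norm_mul]
        have h6 : ‖(ArithmeticFunction.moebius d : ℂ)‖ ≤ 1 := by
          rw [Complex.norm_intCast]
          exact_mod_cast ArithmeticFunction.abs_moebius_le_one
        calc _ ≤ 1 * (1 * (√(p : ℝ) * (1 + Real.log p))) := by
              gcongr
              · exact DirichletCharacter.norm_le_one _ _
              · exact pv_Icc p χ hχ _
          _ = _ := by ring
    _ = ((n / e).divisors.card : ℝ) * (√(p : ℝ) * (1 + Real.log p)) := by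
      rw [Finset.sum_const, nsmul_eq_mul]
    _ ≤ _ := by
      gcongr
      exact Nat.div_dvd_of_dvd he

lemma gcd_count (n e : ℕ) (hn : 0 < n) (he : e ∣ n) :
    ((Finset.Icc 1 n).filter (fun h : ℕ => h.gcd n = e)).card = (n / e).totient := by
  rw [Nat.totient_div_of_dvd he]
  refine Finset.card_nbij' (fun h => if h = n then 0 else h) (fun h => if h = 0 then n else h) ?_ ?_ ?_ ?_
  · intro h hh
    simp only [Finset.coe_filter, Finset.mem_Icc, Set.mem_ofPred_eq, Finset.mem_range] at hh ⊢
    split_ifs with h1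
    · subst h1
      simp only [Nat.gcd_self] at hh
      simp [hh.2]
      omega
    · rw [Nat.gcd_comm]; exact ⟨by omega, hh.2⟩
  · intro h hh
    simp only [Finset.coe_filter, Finset.mem_Icc, Set.mem_ofPred_eq, Finset.mem_range] at hh ⊢
    split_ifs with h1
    · subst h1
      simp only [Nat.gcd_zero_right] at hh
      simp [hh.2]; omega
    · rw [Nat.gcd_comm]; exact ⟨by omega, hh.2⟩
  · intro h hh
    simp only [Finset.coe_filter, Finset.mem_Icc, Set.mem_ofPred_eq] at hh
    simp only
    split_ifs <;> omega
  · intro h hh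
    simp only [Finset.coe_filter, Finset.mem_range, Set.mem_ofPred_eq] at hh
    simp only
    split_ifs <;> omega

end P20
end SW

namespace SW
section P21
open MeasureTheory Filter Topology

noncomputable def Gp (p : ℕ) : ℕ := Nat.card {h : ℕ // 1 ≤ h ∧ h ≤ p - 1 ∧ ∃ g : ℕ, 1 ≤ g ∧ g ≤ p - 1 ∧
              g ^ h ≡ h [MOD p]}

lemma cop (p : ℕ) [Fact p.Prime] (h : ℕ) (h1 : 1 ≤ h) (h2 : h ≤ p - 1) : h.Coprime p := by
  have hp := (Fact.out : p.Prime)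
  exact ((Nat.Prime.coprime_iff_not_dvd hp).2 (Nat.not_dvd_of_pos_of_lt (by omega) (by have := hp.two_le; omega))).symm

lemma residue_iff (p : ℕ) [Fact p.Prime] (h : ℕ) (h1 : 1 ≤ h) (h2 : h ≤ p - 1) :
    (∃ g : ℕ, 1 ≤ g ∧ g ≤ p - 1 ∧ g ^ h ≡ h [MOD p]) ↔ ∃ y : (ZMod p)ˣ, y ^ (h.gcd (p - 1)) = ZMod.unitOfCoprime h (cop p h h1 h2) := by
  have hp := (Fact.out : p.Prime)
  constructor
  · rintro ⟨g, g1, g2, hg⟩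
    have h3 : (ZMod.unitOfCoprime g (cop p g g1 g2)) ^ h = ZMod.unitOfCoprime h (cop p h h1 h2) := by
      ext
      rw [Units.val_pow_eq_pow_val, ZMod.coe_unitOfCoprime, ZMod.coe_unitOfCoprime]
      have := (ZMod.natCast_eq_natCast_iff _ _ _).2 hg
      push_cast at this
      exact this
    refine ⟨(ZMod.unitOfCoprime g (cop p g g1 g2)) ^ (h / h.gcd (p - 1)), ?_⟩
    rw [← pow_mul, Nat.div_mul_cancel (Nat.gcd_dvd_left _ _), h3]
  · rintro ⟨y, hy⟩
    have hz : (y ^ (h.gcdA (p - 1))) ^ h = ZMod.unitOfCoprime h (cop p h h1 h2) := by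
      rw [← hy, ← zpow_natCast, ← zpow_natCast, Nat.gcd_eq_gcd_ab, zpow_add, ← zpow_mul, mul_comm, zpow_mul y ((p - 1 : ℕ) : ℤ), zpow_natCast, ZMod.units_pow_card_sub_one_eq_one, one_zpow, mul_one]
    refine ⟨((y ^ (h.gcdA (p - 1)) : (ZMod p)ˣ) : ZMod p).val, ?_, ?_, ?_⟩
    · have : ((y ^ (h.gcdA (p - 1)) : (ZMod p)ˣ) : ZMod p) ≠ 0 := Units.ne_zero _
      have := (ZMod.val_ne_zero _).2 this
      omega
    · have := ZMod.val_lt ((y ^ (h.gcdA (p - 1)) : (ZMod p)ˣ) : ZMod p)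
      omega
    · rw [← ZMod.natCast_eq_natCast_iff]
      rw [Nat.cast_pow, ZMod.natCast_zmod_val, ← Units.val_pow_eq_pow_val, hz, ZMod.coe_unitOfCoprime]

lemma Gp_eq (p : ℕ) [Fact p.Prime] (χ : ℕ → DirichletCharacter ℂ p) (hχ : ∀ e, e ∣ p - 1 → orderOf (χ e) = e ∧ ∀ u : (ZMod p)ˣ, (χ e (u : ZMod p) = 1 ↔ ∃ y : (ZMod p)ˣ, y ^ e = u)) :
    (Gp p : ℂ) = ∑ e ∈ (p - 1).divisors, (1 / (e : ℂ)) * ∑ j ∈ Finset.range e, ∑ h ∈ (Finset.Icc 1 (p - 1)).filter (fun h : ℕ => h.gcd (p - 1) = e), (χ e (h : ZMod p)) ^ j := by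
  classical
  have hp := (Fact.out : p.Prime)
  have hn : 0 < p - 1 := by have := hp.two_le; omega
  have h1 : Gp p = ((Finset.Icc 1 (p - 1)).filter (fun h : ℕ => ∃ g : ℕ, 1 ≤ g ∧ g ≤ p - 1 ∧ g ^ h ≡ h [MOD p])).card := by
    rw [Gp]
    refine Nat.subtype_card _ fun h => ?_
    rw [Finset.mem_filter, Finset.mem_Icc, and_assoc]
  rw [h1, Finset.card_filter]
  push_cast
  rw [← Finset.sum_fiberwise_of_maps_to (s := Finset.Icc 1 (p - 1)) (t := (p - 1).divisors) (g := fun h : ℕ => h.gcd (p - 1)) (fun h hh => by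
    rw [Nat.mem_divisors]; exact ⟨Nat.gcd_dvd_right _ _, hn.ne'⟩)]
  refine Finset.sum_congr rfl fun e he => ?_
  have hed := Nat.dvd_of_mem_divisors he
  have he0 : (e : ℂ) ≠ 0 := by
    have := Nat.pos_of_mem_divisors he
    exact_mod_cast this.ne'
  obtain ⟨ho, hr⟩ := hχ e hed
  rw [Finset.sum_comm, Finset.mul_sum]
  refine Finset.sum_congr rfl fun h hh => ?_
  rw [Finset.mem_filter, Finset.mem_Icc] at hh
  obtain ⟨⟨ha, hb⟩, hc⟩ := hh
  have hres := residue_iff p h ha hb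
  have h2 := hr (ZMod.unitOfCoprime h (cop p h ha hb))
  rw [hc] at hres
  rw [ZMod.coe_unitOfCoprime] at h2
  have h3 : χ e (h : ZMod p) ^ e = 1 := by
    have := MulChar.pow_apply_coe (χ e) e (ZMod.unitOfCoprime h (cop p h ha hb))
    rw [ZMod.coe_unitOfCoprime] at this
    rw [← this]
    have h4 : χ e ^ e = 1 := by
      have := pow_orderOf_eq_one (χ e)
      rwa [ho] at this
    rw [h4]
    have := MulChar.one_apply_coe (R' := ℂ) (ZMod.unitOfCoprime h (cop p h ha hb))
    rwa [ZMod.coe_unitOfCoprime] at this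
  rw [geom_char e _ h3]
  simp only [h2, ← hres]
  split_ifs
  · field_simp
  · simp

lemma totient_moebius (m : ℕ) (hm : 0 < m) : ∑ d ∈ m.divisors, cA d = (m.totient : ℝ) / m := by
  have h := (ArithmeticFunction.sum_eq_iff_sum_mul_moebius_eq (f := fun n => (n.totient : ℝ)) (g := fun n => (n : ℝ))).1 (fun n hn => by
    exact_mod_cast Nat.sum_totient n) m hm
  rw [← h, Nat.sum_divisorsAntidiagonal (fun i j => (ArithmeticFunction.moebius i : ℝ) * (j : ℝ)), Finset.sum_div]
  refine Finset.sum_congr rfl fun d hd => ?_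
  have hdm := Nat.dvd_of_mem_divisors hd
  have hd0 : (d : ℝ) ≠ 0 := by exact_mod_cast (Nat.pos_of_mem_divisors hd).ne'
  have hm0 : (m : ℝ) ≠ 0 := by exact_mod_cast hm.ne'
  simp only [cA, ArithmeticFunction.coe_mk]
  rw [Nat.cast_div hdm hd0]
  field_simp

lemma ff_eq (n : ℕ) (hn : 0 < n) : ff n * n = ∑ e ∈ n.divisors, 1 / (e : ℝ) * ((n / e).totient : ℝ) := by
  have h1 : ff n = (cB * (cA * (ArithmeticFunction.zeta : ArithmeticFunction ℝ))) n := by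
    rw [ff, ← ArithmeticFunction.coe_mul_zeta_apply, cc, ← mul_assoc, mul_comm cA cB]
  rw [h1, ArithmeticFunction.mul_apply, Nat.sum_divisorsAntidiagonal (fun i j => cB i * (cA * (ArithmeticFunction.zeta : ArithmeticFunction ℝ)) j), Finset.sum_mul]
  refine Finset.sum_congr rfl fun e he => ?_
  have hdm := Nat.dvd_of_mem_divisors he
  have hpos := Nat.div_pos (Nat.le_of_dvd hn hdm) (Nat.pos_of_mem_divisors he)
  have hd0 : (e : ℝ) ≠ 0 := by exact_mod_cast (Nat.pos_of_mem_divisors he).ne'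
  have hm0 : (n : ℝ) ≠ 0 := by exact_mod_cast hn.ne'
  rw [ArithmeticFunction.coe_mul_zeta_apply, totient_moebius _ hpos, Nat.cast_div hdm hd0]
  simp only [cB, ArithmeticFunction.coe_mk]
  field_simp

lemma Gp_bound (p : ℕ) [Fact p.Prime] :
    |(Gp p : ℝ) - ff (p - 1) * ((p - 1 : ℕ) : ℝ)| ≤ ((p - 1).divisors.card : ℝ) ^ 2 * (√(p : ℝ) * (1 + Real.log p)) := by
  have hp := (Fact.out : p.Prime)
  have hn : 0 < p - 1 := by have := hp.two_le; omega
  have hex : ∀ e : ℕ, ∃ χ : DirichletCharacter ℂ p, e ∣ p - 1 → orderOf χ = e ∧ ∀ u : (ZMod p)ˣ, (χ (u : ZMod p) = 1 ↔ ∃ y : (ZMod p)ˣ, y ^ e = u) := by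
    intro e
    by_cases he : e ∣ p - 1
    · obtain ⟨χ, h⟩ := char_residue p e he
      exact ⟨χ, fun _ => h⟩
    · exact ⟨1, fun h => absurd h he⟩
  choose χ hχ using hex
  have hG := Gp_eq p χ hχ
  set n := p - 1 with hnd
  set B := √(p : ℝ) * (1 + Real.log p) with hB
  have hB0 : 0 ≤ B := by
    have : (1 : ℝ) ≤ p := by exact_mod_cast hp.one_le
    have := Real.log_nonneg this
    positivity
  have hF : ((ff n * (n : ℝ) : ℝ) : ℂ) = ∑ e ∈ n.divisors, (1 / (e : ℂ)) * ((n / e).totient : ℂ) := by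
    rw [ff_eq n hn]; push_cast; rfl
  have h1 : ((Gp p : ℝ) - ff n * (n : ℝ) : ℝ) = (Gp p : ℂ) - ((ff n * (n : ℝ) : ℝ) : ℂ) := by push_cast; rfl
  rw [← Real.norm_eq_abs, ← Complex.norm_real, h1, hG, hF, ← Finset.sum_sub_distrib]
  refine (norm_sum_le _ _).trans ?_
  calc _ ≤ ∑ e ∈ n.divisors, (n.divisors.card : ℝ) * B := by
        refine Finset.sum_le_sum fun e he => ?_
        have hed := Nat.dvd_of_mem_divisors he
        have hepos := Nat.pos_of_mem_divisors he
        have he0 : (0 : ℝ) < e := by exact_mod_cast hepos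
        obtain ⟨ho, hr⟩ := hχ e hed
        rw [← mul_sub, norm_mul]
        have hr1 : Finset.range e = Finset.range ((e - 1) + 1) := by congr 1; omega
        have h2 : ∑ j ∈ Finset.range e, ∑ h ∈ (Finset.Icc 1 n).filter (fun h : ℕ => h.gcd n = e), (χ e (h : ZMod p)) ^ j - ((n / e).totient : ℂ) = ∑ j ∈ Finset.range (e - 1), ∑ h ∈ (Finset.Icc 1 n).filter (fun h : ℕ => h.gcd n = e), ((χ e) ^ (j + 1)) (h : ZMod p) := by
          rw [hr1, Finset.sum_range_succ', sub_eq_iff_eq_add]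
          congr 1
          · refine Finset.sum_congr rfl fun j _ => Finset.sum_congr rfl fun h _ => ?_
            rw [MulChar.pow_apply' _ (by omega)]
          · simp only [pow_zero, Finset.sum_const, nsmul_eq_mul, mul_one]
            rw [gcd_count n e hn hed]
        rw [h2]
        have h3 : ‖∑ j ∈ Finset.range (e - 1), ∑ h ∈ (Finset.Icc 1 n).filter (fun h : ℕ => h.gcd n = e), ((χ e) ^ (j + 1)) (h : ZMod p)‖ ≤ e * ((n.divisors.card : ℝ) * B) := by
          refine (norm_sum_le _ _).trans ?_
          calc _ ≤ ∑ j ∈ Finset.range (e - 1), (n.divisors.card : ℝ) * B := by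
                refine Finset.sum_le_sum fun j hj => ?_
                rw [Finset.mem_range] at hj
                refine gcd_char_sum p _ ?_ n e hn hed
                exact pow_ne_one_of_lt_orderOf (by omega) (by rw [ho]; omega)
            _ = ((e - 1 : ℕ) : ℝ) * ((n.divisors.card : ℝ) * B) := by
              rw [Finset.sum_const, nsmul_eq_mul, Finset.card_range]
            _ ≤ _ := by
              gcongr
              exact Nat.sub_le _ _
        rw [norm_div, norm_one, Complex.norm_natCast]
        calc _ ≤ 1 / (e : ℝ) * (e * ((n.divisors.card : ℝ) * B)) := by gcongr
          _ = _ := by field_simp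
    _ = _ := by rw [Finset.sum_const, nsmul_eq_mul]; ring

end P21
end SW

namespace SW
section P22
open MeasureTheory Filter Topology

lemma Gp_err : ∃ C > 0, ∀ p : ℕ, p.Prime →
    |(Gp p : ℝ) / ((p - 1 : ℕ) : ℝ) - ff (p - 1)| ≤ C * (p : ℝ) ^ (-(1 / 4) : ℝ) := by
  obtain ⟨C1, hC1, h1⟩ := divisor_bound (ε := 1 / 16) (by norm_num)
  obtain ⟨C2, hC2, h2⟩ := log_pow_le 1 (ε := 1 / 8) (by norm_num)
  have hC1' : 0 < C1 := by linarith
  refine ⟨2 * (C1 ^ 2 * (1 + C2)), by positivity, fun p hp => ?_⟩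
  have : Fact p.Prime := ⟨hp⟩
  have hb := Gp_bound p
  have hn : 0 < p - 1 := by have := hp.two_le; omega
  have hn0 : (0 : ℝ) < ((p - 1 : ℕ) : ℝ) := by exact_mod_cast hn
  have hp0 : (0 : ℝ) < p := by exact_mod_cast hp.pos
  have hp1 : (1 : ℝ) ≤ p := by exact_mod_cast hp.one_le
  have hnp : (p : ℝ) ≤ 2 * ((p - 1 : ℕ) : ℝ) := by
    have : p ≤ 2 * (p - 1) := by have := hp.two_le; omega
    exact_mod_cast this
  have hnp' : ((p - 1 : ℕ) : ℝ) ≤ p := by exact_mod_cast Nat.sub_le p 1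
  have hd := h1 (p - 1) hn.ne'
  have hd2 : ((p - 1).divisors.card : ℝ) ≤ C1 * (p : ℝ) ^ (1 / 16 : ℝ) := by
    refine hd.trans ?_
    gcongr
  have hl : 1 + Real.log p ≤ (1 + C2) * (p : ℝ) ^ (1 / 8 : ℝ) := by
    have := h2 p hp1
    rw [pow_one] at this
    have h3 := Real.one_le_rpow hp1 (z := 1 / 8) (by norm_num)
    linarith
  have hl0 : 0 ≤ 1 + Real.log p := by
    have := Real.log_nonneg hp1
    linarith
  have hmain : |(Gp p : ℝ) - ff (p - 1) * ((p - 1 : ℕ) : ℝ)| ≤ C1 ^ 2 * (1 + C2) * (p : ℝ) ^ (3 / 4 : ℝ) := by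
    refine hb.trans ?_
    calc _ ≤ (C1 * (p : ℝ) ^ (1 / 16 : ℝ)) ^ 2 * (√(p : ℝ) * ((1 + C2) * (p : ℝ) ^ (1 / 8 : ℝ))) := by gcongr
      _ = C1 ^ 2 * (1 + C2) * ((p : ℝ) ^ (1 / 16 : ℝ) * (p : ℝ) ^ (1 / 16 : ℝ) * (p : ℝ) ^ (1 / 2 : ℝ) * (p : ℝ) ^ (1 / 8 : ℝ)) := by
        rw [Real.sqrt_eq_rpow]; ring
      _ = _ := by
        rw [← Real.rpow_add hp0, ← Real.rpow_add hp0, ← Real.rpow_add hp0]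
        norm_num
  have e : (Gp p : ℝ) / ((p - 1 : ℕ) : ℝ) - ff (p - 1) = ((Gp p : ℝ) - ff (p - 1) * ((p - 1 : ℕ) : ℝ)) / ((p - 1 : ℕ) : ℝ) := by
    field_simp
  rw [e, abs_div, abs_of_pos hn0, div_le_iff₀ hn0]
  refine hmain.trans ?_
  calc C1 ^ 2 * (1 + C2) * (p : ℝ) ^ (3 / 4 : ℝ) = C1 ^ 2 * (1 + C2) * ((p : ℝ) ^ (-(1 / 4) : ℝ) * p) := by
        congr 1
        conv_rhs => rw [← Real.rpow_add_one hp0.ne']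
        norm_num
    _ ≤ C1 ^ 2 * (1 + C2) * ((p : ℝ) ^ (-(1 / 4) : ℝ) * (2 * ((p - 1 : ℕ) : ℝ))) := by gcongr
    _ = _ := by ring

lemma Gp_err_sum : ∃ C > 0, ∀ x : ℝ, 49 ≤ x →
    |∑ p ∈ (Finset.Icc 1 ⌊x⌋₊).filter Nat.Prime, ((Gp p : ℝ) / ((p - 1 : ℕ) : ℝ) - ff (p - 1))| ≤ C * x ^ (7 / 8 : ℝ) := by
  obtain ⟨C1, hC1, h1⟩ := Gp_err
  refine ⟨2 * C1, by positivity, fun x hx => ?_⟩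
  have hx0 : 0 < x := by linarith
  set N := ⌊x⌋₊ with hN
  set M := ⌊√x⌋₊ with hM
  have hNx : (N : ℝ) ≤ x := Nat.floor_le hx0.le
  have hMx : (M : ℝ) ≤ √x := Nat.floor_le (Real.sqrt_nonneg _)
  refine (Finset.abs_sum_le_sum_abs _ _).trans ?_
  have hterm : ∀ p ∈ (Finset.Icc 1 N).filter Nat.Prime, |(Gp p : ℝ) / ((p - 1 : ℕ) : ℝ) - ff (p - 1)| ≤ (if p ∈ Finset.Icc 1 M then C1 else 0) + C1 * x ^ (-(1 / 8) : ℝ) := by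
    intro p hp
    rw [Finset.mem_filter, Finset.mem_Icc] at hp
    refine (h1 p hp.2).trans ?_
    have hp1 : (1 : ℝ) ≤ p := by exact_mod_cast hp.1.1
    split_ifs with h
    · have h2 : (p : ℝ) ^ (-(1 / 4) : ℝ) ≤ 1 := Real.rpow_le_one_of_one_le_of_nonpos hp1 (by norm_num)
      have h3 : 0 ≤ C1 * x ^ (-(1 / 8) : ℝ) := by positivity
      nlinarith
    · rw [zero_add]
      gcongr
      have h4 : M < p := by
        rw [Finset.mem_Icc] at h; omega
      have h5 : √x ≤ p := (Nat.lt_of_floor_lt h4).le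
      calc (p : ℝ) ^ (-(1 / 4) : ℝ) ≤ (√x) ^ (-(1 / 4) : ℝ) :=
            Real.rpow_le_rpow_of_nonpos (by positivity) h5 (by norm_num)
        _ = _ := by
          rw [Real.sqrt_eq_rpow, ← Real.rpow_mul hx0.le]; norm_num
  refine (Finset.sum_le_sum hterm).trans ?_
  have hle : ∑ p ∈ (Finset.Icc 1 N).filter Nat.Prime, ((if p ∈ Finset.Icc 1 M then C1 else 0) + C1 * x ^ (-(1 / 8) : ℝ)) ≤ ∑ p ∈ Finset.Icc 1 N, ((if p ∈ Finset.Icc 1 M then C1 else 0) + C1 * x ^ (-(1 / 8) : ℝ)) := by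
    refine Finset.sum_le_sum_of_subset_of_nonneg (Finset.filter_subset _ _) fun i _ _ => ?_
    have h3 : 0 ≤ C1 * x ^ (-(1 / 8) : ℝ) := by positivity
    split_ifs <;> linarith
  refine hle.trans ?_
  rw [Finset.sum_add_distrib, ← Finset.sum_filter, Finset.sum_const, Finset.sum_const, nsmul_eq_mul, nsmul_eq_mul, Nat.card_Icc, Nat.add_sub_cancel]
  have hc : (((Finset.Icc 1 N).filter (fun p => p ∈ Finset.Icc 1 M)).card : ℝ) ≤ M := by
    have : ((Finset.Icc 1 N).filter (fun p => p ∈ Finset.Icc 1 M)).card ≤ (Finset.Icc 1 M).card :=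
      Finset.card_le_card fun a ha => (Finset.mem_filter.1 ha).2
    rw [Nat.card_Icc, Nat.add_sub_cancel] at this
    exact_mod_cast this
  have hs : √x ≤ x ^ (7 / 8 : ℝ) := by
    rw [Real.sqrt_eq_rpow]
    exact Real.rpow_le_rpow_of_exponent_le (by linarith) (by norm_num)
  have hx8 : x * x ^ (-(1 / 8) : ℝ) = x ^ (7 / 8 : ℝ) := by
    rw [mul_comm, ← Real.rpow_add_one hx0.ne']; norm_num
  calc _ ≤ √x * C1 + x * (C1 * x ^ (-(1 / 8) : ℝ)) := by
        gcongr
        exact hc.trans hMx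
    _ = √x * C1 + C1 * (x * x ^ (-(1 / 8) : ℝ)) := by ring
    _ ≤ x ^ (7 / 8 : ℝ) * C1 + C1 * x ^ (7 / 8 : ℝ) := by rw [hx8]; gcongr
    _ = _ := by ring

lemma avg_Gp (K : ℕ) : ∃ C > 0, ∀ x : ℝ, 49 ≤ x →
    |∑ p ∈ (Finset.Icc 1 ⌊x⌋₊).filter Nat.Prime, (Gp p : ℝ) / ((p - 1 : ℕ) : ℝ) - (∑' n, gg n) * ∫ t in (2 : ℝ)..x, 1 / Real.log t| ≤ C * (x / Real.log x ^ K) := by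
  obtain ⟨C1, hC1, h1⟩ := avg_ff K
  obtain ⟨C2, hC2, h2⟩ := Gp_err_sum
  obtain ⟨C3, hC3, h3⟩ := log_pow_le K (ε := 1 / 8) (by norm_num)
  refine ⟨C1 + C2 * C3, by positivity, fun x hx => ?_⟩
  have hx0 : 0 < x := by linarith
  have hl1 : 1 ≤ Real.log x := one_le_log (by linarith)
  have a1 := h1 x hx
  have a2 := h2 x hx
  have a3 := h3 x (by linarith)
  have a4 : x ^ (7 / 8 : ℝ) ≤ C3 * (x / Real.log x ^ K) := by
    rw [← mul_div_assoc, le_div_iff₀ (by positivity)]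
    calc x ^ (7 / 8 : ℝ) * Real.log x ^ K ≤ x ^ (7 / 8 : ℝ) * (C3 * x ^ (1 / 8 : ℝ)) := by gcongr
      _ = C3 * (x ^ (7 / 8 : ℝ) * x ^ (1 / 8 : ℝ)) := by ring
      _ = C3 * x := by rw [← Real.rpow_add hx0]; norm_num
  have a5 : C2 * x ^ (7 / 8 : ℝ) ≤ C2 * (C3 * (x / Real.log x ^ K)) := by gcongr
  rw [Finset.sum_sub_distrib] at a2
  rw [abs_le] at *
  constructor <;> nlinarith [a1.1, a1.2, a2.1, a2.2]

end P22
end SW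

open SW

theorem averaged_G_gANY_hANY (C : ℝ) (hC : 0 < C) :
    ∃ K : ℝ, ∀ x : ℝ, 2 ≤ x →
      |(∑ p ∈ Finset.filter Nat.Prime (Finset.Iic ⌊x⌋₊),
          (Nat.card {h : ℕ // 1 ≤ h ∧ h ≤ p - 1 ∧ ∃ g : ℕ, 1 ≤ g ∧ g ≤ p - 1 ∧
              g ^ h ≡ h [MOD p]} : ℝ) / ((p - 1 : ℕ) : ℝ)) -
        (∏' q : Nat.Primes, (1 - ((q : ℕ) : ℝ) / (((q : ℕ) : ℝ) ^ 3 - 1))) *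
          ∫ t in (2 : ℝ)..x, 1 / Real.log t| ≤ K * x / Real.log x ^ C := by
  obtain ⟨C1, hC1, h1⟩ := avg_Gp ⌈C⌉₊
  rw [← gg_tsum]
  have hfilt : ∀ N : ℕ, Finset.filter Nat.Prime (Finset.Iic N) = (Finset.Icc 1 N).filter Nat.Prime := by
    intro N
    ext a
    simp only [Finset.mem_filter, Finset.mem_Iic, Finset.mem_Icc]
    exact ⟨fun h => ⟨⟨h.2.one_le, h.1⟩, h.2⟩, fun h => ⟨h.1.2, h.2⟩⟩
  set T : ℝ := ∑ p ∈ Finset.Icc 1 49, (Gp p : ℝ) / ((p - 1 : ℕ) : ℝ) with hT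
  have hT0 : 0 ≤ T := Finset.sum_nonneg fun p _ => by positivity
  set S : ℝ := ∑' n, gg n with hS
  have hl49 : 0 < Real.log 49 := Real.log_pos (by norm_num)
  refine ⟨C1 + (T + |S| * 98) * Real.log 49 ^ C, fun x hx => ?_⟩
  have hx0 : 0 < x := by linarith
  have hlx : 0 < Real.log x := Real.log_pos (by linarith)
  have hlC : 0 < Real.log x ^ C := Real.rpow_pos_of_pos hlx C
  have hcomp : 0 ≤ (T + |S| * 98) * Real.log 49 ^ C := by positivity
  change |∑ p ∈ Finset.filter Nat.Prime (Finset.Iic ⌊x⌋₊), (Gp p : ℝ) / ((p - 1 : ℕ) : ℝ) - _| ≤ _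
  rw [hfilt]
  rcases le_or_gt 49 x with h49 | h49
  · refine (h1 x h49).trans ?_
    have hl1 : 1 ≤ Real.log x := one_le_log (by linarith)
    have h2 : Real.log x ^ C ≤ Real.log x ^ ⌈C⌉₊ := by
      rw [← Real.rpow_natCast]
      exact Real.rpow_le_rpow_of_exponent_le hl1 (Nat.le_ceil C)
    calc C1 * (x / Real.log x ^ ⌈C⌉₊) ≤ C1 * (x / Real.log x ^ C) := by gcongr
      _ = C1 * x / Real.log x ^ C := by ring
      _ ≤ _ := by gcongr; linarith
  · have h2 : ∑ p ∈ (Finset.Icc 1 ⌊x⌋₊).filter Nat.Prime, (Gp p : ℝ) / ((p - 1 : ℕ) : ℝ) ≤ T := by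
      refine Finset.sum_le_sum_of_subset_of_nonneg ?_ fun p _ _ => by positivity
      refine (Finset.filter_subset _ _).trans (Finset.Icc_subset_Icc_right ?_)
      exact Nat.floor_le_of_le (by push_cast; linarith)
    have h3 : 0 ≤ ∑ p ∈ (Finset.Icc 1 ⌊x⌋₊).filter Nat.Prime, (Gp p : ℝ) / ((p - 1 : ℕ) : ℝ) :=
      Finset.sum_nonneg fun p _ => by positivity
    have h4 : |S * ∫ t in (2 : ℝ)..x, 1 / Real.log t| ≤ |S| * 98 := by
      rw [abs_mul]
      have := li_bound x hx
      gcongr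
      linarith
    have h5 : Real.log x ^ C ≤ Real.log 49 ^ C :=
      Real.rpow_le_rpow hlx.le (Real.log_le_log hx0 h49.le) hC.le
    have h6 : T + |S| * 98 ≤ (C1 + (T + |S| * 98) * Real.log 49 ^ C) * x / Real.log x ^ C := by
      rw [le_div_iff₀ hlC]
      calc (T + |S| * 98) * Real.log x ^ C ≤ (T + |S| * 98) * Real.log 49 ^ C := by gcongr
        _ ≤ (C1 + (T + |S| * 98) * Real.log 49 ^ C) * 1 := by linarith
        _ ≤ _ := by gcongr; linarith
    refine le_trans ?_ h6
    rw [abs_le] at *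
    constructor <;> linarith [h4.1, h4.2]
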